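/- arXiv:2008.12698 — 2 statements merged into one kernel-verified Lean document; each statement's English description precedes it below -/
import Mathlib

section
/- If f₁,…,f_k ∈ ℝ[x₁,…,x_d] are such that the basic closed semi-algebraic set K(f) is compact, then the preordering T(f) is Archimedean: for every p ∈ ℝ[x₁,…,x_d] there exists λ > 0 such that λ − p ∈ T(f) and λ + p ∈ T(f). -/
/-- A sum of squares of polynomials. -/
def IsSOS {d : ℕ} (p : MvPolynomial (Fin d) ℝ) : Prop :=
  ∃ (n : ℕ) (q : Fin n → MvPolynomial (Fin d) ℝ), p = ∑ i, (q i) ^ 2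

/-- Membership in the preordering `T(f)` generated by `f 0, …, f (k-1)`. -/
def InPreordering {d k : ℕ} (f : Fin k → MvPolynomial (Fin d) ℝ)
    (p : MvPolynomial (Fin d) ℝ) : Prop :=
  ∃ σ : (Fin k → Bool) → MvPolynomial (Fin d) ℝ,
    (∀ e, IsSOS (σ e)) ∧
    p = ∑ e : Fin k → Bool, (∏ i, if e i then f i else 1) * σ e

/-- The basic closed semi-algebraic set `K(f)`. -/
def SemiAlgSet {d k : ℕ} (f : Fin k → MvPolynomial (Fin d) ℝ) : Set (Fin d → ℝ) :=
  {x | ∀ i, 0 ≤ MvPolynomial.eval x (f i)}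


section helpers
set_option linter.unusedSectionVars false
open Polynomial

def PolyIVT (R : Type*) [Field R] [LinearOrder R] : Prop :=
  ∀ (p : R[X]) (a b : R), a < b → p.eval a < 0 → 0 < p.eval b →
    ∃ c, a < c ∧ c < b ∧ p.eval c = 0

section ivt
variable {R : Type*} [Field R] [LinearOrder R] [IsStrictOrderedRing R]

lemma PolyIVT.mul_neg (h : PolyIVT R) (p : R[X]) (a b : R) (hab : a < b)
    (hs : p.eval a * p.eval b < 0) : ∃ c, a < c ∧ c < b ∧ p.eval c = 0 := by
  rcases mul_neg_iff.1 hs with ⟨h1, h2⟩ | ⟨h1, h2⟩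
  · obtain ⟨c, hc1, hc2, hc3⟩ := h (-p) a b hab (by simpa using h1) (by simpa using h2)
    exact ⟨c, hc1, hc2, by simpa using hc3⟩
  · exact h p a b hab h1 h2

lemma rolle_aux (h : PolyIVT R) (p : R[X]) (hp : p ≠ 0) (a b : R) (hab : a < b)
    (ha : p.eval a = 0) (hb : p.eval b = 0) (hno : ∀ c, a < c → c < b → p.eval c ≠ 0) :
    ∃ c, a < c ∧ c < b ∧ p.derivative.eval c = 0 := by
  obtain ⟨q, hq, hqa⟩ := Polynomial.exists_eq_pow_rootMultiplicity_mul_and_not_dvd p hp a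
  have hm : 0 < p.rootMultiplicity a := (Polynomial.rootMultiplicity_pos hp).2 ha
  obtain ⟨m, hm⟩ : ∃ m, p.rootMultiplicity a = m + 1 := ⟨_, (Nat.succ_pred_eq_of_pos hm).symm⟩
  rw [hm] at hq
  have hq0 : q ≠ 0 := by rintro rfl; simp at hqa
  have hba : b - a ≠ 0 := sub_ne_zero.2 hab.ne'
  have hqb : q.eval b = 0 := by
    rw [hq] at hb
    simpa [hba] using hb
  obtain ⟨s, hs, hsb⟩ := Polynomial.exists_eq_pow_rootMultiplicity_mul_and_not_dvd q hq0 b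
  have hn : 0 < q.rootMultiplicity b := (Polynomial.rootMultiplicity_pos hq0).2 hqb
  obtain ⟨n, hn⟩ : ∃ n, q.rootMultiplicity b = n + 1 := ⟨_, (Nat.succ_pred_eq_of_pos hn).symm⟩
  rw [hn] at hs
  rw [Polynomial.dvd_iff_isRoot, IsRoot] at hqa hsb
  have hsa : s.eval a ≠ 0 := by
    intro h0; apply hqa; rw [hs]; simp [h0]
  have hsab : 0 < s.eval a * s.eval b := by
    by_contra hcon
    have : s.eval a * s.eval b < 0 := lt_of_le_of_ne (not_lt.1 hcon) (mul_ne_zero hsa hsb)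
    obtain ⟨c, h1, h2, h3⟩ := h.mul_neg s a b hab this
    apply hno c h1 h2
    rw [hq, hs]; simp [h3]
  let t : R[X] := C ((m + 1 : ℕ) : R) * (X - C b) * s + C ((n + 1 : ℕ) : R) * (X - C a) * s
    + (X - C a) * (X - C b) * derivative s
  have hta : t.eval a = (m+1) * (a - b) * s.eval a := by simp [t]
  have htb : t.eval b = (n+1) * (b - a) * s.eval b := by simp [t]
  have hneg : t.eval a * t.eval b < 0 := by
    rw [hta, htb]
    have h1 : (0:R) < (m+1) := by positivity
    have h2 : (0:R) < (n+1) := by positivity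
    have h3 : (0:R) < b - a := sub_pos.2 hab
    have h4 := mul_pos (mul_pos (mul_pos h1 h2) (mul_pos h3 h3)) hsab
    nlinarith
  obtain ⟨c, h1, h2, h3⟩ := h.mul_neg t a b hab hneg
  refine ⟨c, h1, h2, ?_⟩
  have : derivative p = (X - C a)^m * (X - C b)^n * t := by
    rw [hq, hs]
    simp only [derivative_mul, derivative_X_sub_C_pow, t, Nat.add_sub_cancel]
    simp only [Nat.cast_add, Nat.cast_one, map_add, map_natCast, map_one]
    ring
  rw [this]; simp [h3]

lemma rolle (h : PolyIVT R) (p : R[X]) (a b : R) (hab : a < b)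
    (ha : p.eval a = 0) (hb : p.eval b = 0) :
    ∃ c, a < c ∧ c < b ∧ p.derivative.eval c = 0 := by
  by_cases hp : p = 0
  · obtain ⟨c, h1, h2⟩ := exists_between hab
    exact ⟨c, h1, h2, by simp [hp]⟩
  have hne : (p.roots.toFinset.filter (fun c => a < c ∧ c ≤ b)).Nonempty :=
    ⟨b, by simp [hp, hb, hab]⟩
  obtain ⟨b', hb', hmin⟩ := Finset.exists_min_image _ id hne
  simp only [Finset.mem_filter, Multiset.mem_toFinset, mem_roots hp, IsRoot, id] at hb' hmin
  obtain ⟨c, h1, h2, h3⟩ := rolle_aux h p hp a b' hb'.2.1 ha hb'.1 (fun c h1 h2 h3 =>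
    absurd (hmin c ⟨h3, h1, h2.le.trans hb'.2.2⟩) (not_le.2 h2))
  exact ⟨c, h1, h2.trans_le hb'.2.2, h3⟩

lemma poly_mono (h : PolyIVT R) (p : R[X]) (a b : R) (hab : a < b)
    (hd : ∀ c, a < c → c < b → 0 < p.derivative.eval c) : p.eval a < p.eval b := by
  have hba : 0 < b - a := sub_pos.2 hab
  obtain ⟨c, h1, h2, h3⟩ := rolle h (p - C (p.eval a) -
    C ((p.eval b - p.eval a) / (b - a)) * (X - C a)) a b hab (by simp) (by
      simp [hba.ne'])
  have h4 := hd c h1 h2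
  simp [sub_eq_zero] at h3
  rw [h3] at h4
  have := (div_pos_iff_of_pos_right hba).1 h4
  linarith

lemma poly_top (p : R[X]) (n : ℕ) : p.natDegree = n + 1 → 0 < p.leadingCoeff →
    ∀ M : R, ∃ B, ∀ x, B ≤ x → M ≤ p.eval x := by
  induction n generalizing p with
  | zero =>
    intro hd hl M
    have hp := p.divX_mul_X_add
    have hd' : p.divX.natDegree = 0 := by rw [natDegree_divX_eq_natDegree_tsub_one]; omega
    obtain ⟨c, hc⟩ : ∃ c, p.divX = C c := ⟨_, eq_C_of_natDegree_eq_zero hd'⟩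
    have hlc : p.leadingCoeff = c := by
      have := p.coeff_divX (n := 0)
      rw [hc] at this
      simp [leadingCoeff, hd] at this ⊢
      exact this.symm
    rw [hlc] at hl
    refine ⟨(M - p.coeff 0) / c, fun x hx => ?_⟩
    rw [← hp, hc]
    simp
    rw [div_le_iff₀ hl] at hx
    linarith
  | succ n ih =>
    intro hd hl M
    have hp := p.divX_mul_X_add
    have hd' : p.divX.natDegree = n + 1 := by rw [natDegree_divX_eq_natDegree_tsub_one]; omega
    have hlc : p.divX.leadingCoeff = p.leadingCoeff := by
      rw [leadingCoeff, hd', coeff_divX, leadingCoeff, hd]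
    obtain ⟨B, hB⟩ := ih p.divX hd' (by rwa [hlc]) 1
    refine ⟨max B (max 0 (M - p.coeff 0)), fun x hx => ?_⟩
    have h1 := hB x ((le_max_left _ _).trans hx)
    have h2 : 0 ≤ x := ((le_max_left _ _).trans (le_max_right _ _)).trans hx
    have h3 : M - p.coeff 0 ≤ x := ((le_max_right _ _).trans (le_max_right _ _)).trans hx
    rw [← hp]
    simp
    nlinarith

lemma unbdd_right (h : PolyIVT R) (p : R[X]) (x₀ : R)
    (hd : ∀ x, x₀ < x → 0 < p.derivative.eval x) : ∃ x, x₀ < x ∧ 0 < p.eval x := by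
  have hdeg : p.natDegree ≠ 0 := by
    intro h0
    have := hd (x₀ + 1) (by linarith)
    rw [eq_C_of_natDegree_eq_zero h0] at this
    simp at this
  obtain ⟨n, hn⟩ := Nat.exists_eq_succ_of_ne_zero hdeg
  rcases lt_trichotomy 0 p.leadingCoeff with hl | hl | hl
  · obtain ⟨B, hB⟩ := poly_top p n hn hl 1
    refine ⟨max B (x₀ + 1), ?_, ?_⟩
    · exact lt_of_lt_of_le (by linarith) (le_max_right _ _)
    · exact lt_of_lt_of_le one_pos (hB _ (le_max_left _ _))
  · exfalso; have := leadingCoeff_eq_zero.1 hl.symm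
    simp [this] at hn
  · exfalso
    obtain ⟨B, hB⟩ := poly_top (-p) n (by simpa using hn) (by simpa using hl) (1 - p.eval x₀)
    have h1 := hB (max B (x₀+1)) (le_max_left _ _)
    have h2 : x₀ < max B (x₀ + 1) := lt_of_lt_of_le (by linarith) (le_max_right _ _)
    have h3 := poly_mono h p _ _ h2 (fun c hc _ => hd c hc)
    simp only [eval_neg] at h1
    linarith

lemma unbdd_left (h : PolyIVT R) (p : R[X]) (x₀ : R)
    (hd : ∀ x, x < x₀ → 0 < p.derivative.eval x) : ∃ x, x < x₀ ∧ p.eval x < 0 := by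
  obtain ⟨x, h1, h2⟩ := unbdd_right h (-(p.comp (-X))) (-x₀) (by
    intro x hx
    have := hd (-x) (by linarith)
    simpa [derivative_comp] using this)
  exact ⟨-x, by linarith, by simpa using h2⟩

end ivt
section cells
variable {F R : Type*} [Field F] [LinearOrder F] [IsStrictOrderedRing F]
  [Field R] [LinearOrder R] [IsStrictOrderedRing R]

def CRel (C : Finset (F × R)) (z : F) (x : R) : Prop :=
  ∀ c ∈ C, (z < c.1 ↔ x < c.2) ∧ (c.1 < z ↔ c.2 < x)


lemma CRel.convex {C : Finset (F × R)} {z : F} {x1 x2 m : R} (h1 : CRel C z x1) (h2 : CRel C z x2)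
    (hm1 : x1 ≤ m) (hm2 : m ≤ x2) : CRel C z m := by
  intro c hc
  have := h1 c hc
  have := h2 c hc
  grind


lemma CRel.difun {C : Finset (F × R)} {z z' : F} {x x' : R} (h1 : CRel C z x) (h2 : CRel C z x')
    (h3 : CRel C z' x) : CRel C z' x' := by
  intro c hc
  have := h1 c hc
  have := h2 c hc
  have := h3 c hc
  grind

def swapC (C : Finset (F × R)) : Finset (R × F) := C.map (Equiv.prodComm F R).toEmbedding


lemma rel_swap {C : Finset (F × R)} {z : F} {x : R} : CRel (swapC C) x z ↔ CRel C z x := by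
  simp only [CRel, swapC, Finset.forall_mem_map]
  refine forall_congr' fun c => forall_congr' fun hc => ?_
  simp
  grind

def negC (C : Finset (F × R)) : Finset (F × R) :=
  C.map (((Equiv.neg F).prodCongr (Equiv.neg R)).toEmbedding)

lemma rel_neg {C : Finset (F × R)} {z : F} {x : R} : CRel (negC C) (-z) (-x) ↔ CRel C z x := by
  simp only [CRel, negC, Finset.forall_mem_map]
  refine forall_congr' fun c => forall_congr' fun hc => ?_
  simp
  grind


lemma right_pt {C : Finset (F × R)} {z : F} {x : R} (h : CRel C z x) (hz : ∀ c ∈ C, c.1 ≠ z)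
    (S : Finset R) : ∃ m, x < m ∧ CRel C z m ∧ ∀ s ∈ S, s ≤ x ∨ m < s := by
  classical
  obtain ⟨m, h1, h2⟩ := Order.exists_between_finsets ({x} : Finset R)
    (((C.image Prod.snd) ∪ S).filter (fun y => x < y)) (by simp)
  have hxm := h1 x (by simp)
  refine ⟨m, hxm, ?_, ?_⟩
  · intro c hc
    have h3 := h c hc
    have h4 := hz c hc
    have h5 : x < c.2 → m < c.2 := fun hx => h2 c.2 (by
      simp only [Finset.mem_filter, Finset.mem_union, Finset.mem_image]
      exact ⟨Or.inl ⟨c, hc, rfl⟩, hx⟩)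
    grind
  · intro s hs
    by_cases hxs : x < s
    · right; exact h2 s (by simp [hs, hxs])
    · left; exact not_lt.1 hxs


lemma left_pt {C : Finset (F × R)} {z : F} {x : R} (h : CRel C z x) (hz : ∀ c ∈ C, c.1 ≠ z)
    (S : Finset R) : ∃ m, m < x ∧ CRel C z m ∧ ∀ s ∈ S, x ≤ s ∨ s < m := by
  classical
  obtain ⟨m, h1, h2⟩ := Order.exists_between_finsets 
    (((C.image Prod.snd) ∪ S).filter (fun y => y < x)) ({x} : Finset R) (by simp)
  have hxm := h2 x (by simp)
  refine ⟨m, hxm, ?_, ?_⟩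
  · intro c hc
    have h3 := h c hc
    have h4 := hz c hc
    have h5 : c.2 < x → c.2 < m := fun hx => h1 c.2 (by
      simp only [Finset.mem_filter, Finset.mem_union, Finset.mem_image]
      exact ⟨Or.inl ⟨c, hc, rfl⟩, hx⟩)
    grind
  · intro s hs
    by_cases hxs : s < x
    · right; exact h1 s (by simp [hs, hxs])
    · left; exact not_lt.1 hxs


lemma exists_rel {C : Finset (F × R)} (hC : ∀ c ∈ C, CRel C c.1 c.2) (z : F) :
    ∃ x, CRel C z x := by
  classical
  by_cases hz : ∃ c ∈ C, c.1 = z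
  · obtain ⟨c, hc, rfl⟩ := hz
    exact ⟨c.2, hC c hc⟩
  push Not at hz
  obtain ⟨m, h1, h2⟩ := Order.exists_between_finsets
    ((C.filter (fun c => c.1 < z)).image Prod.snd) ((C.filter (fun c => z < c.1)).image Prod.snd)
    (by
      intro x hx y hy
      simp only [Finset.mem_image, Finset.mem_filter] at hx hy
      obtain ⟨c, ⟨hc, hc1⟩, rfl⟩ := hx
      obtain ⟨d, ⟨hd, hd1⟩, rfl⟩ := hy
      exact ((hC c hc d hd).1).1 (hc1.trans hd1))
  refine ⟨m, fun c hc => ?_⟩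
  have h3 : c.1 < z → c.2 < m := fun h => h1 _ (Finset.mem_image.2 ⟨c, by simp [hc, h], rfl⟩)
  have h4 : z < c.1 → m < c.2 := fun h => h2 _ (Finset.mem_image.2 ⟨c, by simp [hc, h], rfl⟩)
  have := hz c hc
  grind

lemma near_neg (h : PolyIVT R) (p : R[X]) (b x : R) (hbx : b < x) (hb : p.eval b < 0) :
    ∃ y, b < y ∧ y < x ∧ p.eval y < 0 := by
  classical
  have hp : p ≠ 0 := by rintro rfl; simp at hb
  obtain ⟨m, h1, h2⟩ := Order.exists_between_finsets ({b} : Finset R)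
    (insert x (p.roots.toFinset.filter (fun y => b < y))) (by simp [hbx])
  have hbm := h1 b (by simp)
  refine ⟨m, hbm, h2 x (by simp), ?_⟩
  by_contra hcon
  rcases (not_lt.1 hcon).eq_or_lt with h0 | h0
  · exact lt_irrefl m (h2 m (by simp [hp, h0.symm, hbm]))
  · obtain ⟨c, hc1, hc2, hc3⟩ := h p b m hbm hb h0
    exact lt_asymm hc2 (h2 c (by simp [hp, hc3, hc1]))

lemma cell_neg (hF : PolyIVT F) (hR : PolyIVT R) (C : Finset (F × R))
    (hC : ∀ c ∈ C, CRel C c.1 c.2) (p : F[X]) (q : R[X])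
    (hs : ∀ c ∈ C, p.eval c.1 < 0 → q.eval c.2 < 0)
    (z : F) (x : R) (hzx : CRel C z x) (hz : ∀ c ∈ C, c.1 ≠ z)
    (hp : ∀ z', CRel C z' x → 0 < p.derivative.eval z')
    (hq : ∀ x', CRel C z x' → 0 < q.derivative.eval x')
    (hneg : p.eval z < 0) : ∃ x', CRel C z x' ∧ q.eval x' < 0 := by
  classical
  by_cases hne : (C.filter (fun c => c.1 < z)).Nonempty
  · obtain ⟨c, hc, hmax⟩ := Finset.exists_max_image _ (fun c => c.1) hne
    simp only [Finset.mem_filter] at hc hmax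
    obtain ⟨hc, hcz⟩ := hc
    have hcx : c.2 < x := (hzx c hc).2.1 hcz
    have hmon : p.eval c.1 < p.eval z := by
      apply poly_mono hF p _ _ hcz
      intro w hw1 hw2
      apply hp
      intro e he
      have h1 := hzx e he
      have h2 := hz e he
      have h3 := hmax e
      grind
    obtain ⟨y, hy1, hy2, hy3⟩ := near_neg hR q c.2 x hcx (hs c hc (hmon.trans hneg))
    refine ⟨y, ?_, hy3⟩
    intro e he
    have h1 := hzx e he
    have h2 := hz e he
    have h3 := hmax e
    have h4 := hC c hc e he
    grind
  · have hno : ∀ c ∈ C, ¬ c.1 < z := fun c hc h => hne ⟨c, by simp [hc, h]⟩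
    obtain ⟨y, h1, h2⟩ := unbdd_left hR q x (fun y hy => hq y (by
      intro e he
      have h1 := hzx e he
      have h2 := hz e he
      have h3 := hno e he
      grind))
    refine ⟨y, ?_, h2⟩
    intro e he
    have h1 := hzx e he
    have h2 := hz e he
    have h3 := hno e he
    grind

lemma cell_pos (hF : PolyIVT F) (hR : PolyIVT R) (C : Finset (F × R))
    (hC : ∀ c ∈ C, CRel C c.1 c.2) (p : F[X]) (q : R[X])
    (hs : ∀ c ∈ C, 0 < p.eval c.1 → 0 < q.eval c.2)
    (z : F) (x : R) (hzx : CRel C z x) (hz : ∀ c ∈ C, c.1 ≠ z)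
    (hp : ∀ z', CRel C z' x → 0 < p.derivative.eval z')
    (hq : ∀ x', CRel C z x' → 0 < q.derivative.eval x')
    (hneg : 0 < p.eval z) : ∃ x', CRel C z x' ∧ 0 < q.eval x' := by
  obtain ⟨x', h1, h2⟩ := cell_neg hF hR (negC C) (by
      simp only [negC, Finset.forall_mem_map]
      intro c hc
      exact rel_neg.2 (hC c hc)) (-(p.comp (-X))) (-(q.comp (-X))) (by
      simp only [negC, Finset.forall_mem_map]
      intro c hc
      simpa using hs c hc) (-z) (-x) (rel_neg.2 hzx) (by
      simp only [negC, Finset.forall_mem_map]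
      intro c hc
      simpa using hz c hc) (by
      intro z' hz'
      have := hp (-z') (by rw [← rel_neg]; simpa using hz')
      simpa [derivative_comp] using this) (by
      intro z' hz'
      have := hq (-z') (by rw [← rel_neg]; simpa using hz')
      simpa [derivative_comp] using this) (by simpa using hneg)
  exact ⟨-x', by rw [← rel_neg]; simpa using h1, by simpa using h2⟩

lemma cell_sign (hF : PolyIVT F) (hR : PolyIVT R) (C : Finset (F × R))
    (hC : ∀ c ∈ C, CRel C c.1 c.2) (p : F[X]) (q : R[X])
    (hs : ∀ c ∈ C, SignType.sign (p.eval c.1) = SignType.sign (q.eval c.2))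
    (z : F) (x : R) (hzx : CRel C z x) (hz : ∀ c ∈ C, c.1 ≠ z)
    (hp : ∀ z', CRel C z' x → 0 < p.derivative.eval z')
    (hq : ∀ x', CRel C z x' → 0 < q.derivative.eval x')
    (hroot : ∀ ζ ξ, CRel C ζ ξ → p.eval ζ = 0 → q.eval ξ = 0 →
      (z < ζ ↔ x < ξ) ∧ (ζ < z ↔ ξ < x)) :
    SignType.sign (p.eval z) = SignType.sign (q.eval x) := by
  have hx : ∀ c ∈ C, c.2 ≠ x := by
    intro c hc
    have h1 := hzx c hc
    have h2 := hz c hc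
    grind
  have hC' : ∀ c ∈ swapC C, CRel (swapC C) c.1 c.2 := by
    simp only [swapC, Finset.forall_mem_map]
    intro c hc
    exact rel_swap.2 (hC c hc)
  have neg1 : ∀ z', CRel C z' x → p.eval z' < 0 → ∃ x', CRel C z x' ∧ q.eval x' < 0 := by
    intro z' hz' hn
    obtain ⟨x', h1, h2⟩ := cell_neg hF hR C hC p q (fun c hc h => by
      have := hs c hc
      rw [sign_neg h] at this
      exact sign_eq_neg_one_iff.1 this.symm) z' x hz' (by
        intro c hc
        have h1 := hz' c hc
        have h2 := hx c hc
        grind) hp (fun x' hx' => hq x' (CRel.difun hz' hx' hzx)) hn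
    exact ⟨x', CRel.difun hz' h1 hzx, h2⟩
  have pos1 : ∀ z', CRel C z' x → 0 < p.eval z' → ∃ x', CRel C z x' ∧ 0 < q.eval x' := by
    intro z' hz' hn
    obtain ⟨x', h1, h2⟩ := cell_pos hF hR C hC p q (fun c hc h => by
      have := hs c hc
      rw [sign_pos h] at this
      exact sign_eq_one_iff.1 this.symm) z' x hz' (by
        intro c hc
        have h1 := hz' c hc
        have h2 := hx c hc
        grind) hp (fun x' hx' => hq x' (CRel.difun hz' hx' hzx)) hn
    exact ⟨x', CRel.difun hz' h1 hzx, h2⟩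
  have neg2 : ∀ x', CRel C z x' → q.eval x' < 0 → ∃ z', CRel C z' x ∧ p.eval z' < 0 := by
    intro x' hx' hn
    obtain ⟨z', h1, h2⟩ := cell_neg hR hF (swapC C) hC' q p (by
      simp only [swapC, Finset.forall_mem_map]
      intro c hc h
      have := hs c hc
      change q.eval c.2 < 0 at h
      rw [sign_neg h] at this
      exact sign_eq_neg_one_iff.1 this) x' z (rel_swap.2 hx') (by
        simp only [swapC, Finset.forall_mem_map]
        intro c hc
        have h1 := hx' c hc
        have h2 := hz c hc
        change c.2 ≠ x'
        grind) (fun w hw => hq w (rel_swap.1 hw))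
        (fun w hw => hp w (CRel.difun hx' hzx (rel_swap.1 hw))) hn
    exact ⟨z', CRel.difun hx' hzx (rel_swap.1 h1), h2⟩
  have pos2 : ∀ x', CRel C z x' → 0 < q.eval x' → ∃ z', CRel C z' x ∧ 0 < p.eval z' := by
    intro x' hx' hn
    obtain ⟨z', h1, h2⟩ := cell_pos hR hF (swapC C) hC' q p (by
      simp only [swapC, Finset.forall_mem_map]
      intro c hc h
      have := hs c hc
      change 0 < q.eval c.2 at h
      rw [sign_pos h] at this
      exact sign_eq_one_iff.1 this) x' z (rel_swap.2 hx') (by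
        simp only [swapC, Finset.forall_mem_map]
        intro c hc
        have h1 := hx' c hc
        have h2 := hz c hc
        change c.2 ≠ x'
        grind) (fun w hw => hq w (rel_swap.1 hw))
        (fun w hw => hp w (CRel.difun hx' hzx (rel_swap.1 hw))) hn
    exact ⟨z', CRel.difun hx' hzx (rel_swap.1 h1), h2⟩
  have conv1 : ∀ z1 z2 m, CRel C z1 x → CRel C z2 x → z1 ≤ m → m ≤ z2 → CRel C m x := by
    intro z1 z2 m h1 h2 h3 h4
    exact rel_swap.1 (CRel.convex (rel_swap.2 h1) (rel_swap.2 h2) h3 h4)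
  have mono1 : ∀ z1 z2, CRel C z1 x → CRel C z2 x → z1 < z2 → p.eval z1 < p.eval z2 :=
    fun z1 z2 h1 h2 h3 => poly_mono hF p _ _ h3 (fun c hc1 hc2 =>
      hp c (conv1 z1 z2 c h1 h2 hc1.le hc2.le))
  have mono2 : ∀ z1 z2, CRel C z z1 → CRel C z z2 → z1 < z2 → q.eval z1 < q.eval z2 :=
    fun z1 z2 h1 h2 h3 => poly_mono hR q _ _ h3 (fun c hc1 hc2 =>
      hq c (CRel.convex h1 h2 hc1.le hc2.le))
  have root1 : ∀ z1 z2, CRel C z1 x → CRel C z2 x → p.eval z1 < 0 → 0 < p.eval z2 →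
      ∃ ζ, CRel C ζ x ∧ p.eval ζ = 0 := by
    intro z1 z2 h1 h2 h3 h4
    have h12 : z1 < z2 := by
      by_contra hcon
      rcases (not_lt.1 hcon).eq_or_lt with h | h
      · subst h; exact lt_asymm h3 h4
      · exact absurd (mono1 _ _ h2 h1 h) (by linarith)
    obtain ⟨c, hc1, hc2, hc3⟩ := hF p z1 z2 h12 h3 h4
    exact ⟨c, conv1 _ _ _ h1 h2 hc1.le hc2.le, hc3⟩
  have root2 : ∀ z1 z2, CRel C z z1 → CRel C z z2 → q.eval z1 < 0 → 0 < q.eval z2 →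
      ∃ ζ, CRel C z ζ ∧ q.eval ζ = 0 := by
    intro z1 z2 h1 h2 h3 h4
    have h12 : z1 < z2 := by
      by_contra hcon
      rcases (not_lt.1 hcon).eq_or_lt with h | h
      · subst h; exact lt_asymm h3 h4
      · exact absurd (mono2 _ _ h2 h1 h) (by linarith)
    obtain ⟨c, hc1, hc2, hc3⟩ := hR q z1 z2 h12 h3 h4
    exact ⟨c, CRel.convex h1 h2 hc1.le hc2.le, hc3⟩
  have hz' : ∀ c ∈ swapC C, c.1 ≠ x := by
    simp only [swapC, Finset.forall_mem_map]
    exact hx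
  -- if p has a zero in the cell then q has one
  have zero12 : ∀ ζ, CRel C ζ x → p.eval ζ = 0 → ∃ ξ, CRel C z ξ ∧ q.eval ξ = 0 := by
    intro ζ hζ h0
    have hζ' : ∀ c ∈ C, c.2 ≠ x := hx
    obtain ⟨m, hm1, hm2, -⟩ := right_pt (rel_swap.2 hζ) hz' ∅
    obtain ⟨l, hl1, hl2, -⟩ := left_pt (rel_swap.2 hζ) hz' ∅
    rw [rel_swap] at hm2 hl2
    have h1 := mono1 _ _ hζ hm2 hm1
    have h2 := mono1 _ _ hl2 hζ hl1
    rw [h0] at h1 h2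
    obtain ⟨x1, hx1, hx1'⟩ := neg1 l hl2 h2
    obtain ⟨x2, hx2, hx2'⟩ := pos1 m hm2 h1
    exact root2 _ _ hx1 hx2 hx1' hx2'
  have zero21 : ∀ ξ, CRel C z ξ → q.eval ξ = 0 → ∃ ζ, CRel C ζ x ∧ p.eval ζ = 0 := by
    intro ξ hξ h0
    obtain ⟨m, hm1, hm2, -⟩ := right_pt hξ hz ∅
    obtain ⟨l, hl1, hl2, -⟩ := left_pt hξ hz ∅
    have h1 := mono2 _ _ hξ hm2 hm1
    have h2 := mono2 _ _ hl2 hξ hl1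
    rw [h0] at h1 h2
    obtain ⟨x1, hx1, hx1'⟩ := neg2 l hl2 h2
    obtain ⟨x2, hx2, hx2'⟩ := pos2 m hm2 h1
    exact root1 _ _ hx1 hx2 hx1' hx2'
  have key : ∀ ζ ξ, CRel C ζ x → CRel C z ξ → p.eval ζ = 0 → q.eval ξ = 0 →
      SignType.sign (p.eval z) = SignType.sign (q.eval x) := by
    intro ζ ξ h1 h2 h3 h4
    have h5 := hroot ζ ξ (CRel.difun hzx h2 h1) h3 h4
    rcases lt_trichotomy z ζ with h | h | h
    · have h6 := h5.1.1 h
      have h7 := mono1 _ _ hzx h1 h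
      have h8 := mono2 _ _ hzx h2 h6
      rw [h3] at h7; rw [h4] at h8
      rw [sign_neg h7, sign_neg h8]
    · have h6 : x = ξ := by grind
      subst h h6
      rw [h3, h4, sign_zero, sign_zero]
    · have h6 := h5.2.1 h
      have h7 := mono1 _ _ h1 hzx h
      have h8 := mono2 _ _ h2 hzx h6
      rw [h3] at h7; rw [h4] at h8
      rw [sign_pos h7, sign_pos h8]
  rcases lt_trichotomy (p.eval z) 0 with h | h | h
  · rcases lt_trichotomy (q.eval x) 0 with h' | h' | h'
    · rw [sign_neg h, sign_neg h']
    · obtain ⟨ζ, h1, h2⟩ := zero21 x hzx h'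
      exact key ζ x h1 hzx h2 h'
    · obtain ⟨x1, h1, h2⟩ := neg1 z hzx h
      obtain ⟨ξ, h3, h4⟩ := root2 x1 x h1 hzx h2 h'
      obtain ⟨ζ, h5, h6⟩ := zero21 ξ h3 h4
      exact key ζ ξ h5 h3 h6 h4
  · obtain ⟨ξ, h1, h2⟩ := zero12 z hzx h
    exact key z ξ hzx h1 h h2
  · rcases lt_trichotomy (q.eval x) 0 with h' | h' | h'
    · obtain ⟨x1, h1, h2⟩ := pos1 z hzx h
      obtain ⟨ξ, h3, h4⟩ := root2 x x1 hzx h1 h' h2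
      obtain ⟨ζ, h5, h6⟩ := zero21 ξ h3 h4
      exact key ζ ξ h5 h3 h6 h4
    · obtain ⟨ζ, h1, h2⟩ := zero21 x hzx h'
      exact key ζ x h1 hzx h2 h'
    · rw [sign_pos h, sign_pos h']

end cells
section addpoly
variable {F R : Type*} [Field F] [LinearOrder F] [IsStrictOrderedRing F]
  [Field R] [LinearOrder R] [IsStrictOrderedRing R]

lemma add_poly (hF : PolyIVT F) (hR : PolyIVT R) (C : Finset (F × R))
    (hC : ∀ c ∈ C, CRel C c.1 c.2) (p : F[X]) (q : R[X])
    (hs : ∀ c ∈ C, SignType.sign (p.eval c.1) = SignType.sign (q.eval c.2))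
    (hder : ∀ z x, CRel C z x →
      SignType.sign (p.derivative.eval z) = SignType.sign (q.derivative.eval x))
    (hp' : p.derivative ≠ 0) (hq' : q.derivative ≠ 0) :
    ∃ C' : Finset (F × R), C ⊆ C' ∧ (∀ c ∈ C', CRel C' c.1 c.2) ∧
      (∀ c ∈ C', c ∈ C ∨ (p.eval c.1 = 0 ∧ q.eval c.2 = 0)) ∧
      ∀ z x, CRel C' z x → SignType.sign (p.eval z) = SignType.sign (q.eval x) := by
  classical
  have hp : p ≠ 0 := by rintro rfl; simp at hp'
  have hq : q ≠ 0 := by rintro rfl; simp at hq'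
  -- nonvanishing of derivative on open cells
  have nz : ∀ z x, CRel C z x → (∀ c ∈ C, c.1 ≠ z) → q.derivative.eval x ≠ 0 := by
    intro z x hzx hz h0
    obtain ⟨m, h1, h2, h3⟩ := right_pt hzx hz q.derivative.roots.toFinset
    have h4 := (hder z x hzx).symm.trans (hder z m h2)
    rw [h0, sign_zero, eq_comm, sign_eq_zero_iff] at h4
    have := h3 m (by simp [hq', h4])
    grind
  let N : Finset (F × R) := (p.roots.toFinset ×ˢ q.roots.toFinset).filter (fun c => CRel C c.1 c.2)
  have hN : ∀ c, c ∈ N ↔ p.eval c.1 = 0 ∧ q.eval c.2 = 0 ∧ CRel C c.1 c.2 := by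
    intro c
    simp only [N, Finset.mem_filter, Finset.mem_product, Multiset.mem_toFinset, mem_roots hp,
      mem_roots hq, IsRoot]
    tauto
  have hpt : ∀ c ∈ C, ∀ x, CRel C c.1 x → x = c.2 := by
    intro c hc x hx
    have := hx c hc
    grind
  have hpt' : ∀ c ∈ C, ∀ z, CRel C z c.2 → z = c.1 := by
    intro c hc x hx
    have := hx c hc
    grind
  have uniq : ∀ c ∈ N, ∀ d ∈ N, CRel C c.1 d.2 → c = d := by
    intro c hc d hd hcd
    rw [hN] at hc hd
    by_cases hz : ∃ e ∈ C, e.1 = c.1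
    · obtain ⟨e, he, he1⟩ := hz
      have h1 := hpt e he c.2 (he1 ▸ hc.2.2)
      have h2 := hpt e he d.2 (he1 ▸ hcd)
      have h3 := hpt' e he d.1 (h2 ▸ hd.2.2)
      ext
      · rw [h3, he1]
      · rw [h1, h2]
    · push Not at hz
      have hdc : CRel C d.1 c.2 := CRel.difun hcd hc.2.2 hd.2.2
      have cq : ∀ a b, CRel C c.1 a → CRel C c.1 b → q.eval a = 0 → q.eval b = 0 → ¬ a < b := by
        intro a b ha hb h1 h2 hab
        obtain ⟨r, hr1, hr2, hr3⟩ := rolle hR q a b hab h1 h2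
        exact nz c.1 r (CRel.convex ha hb hr1.le hr2.le) hz hr3
      have cp : ∀ a b, CRel C a c.2 → CRel C b c.2 → p.eval a = 0 → p.eval b = 0 → ¬ a < b := by
        intro a b ha hb h1 h2 hab
        obtain ⟨r, hr1, hr2, hr3⟩ := rolle hF p a b hab h1 h2
        have hr : CRel C r c.2 :=
          rel_swap.1 (CRel.convex (rel_swap.2 ha) (rel_swap.2 hb) hr1.le hr2.le)
        have := hder r c.2 hr
        rw [hr3, sign_zero, eq_comm, sign_eq_zero_iff] at this
        exact nz c.1 c.2 hc.2.2 hz this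
      ext
      · have h1 := cp c.1 d.1 hc.2.2 hdc hc.1 hd.1
        have h2 := cp d.1 c.1 hdc hc.2.2 hd.1 hc.1
        exact le_antisymm (not_lt.1 h2) (not_lt.1 h1)
      · have h1 := cq c.2 d.2 hc.2.2 hcd hc.2.1 hd.2.1
        have h2 := cq d.2 c.2 hcd hc.2.2 hd.2.1 hc.2.1
        exact le_antisymm (not_lt.1 h2) (not_lt.1 h1)
  refine ⟨C ∪ N, Finset.subset_union_left, ?_, ?_, ?_⟩
  · intro c hc d hd
    rw [Finset.mem_union] at hc hd
    rcases hc with hc | hc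
    · rcases hd with hd | hd
      · exact hC c hc d hd
      · have := ((hN d).1 hd).2.2 c hc
        grind
    · rcases hd with hd | hd
      · exact ((hN c).1 hc).2.2 d hd
      · by_cases hcd : CRel C c.1 d.2
        · rw [uniq c hc d hd hcd]; simp
        · unfold CRel at hcd
          push Not at hcd
          obtain ⟨e, he, he'⟩ := hcd
          have h1 := ((hN c).1 hc).2.2 e he
          have h2 := ((hN d).1 hd).2.2 e he
          grind
  · intro c hc
    rcases Finset.mem_union.1 hc with h | h
    · exact Or.inl h
    · exact Or.inr ⟨((hN c).1 h).1, ((hN c).1 h).2.1⟩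
  · intro z x hzx'
    have hzx : CRel C z x := fun c hc => hzx' c (Finset.mem_union_left _ hc)
    by_cases hz : ∃ e ∈ C, e.1 = z
    · obtain ⟨e, he, rfl⟩ := hz
      rw [hpt e he x hzx]
      exact hs e he
    push Not at hz
    have hroot : ∀ ζ ξ, CRel C ζ ξ → p.eval ζ = 0 → q.eval ξ = 0 →
      (z < ζ ↔ x < ξ) ∧ (ζ < z ↔ ξ < x) := by
      intro ζ ξ h1 h2 h3
      exact hzx' (ζ, ξ) (Finset.mem_union_right _ ((hN _).2 ⟨h2, h3, h1⟩))
    rcases lt_or_gt_of_ne (nz z x hzx hz) with hneg | hpos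
    · have h1 : ∀ z', CRel C z' x → p.derivative.eval z' < 0 := by
        intro z' hz'
        have := hder z' x hz'
        rw [sign_neg hneg] at this
        exact sign_eq_neg_one_iff.1 this
      have h2 : ∀ x', CRel C z x' → q.derivative.eval x' < 0 := by
        intro x' hx'
        have := hder z x' hx'
        rw [sign_neg (h1 z hzx)] at this
        exact sign_eq_neg_one_iff.1 this.symm
      have := cell_sign hF hR C hC (-p) (-q) (fun c hc => by
        simp [Left.sign_neg, hs c hc]) z x hzx hz
        (fun z' hz' => by simpa using h1 z' hz') (fun z' hz' => by simpa using h2 z' hz')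
        (fun ζ ξ a b c => hroot ζ ξ a (by simpa using b) (by simpa using c))
      simpa [Left.sign_neg] using this
    · have h1 : ∀ z', CRel C z' x → 0 < p.derivative.eval z' := by
        intro z' hz'
        have := hder z' x hz'
        rw [sign_pos hpos] at this
        exact sign_eq_one_iff.1 this
      have h2 : ∀ x', CRel C z x' → 0 < q.derivative.eval x' := by
        intro x' hx'
        have := hder z x' hx'
        rw [sign_pos (h1 z hzx)] at this
        exact sign_eq_one_iff.1 this.symm
      exact cell_sign hF hR C hC p q hs z x hzx hz h1 h2 hroot

variable {A : Type*} [CommRing A]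

def ClosedAt (m : ℕ) (rem : A[X] → A[X] → A[X]) (s : Finset A[X]) : Prop :=
  (∀ p ∈ s, m < p.natDegree → derivative p ∈ s ∧ p.eraseLead ∈ s) ∧
  ∀ p ∈ s, ∀ g ∈ s, m < g.natDegree → g.natDegree ≤ p.natDegree → rem p g ∈ s

def RemSpec (rem : A[X] → A[X] → A[X]) : Prop := ∀ p g, (rem p g).natDegree ≤ g.natDegree - 1 ∧
  (1 ≤ g.natDegree → ∃ (k : ℕ) (q : A[X]), C (g.leadingCoeff ^ (2 * k)) * p = q * g + rem p g)

lemma exists_prem (g : A[X]) (hg : 1 ≤ g.natDegree) (n : ℕ) : ∀ p : A[X], p.natDegree ≤ n →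
    ∃ (r : A[X]) (k : ℕ) (q : A[X]), r.natDegree ≤ g.natDegree - 1 ∧
      C (g.leadingCoeff ^ k) * p = q * g + r := by
  induction n with
  | zero =>
    intro p hp
    exact ⟨p, 0, 0, by omega, by simp⟩
  | succ n ih =>
    intro p hp
    by_cases hlt : p.natDegree < g.natDegree
    · exact ⟨p, 0, 0, by omega, by simp⟩
    let p1 := C g.leadingCoeff * p - C p.leadingCoeff * X ^ (p.natDegree - g.natDegree) * g
    have hp1 : p1.natDegree ≤ n := by
      rw [natDegree_le_iff_coeff_eq_zero]
      intro N hN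
      have e1 : p1.coeff N = g.leadingCoeff * p.coeff N -
          p.leadingCoeff * (X ^ (p.natDegree - g.natDegree) * g).coeff N := by
        simp [p1, mul_assoc]
      rw [e1, coeff_X_pow_mul', if_pos (by omega)]
      rcases lt_or_ge p.natDegree N with h | h
      · rw [coeff_eq_zero_of_natDegree_lt h,
          coeff_eq_zero_of_natDegree_lt (p := g) (by omega)]
        simp
      · have : N = p.natDegree := by omega
        subst this
        rw [show p.natDegree - (p.natDegree - g.natDegree) = g.natDegree by omega]
        simp only [leadingCoeff]; ring
    obtain ⟨r, k, q, h1, h2⟩ := ih p1 hp1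
    refine ⟨r, k + 1, q + C (g.leadingCoeff ^ k) * C p.leadingCoeff *
      X ^ (p.natDegree - g.natDegree), h1, ?_⟩
    have : C (g.leadingCoeff ^ k) * p1 = q * g + r := h2
    simp only [p1] at this
    rw [pow_succ, C_mul]
    linear_combination this

lemma exists_rem : ∃ rem : A[X] → A[X] → A[X], RemSpec rem := by
  have : ∀ p g : A[X], ∃ r : A[X], r.natDegree ≤ g.natDegree - 1 ∧
    (1 ≤ g.natDegree → ∃ (k : ℕ) (q : A[X]), C (g.leadingCoeff ^ (2 * k)) * p = q * g + r) := by
    intro p g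
    by_cases hg : 1 ≤ g.natDegree
    · obtain ⟨r, k, q, h1, h2⟩ := exists_prem g hg _ p le_rfl
      refine ⟨C (g.leadingCoeff ^ k) * r, (natDegree_C_mul_le _ _).trans h1, fun _ =>
        ⟨k, C (g.leadingCoeff ^ k) * q, ?_⟩⟩
      rw [two_mul, pow_add, C_mul]
      linear_combination C (g.leadingCoeff ^ k) * h2
    · exact ⟨0, by simp, fun h => absurd h hg⟩
  choose rem hrem using this
  exact ⟨rem, hrem⟩

lemma exists_closed_aux (rem : A[X] → A[X] → A[X]) (hrem : RemSpec rem) (m : ℕ) :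
    ∀ s : Finset A[X], ClosedAt m rem s → ∃ t, s ⊆ t ∧ ClosedAt 0 rem t := by
  classical
  induction m with
  | zero => exact fun s hs => ⟨s, subset_rfl, hs⟩
  | succ m ih =>
    intro s hs
    let s' := s ∪ (s.image derivative ∪ (s.image eraseLead ∪
      ((s ×ˢ s).filter (fun c => c.2.natDegree ≤ c.1.natDegree)).image (fun c => rem c.1 c.2)))
    have hss' : s ⊆ s' := Finset.subset_union_left
    have hd : ∀ p ∈ s, derivative p ∈ s' := fun p hp => by
      simp only [s', Finset.mem_union, Finset.mem_image]; exact Or.inr (Or.inl ⟨p, hp, rfl⟩)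
    have he : ∀ p ∈ s, eraseLead p ∈ s' := fun p hp => by
      simp only [s', Finset.mem_union, Finset.mem_image]
      exact Or.inr (Or.inr (Or.inl ⟨p, hp, rfl⟩))
    have hr : ∀ p ∈ s, ∀ g ∈ s, g.natDegree ≤ p.natDegree → rem p g ∈ s' := fun p hp g hg hgp => by
      simp only [s', Finset.mem_union, Finset.mem_image]
      exact Or.inr (Or.inr (Or.inr ⟨(p, g), by simp [hp, hg, hgp], rfl⟩))
    have hback : ∀ p ∈ s', m < p.natDegree → p ∈ s := by
      intro p hp hm
      simp only [s', Finset.mem_union, Finset.mem_image, Finset.mem_product, Finset.mem_filter] at hp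
      rcases hp with hp | ⟨q, hq, rfl⟩ | ⟨q, hq, rfl⟩ | ⟨⟨q, g⟩, ⟨⟨hq, hg⟩, hgq⟩, rfl⟩
      · exact hp
      · have := natDegree_derivative_le q
        exact (hs.1 q hq (by omega)).1
      · have := eraseLead_natDegree_le q
        exact (hs.1 q hq (by omega)).2
      · have := (hrem q g).1
        dsimp only at hm hq hg ⊢
        exact hs.2 q hq g hg (by omega) hgq
    obtain ⟨t, h1, h2⟩ := ih s' ⟨fun p hp hm => ⟨hd p (hback p hp hm), he p (hback p hp hm)⟩,
      fun p hp g hg hm hgp => hr p (hback p hp (by omega)) g (hback g hg hm) hgp⟩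
    exact ⟨t, hss'.trans h1, h2⟩

end addpoly
section diag
variable {F R : Type*} [Field F] [LinearOrder F] [IsStrictOrderedRing F]
  [Field R] [LinearOrder R] [IsStrictOrderedRing R] {A : Type*} [CommRing A]

lemma exists_closed (rem : A[X] → A[X] → A[X]) (hrem : RemSpec rem) (s : Finset A[X]) :
    ∃ t, s ⊆ t ∧ ClosedAt 0 rem t := by
  apply exists_closed_aux rem hrem (s.sup natDegree) s
  constructor
  · intro p hp h
    exact absurd (Finset.le_sup (f := natDegree) hp) (not_le.2 h)
  · intro p hp g hg h
    exact absurd (Finset.le_sup (f := natDegree) hg) (not_le.2 h)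

def Diag (φ : A →+* R) (ψ : A →+* F) (s : Finset A[X]) : Prop :=
  ∃ C : Finset (F × R), (∀ c ∈ C, CRel C c.1 c.2) ∧
    (∀ c ∈ C, ∃ g ∈ s, ψ g.leadingCoeff ≠ 0 ∧ φ g.leadingCoeff ≠ 0 ∧
      (g.map ψ).eval c.1 = 0 ∧ (g.map φ).eval c.2 = 0) ∧
    ∀ z x, CRel C z x → ∀ g ∈ s,
      SignType.sign ((g.map ψ).eval z) = SignType.sign ((g.map φ).eval x)

lemma map_eraseLead_eq {B : Type*} [CommRing B] (φ : A →+* B) (p : A[X])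
    (h : φ p.leadingCoeff = 0) : p.eraseLead.map φ = p.map φ := by
  have h1 := congrArg (Polynomial.map φ) (eraseLead_add_C_mul_X_pow p)
  rw [Polynomial.map_add, Polynomial.map_mul, map_C, h, C_0, zero_mul, add_zero] at h1
  exact h1

lemma diag_of_closed (hF : PolyIVT F) (hR : PolyIVT R)
    (rem : A[X] → A[X] → A[X]) (hrem : RemSpec rem) (φ : A →+* R) (ψ : A →+* F)
    (s : Finset A[X]) : ClosedAt 0 rem s →
      (∀ g ∈ s, SignType.sign (ψ g.leadingCoeff) = SignType.sign (φ g.leadingCoeff)) →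
      Diag φ ψ s := by
  classical
  refine Finset.induction_on_max_value (ι := A[X]) natDegree s ?_ ?_
  · exact fun _ _ => ⟨∅, by simp, by simp, by simp⟩
  · intro p s hps hmax ih hcl hsg
    have hcl' : ClosedAt 0 rem s := by
      constructor
      · intro q hq hd
        have h1 := hcl.1 q (Finset.mem_insert_of_mem hq) hd
        have h2 := hmax q hq
        refine ⟨Finset.mem_of_mem_insert_of_ne h1.1 ?_, Finset.mem_of_mem_insert_of_ne h1.2 ?_⟩
        · have := natDegree_derivative_le q
          rintro h; rw [h] at this; omega
        · have := eraseLead_natDegree_le q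
          rintro h; rw [h] at this; omega
      · intro q hq g hg hd hgq
        have h1 := hcl.2 q (Finset.mem_insert_of_mem hq) g (Finset.mem_insert_of_mem hg) hd hgq
        have h2 := hmax g hg
        refine Finset.mem_of_mem_insert_of_ne h1 ?_
        have := (hrem q g).1
        rintro h; rw [h] at this; omega
    obtain ⟨C, hC, hroots, hsign⟩ := ih hcl' (fun g hg => hsg g (Finset.mem_insert_of_mem hg))
    have hp := hsg p (Finset.mem_insert_self _ _)
    have hroots' : ∀ c ∈ C, ∃ g ∈ insert p s, ψ g.leadingCoeff ≠ 0 ∧ φ g.leadingCoeff ≠ 0 ∧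
      (g.map ψ).eval c.1 = 0 ∧ (g.map φ).eval c.2 = 0 := fun c hc => by
        obtain ⟨g, hg, h⟩ := hroots c hc
        exact ⟨g, Finset.mem_insert_of_mem hg, h⟩
    by_cases hd : p.natDegree = 0
    · refine ⟨C, hC, hroots', fun z x hzx g hg => ?_⟩
      rcases Finset.mem_insert.1 hg with rfl | hg
      · rw [eq_C_of_natDegree_eq_zero hd] at hp ⊢
        simpa using hp
      · exact hsign z x hzx g hg
    have hpd := hcl.1 p (Finset.mem_insert_self _ _) (Nat.pos_of_ne_zero hd)
    have hder : derivative p ∈ s := Finset.mem_of_mem_insert_of_ne hpd.1 (by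
      have := natDegree_derivative_le p
      rintro h; rw [h] at this; omega)
    have herl : eraseLead p ∈ s := Finset.mem_of_mem_insert_of_ne hpd.2 (by
      have := eraseLead_natDegree_le p
      rintro h; rw [h] at this; omega)
    by_cases hφ : φ p.leadingCoeff = 0
    · have hψ : ψ p.leadingCoeff = 0 := by
        rw [hφ, sign_zero, sign_eq_zero_iff] at hp; exact hp
      refine ⟨C, hC, hroots', fun z x hzx g hg => ?_⟩
      rcases Finset.mem_insert.1 hg with rfl | hg
      · rw [← map_eraseLead_eq φ g hφ, ← map_eraseLead_eq ψ g hψ]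
        exact hsign z x hzx _ herl
      · exact hsign z x hzx g hg
    have hψ : ψ p.leadingCoeff ≠ 0 := by
      intro h
      rw [h, sign_zero, eq_comm, sign_eq_zero_iff] at hp; exact hφ hp
    have hdφ : derivative (p.map φ) ≠ 0 := by
      intro h
      have h1 := natDegree_eq_zero_of_derivative_eq_zero h
      rw [natDegree_map_of_leadingCoeff_ne_zero φ hφ] at h1
      exact hd h1
    have hdψ : derivative (p.map ψ) ≠ 0 := by
      intro h
      have h1 := natDegree_eq_zero_of_derivative_eq_zero h
      rw [natDegree_map_of_leadingCoeff_ne_zero ψ hψ] at h1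
      exact hd h1
    obtain ⟨C', h1, h2, h3, h4⟩ := add_poly hF hR C hC (p.map ψ) (p.map φ) (by
      intro c hc
      obtain ⟨g, hg, g1, g2, g3, g4⟩ := hroots c hc
      have hgd : 1 ≤ g.natDegree := by
        by_contra hcon
        have h0 : g.natDegree = 0 := by omega
        rw [eq_C_of_natDegree_eq_zero h0] at g1 g3
        simp at g1 g3
        exact g1 g3
      obtain ⟨k, q, hk⟩ := (hrem p g).2 hgd
      have hr : rem p g ∈ s := Finset.mem_of_mem_insert_of_ne
        (hcl.2 p (Finset.mem_insert_self _ _) g (Finset.mem_insert_of_mem hg) hgd (hmax g hg)) (by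
          have h2 := (hrem p g).1
          have h3 := hmax g hg
          rintro h; rw [h] at h2; omega)
      have e1 := congrArg (fun t => (t.map ψ).eval c.1) hk
      have e2 := congrArg (fun t => (t.map φ).eval c.2) hk
      simp only [Polynomial.map_mul, Polynomial.map_add, eval_mul, eval_add, map_C, eval_C, g3, g4,
        mul_zero, zero_add] at e1 e2
      rw [map_pow, pow_mul] at e1 e2
      have k1 : 0 < (ψ g.leadingCoeff ^ 2) ^ k := by positivity
      have k2 : 0 < (φ g.leadingCoeff ^ 2) ^ k := by positivity
      have s1 := hsign c.1 c.2 (hC c hc) _ hr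
      rw [← e1, ← e2, sign_mul, sign_mul, sign_pos k1, sign_pos k2, one_mul, one_mul] at s1
      exact s1) (by
      intro z x hzx
      have := hsign z x hzx _ hder
      simpa [derivative_map] using this) hdψ hdφ
    refine ⟨C', h2, ?_, ?_⟩
    · intro c hc
      rcases h3 c hc with h | h
      · exact hroots' c h
      · exact ⟨p, Finset.mem_insert_self _ _, hψ, hφ, h⟩
    · intro z x hzx g hg
      rcases Finset.mem_insert.1 hg with rfl | hg
      · exact h4 z x hzx
      · exact hsign z x (fun c hc => hzx c (h1 hc)) g hg

lemma qe_step (G : Finset A[X]) : ∃ S : Finset A,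
    ∀ {F R : Type} [Field F] [LinearOrder F] [IsStrictOrderedRing F]
      [Field R] [LinearOrder R] [IsStrictOrderedRing R] (_ : PolyIVT F) (_ : PolyIVT R)
      (φ : A →+* R) (ψ : A →+* F), (∀ a ∈ S, SignType.sign (φ a) = SignType.sign (ψ a)) →
      ∀ z : F, ∃ x : R, ∀ g ∈ G,
        SignType.sign ((g.map φ).eval x) = SignType.sign ((g.map ψ).eval z) := by
  classical
  obtain ⟨rem, hrem⟩ := exists_rem (A := A)
  obtain ⟨t, ht, hcl⟩ := exists_closed rem hrem G
  refine ⟨t.image leadingCoeff, ?_⟩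
  intro F R _ _ _ _ _ _ hF hR φ ψ hS z
  obtain ⟨C, hC, -, h⟩ := diag_of_closed hF hR rem hrem φ ψ t hcl (fun g hg =>
    (hS _ (Finset.mem_image_of_mem _ hg)).symm)
  obtain ⟨x, hx⟩ := exists_rel hC z
  exact ⟨x, fun g hg => (h z x hx g (ht hg)).symm⟩

lemma real_polyIVT : PolyIVT ℝ := by
  intro p a b hab ha hb
  obtain ⟨c, hc, h0⟩ := intermediate_value_Ioo hab.le p.continuous.continuousOn ⟨ha, hb⟩
  exact ⟨c, hc.1, hc.2, h0⟩

theorem transfer {F : Type} [Field F] [LinearOrder F] [IsStrictOrderedRing F] (hF : PolyIVT F)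
    (ψ : ℝ →+* F) (n : ℕ) : ∀ (G : Finset (MvPolynomial (Fin n) ℝ)) (y : Fin n → F),
    ∃ x : Fin n → ℝ, ∀ g ∈ G,
      SignType.sign (MvPolynomial.eval x g) = SignType.sign (MvPolynomial.eval₂ ψ y g) := by
  classical
  have hmono : Monotone ψ := by
    have h0 : ∀ r : ℝ, 0 ≤ r → 0 ≤ ψ r := by
      intro r hr
      rw [← Real.mul_self_sqrt hr, map_mul]
      exact mul_self_nonneg _
    intro a b hab
    have := h0 (b - a) (sub_nonneg.2 hab)
    rw [map_sub] at this
    linarith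
  have hstrict : StrictMono ψ := hmono.strictMono_of_injective ψ.injective
  have hsign : ∀ r, SignType.sign r = SignType.sign (ψ r) := by
    intro r
    rcases lt_trichotomy r 0 with h | h | h
    · have := hstrict h; rw [map_zero] at this
      rw [sign_neg h, sign_neg this]
    · simp [h]
    · have := hstrict h; rw [map_zero] at this
      rw [sign_pos h, sign_pos this]
  induction n with
  | zero =>
    intro G y
    refine ⟨Fin.elim0, fun g _ => ?_⟩
    obtain ⟨r, rfl⟩ := MvPolynomial.C_surjective (Fin 0) g
    simpa using hsign r
  | succ n ih =>
    intro G y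
    obtain ⟨S, hS⟩ := qe_step (G.image (MvPolynomial.finSuccEquiv ℝ n))
    obtain ⟨x, hx⟩ := ih S (fun i => y i.succ)
    obtain ⟨x0, hx0⟩ := hS hF real_polyIVT (MvPolynomial.eval x)
      (MvPolynomial.eval₂Hom ψ (fun i => y i.succ)) (fun a ha => hx a ha) (y 0)
    refine ⟨Fin.cons x0 x, fun g hg => ?_⟩
    have := hx0 _ (Finset.mem_image_of_mem _ hg)
    rw [← MvPolynomial.eval_eq_eval_mv_eval'] at this
    rw [this]
    congr 1
    have hh : ((Polynomial.evalRingHom (y 0)).comp ((Polynomial.mapRingHom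
      (MvPolynomial.eval₂Hom ψ (fun i : Fin n => y i.succ))))).comp
        (MvPolynomial.finSuccEquiv ℝ n).toRingEquiv.toRingHom
        = MvPolynomial.eval₂Hom ψ y := by
      apply MvPolynomial.ringHom_ext
      · intro r
        simp [MvPolynomial.finSuccEquiv_apply]
      · intro i
        refine Fin.cases ?_ (fun j => ?_) i
        · simp [MvPolynomial.finSuccEquiv_apply]
        · simp [MvPolynomial.finSuccEquiv_apply]
    exact congrArg (fun t => t g) hh
end diag

section cone
variable {L : Type} [Field L]

structure Good (P : Set L) : Prop where
  zero : 0 ∈ P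
  one : 1 ∈ P
  add : ∀ a ∈ P, ∀ b ∈ P, a + b ∈ P
  mul : ∀ a ∈ P, ∀ b ∈ P, a * b ∈ P
  inv : ∀ a ∈ P, a⁻¹ ∈ P
  sq : ∀ a ∈ P, ∀ b ∈ P, (a - b) ^ 2 ∈ P
  neg : -1 ∉ P

lemma Good.of (Q : Set L) (M : Subfield L) (hQM : ∀ x ∈ Q, x ∈ M) (hsq : ∀ x ∈ M, x ^ 2 ∈ Q)
    (add : ∀ a ∈ Q, ∀ b ∈ Q, a + b ∈ Q) (mul : ∀ a ∈ Q, ∀ b ∈ Q, a * b ∈ Q)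
    (neg : -1 ∉ Q) : Good Q where
  zero := by simpa using hsq 0 M.zero_mem
  one := by simpa using hsq 1 M.one_mem
  add := add
  mul := mul
  inv := by
    intro a ha
    by_cases h : a = 0
    · simpa [h] using ha
    have : a⁻¹ = a * (a⁻¹) ^ 2 := by field_simp
    rw [this]
    exact mul _ ha _ (hsq _ (M.inv_mem (hQM a ha)))
  sq := fun a ha b hb => hsq _ (M.sub_mem (hQM a ha) (hQM b hb))
  neg := neg

lemma Good.eq_zero {P : Set L} (hP : Good P) {a : L} (h1 : a ∈ P) (h2 : -a ∈ P) : a = 0 := by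
  by_contra h
  apply hP.neg
  have : (-1 : L) = (-a) * a⁻¹ := by field_simp
  rw [this]
  exact hP.mul _ h2 _ (hP.inv _ h1)

def Good.field {P : Set L} (hP : Good P) : Subfield L where
  carrier := {x | ∃ a ∈ P, ∃ b ∈ P, x = a - b}
  zero_mem' := ⟨0, hP.zero, 0, hP.zero, by simp⟩
  one_mem' := ⟨1, hP.one, 0, hP.zero, by simp⟩
  add_mem' := by
    rintro _ _ ⟨a, ha, b, hb, rfl⟩ ⟨c, hc, d, hd, rfl⟩
    exact ⟨_, hP.add a ha c hc, _, hP.add b hb d hd, by ring⟩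
  mul_mem' := by
    rintro _ _ ⟨a, ha, b, hb, rfl⟩ ⟨c, hc, d, hd, rfl⟩
    exact ⟨_, hP.add _ (hP.mul a ha c hc) _ (hP.mul b hb d hd), _,
      hP.add _ (hP.mul a ha d hd) _ (hP.mul b hb c hc), by ring⟩
  neg_mem' := by
    rintro _ ⟨a, ha, b, hb, rfl⟩
    exact ⟨b, hb, a, ha, by ring⟩
  inv_mem' := by
    rintro _ ⟨a, ha, b, hb, rfl⟩
    have h := hP.inv _ (hP.sq a ha b hb)
    by_cases h0 : a - b = 0
    · exact ⟨0, hP.zero, 0, hP.zero, by simp [h0]⟩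
    · refine ⟨_, hP.mul a ha _ h, _, hP.mul b hb _ h, ?_⟩
      rw [← sub_mul]
      field_simp

lemma Good.mem_field {P : Set L} (hP : Good P) {x : L} :
    x ∈ hP.field ↔ ∃ a ∈ P, ∃ b ∈ P, x = a - b := Iff.rfl

lemma Good.le_field {P : Set L} (hP : Good P) {x : L} (hx : x ∈ P) : x ∈ hP.field :=
  ⟨x, hx, 0, hP.zero, by simp⟩

lemma Good.sq_field {P : Set L} (hP : Good P) {x : L} (hx : x ∈ hP.field) : x ^ 2 ∈ P := by
  obtain ⟨a, ha, b, hb, rfl⟩ := hx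
  exact hP.sq a ha b hb

lemma Good.total {P : Set L} (hP : Good P) (hmax : ∀ Q, Good Q → P ⊆ Q → Q ⊆ P) {x : L}
    (hx : x ∈ hP.field) : x ∈ P ∨ -x ∈ P := by
  by_contra! hcon
  obtain ⟨h1, h2⟩ := hcon
  apply h1
  refine hmax {y | ∃ a ∈ P, ∃ b ∈ P, y = a + x * b} (Good.of _ hP.field ?_ ?_ ?_ ?_ ?_) ?_ ?_
  · rintro _ ⟨a, ha, b, hb, rfl⟩
    exact add_mem (hP.le_field ha) (mul_mem hx (hP.le_field hb))
  · intro y hy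
    exact ⟨_, hP.sq_field hy, 0, hP.zero, by ring⟩
  · rintro _ ⟨a, ha, b, hb, rfl⟩ _ ⟨c, hc, d, hd, rfl⟩
    exact ⟨_, hP.add a ha c hc, _, hP.add b hb d hd, by ring⟩
  · rintro _ ⟨a, ha, b, hb, rfl⟩ _ ⟨c, hc, d, hd, rfl⟩
    exact ⟨_, hP.add _ (hP.mul a ha c hc) _ (hP.mul _ (hP.sq_field hx) _ (hP.mul b hb d hd)), _,
      hP.add _ (hP.mul a ha d hd) _ (hP.mul b hb c hc), by ring⟩
  · rintro ⟨a, ha, b, hb, h⟩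
    by_cases hb0 : b = 0
    · subst hb0
      apply hP.neg
      rw [h]
      simpa using ha
    · apply h2
      have : -x = (1 + a) * b⁻¹ := by
        field_simp
        linear_combination h
      rw [this]
      exact hP.mul _ (hP.add _ hP.one _ ha) _ (hP.inv _ hb)
  · intro y hy
    exact ⟨y, hy, 0, hP.zero, by ring⟩
  · exact ⟨0, hP.zero, 1, hP.one, by ring⟩

def sqMon {P : Set L} (hP : Good P) (M : Subfield L) : Submonoid L where
  carrier := {x | ∃ c ∈ P, ∃ y ∈ M, x = c * y ^ 2}
  one_mem' := ⟨1, hP.one, 1, M.one_mem, by simp⟩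
  mul_mem' := by
    rintro _ _ ⟨a, ha, b, hb, rfl⟩ ⟨c, hc, d, hd, rfl⟩
    exact ⟨_, hP.mul a ha c hc, _, M.mul_mem hb hd, by ring⟩

lemma Good.extend {P : Set L} (hP : Good P) (hmax : ∀ Q, Good Q → P ⊆ Q → Q ⊆ P)
    (M : Subfield L) (hM : hP.field ≤ M) :
    M ≤ hP.field ∨ (-1 : L) ∈ (sqMon hP M).subsemiringClosure := by
  by_contra! hcon
  obtain ⟨h1, h2⟩ := hcon
  apply h1
  set Q := (sqMon hP M).subsemiringClosure with hQ
  have hle : ∀ x ∈ sqMon hP M, x ∈ Q := fun x hx => by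
    rw [hQ, ← SetLike.mem_coe, Submonoid.subsemiringClosure_coe]
    exact AddSubmonoid.subset_closure hx
  have hsq : ∀ x ∈ M, x ^ 2 ∈ Q := fun x hx => hle _ ⟨1, hP.one, x, hx, by simp⟩
  have hG : Good (Q : Set L) := by
    refine Good.of _ M ?_ hsq (fun a ha b hb => Q.add_mem ha hb)
      (fun a ha b hb => Q.mul_mem ha hb) h2
    intro x hx
    rw [hQ, Submonoid.subsemiringClosure_coe] at hx
    have : AddSubmonoid.closure ((sqMon hP M : Submonoid L) : Set L) ≤
        M.toSubring.toAddSubgroup.toAddSubmonoid := by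
      rw [AddSubmonoid.closure_le]
      rintro _ ⟨a, ha, b, hb, rfl⟩
      exact M.mul_mem (hM (hP.le_field ha)) (M.pow_mem hb 2)
    exact this hx
  have hQP : (Q : Set L) ⊆ P := hmax _ hG (fun x hx => hle _ ⟨x, hx, 1, M.one_mem, by simp⟩)
  intro x hx
  have h3 : (1 + 1 + 1 + 1 : L) ∈ P :=
    hP.add _ (hP.add _ (hP.add _ hP.one _ hP.one) _ hP.one) _ hP.one
  have h4 : (1 + 1 + 1 + 1 : L) ≠ 0 := by
    intro h
    apply hP.neg
    have : (-1 : L) = 1 + 1 + 1 := by linear_combination -h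
    rw [this]
    exact hP.add _ (hP.add _ hP.one _ hP.one) _ hP.one
  have e1 := hQP (hsq _ (M.add_mem hx M.one_mem))
  have e2 := hQP (hsq _ (M.sub_mem hx M.one_mem))
  have hi := hP.inv _ h3
  refine ⟨_, hP.mul _ e1 _ hi, _, hP.mul _ e2 _ hi, ?_⟩
  rw [← sub_mul]
  field_simp
  ring

lemma exists_irr {F : Type} [Field F] [LinearOrder F] [IsStrictOrderedRing F] (f : F[X]) (a b : F) :
    f.eval a * f.eval b < 0 → ∃ p, Irreducible p ∧ p ∣ f ∧ p.eval a * p.eval b < 0 := by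
  induction f using UniqueFactorizationMonoid.induction_on_prime with
  | h₁ => intro h; simp at h
  | h₂ x hx =>
    intro h
    obtain ⟨r, hr, rfl⟩ := Polynomial.isUnit_iff.1 hx
    simp at h
    nlinarith [mul_self_nonneg r]
  | h₃ g p hg hp ih =>
    intro h
    by_cases hs : p.eval a * p.eval b < 0
    · exact ⟨p, hp.irreducible, dvd_mul_right _ _, hs⟩
    · obtain ⟨q, h1, h2, h3⟩ := ih (by
        simp only [eval_mul] at h
        by_contra hc
        nlinarith [mul_nonneg (not_lt.1 hs) (not_lt.1 hc)])
      exact ⟨q, h1, dvd_mul_of_dvd_right h2 _, h3⟩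

set_option maxHeartbeats 1000000 in
lemma ivt_of_max [IsAlgClosed L] {P : Set L} (hP : Good P)
    (hmax : ∀ Q, Good Q → P ⊆ Q → Q ⊆ P)
    [LinearOrder hP.field] [IsStrictOrderedRing hP.field]
    (hord : ∀ x : hP.field, 0 ≤ x ↔ (x : L) ∈ P) : PolyIVT hP.field := by
  have key : ∀ n, ∀ f : hP.field[X], f.natDegree = n → ∀ a b, a < b → f.eval a * f.eval b < 0 →
      ∃ c, a < c ∧ c < b ∧ f.eval c = 0 := by
    intro n
    induction n using Nat.strong_induction_on with
    | _ n ih =>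
    intro f hfn a b hab hf
    obtain ⟨p, hp, hpf, hpab⟩ := exists_irr f a b hf
    have hf0 : f ≠ 0 := by rintro rfl; simp at hf
    have hpn : p.natDegree ≤ n := hfn ▸ natDegree_le_of_dvd hpf hf0
    suffices ∃ c, a < c ∧ c < b ∧ p.eval c = 0 by
      obtain ⟨c, h1, h2, h3⟩ := this
      exact ⟨c, h1, h2, eval_eq_zero_of_dvd_of_eval_eq_zero hpf h3⟩
    have hpd := hp.natDegree_pos
    obtain ⟨θ, hθ⟩ := IsAlgClosed.exists_aeval_eq_zero L p
      (degree_pos_of_irreducible hp).ne'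
    have hint : IsIntegral hP.field θ := by
      rw [← isAlgebraic_iff_isIntegral]
      exact ⟨p, hp.ne_zero, hθ⟩
    have hdvd : ∀ q : hP.field[X], aeval θ q = 0 → p ∣ q := by
      intro q hq
      have h1 := minpoly.dvd _ θ hq
      have h2 : p ∣ minpoly hP.field θ := by
        rw [← minpoly.eq_of_irreducible hp hθ]
        exact dvd_mul_right _ _
      exact h2.trans h1
    set M := (IntermediateField.adjoin hP.field {θ}) with hM
    have hθM : θ ∈ M := IntermediateField.mem_adjoin_simple_self _ θ
    have hrep : ∀ y ∈ M, ∃ r : hP.field[X], aeval θ r = y ∧ r.natDegree < p.natDegree := by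
      intro y hy
      rw [← IntermediateField.mem_toSubalgebra,
        IntermediateField.adjoin_simple_toSubalgebra_of_isAlgebraic hint.isAlgebraic,
        Algebra.adjoin_singleton_eq_range_aeval] at hy
      obtain ⟨r, rfl⟩ := hy
      refine ⟨r % p, ?_, natDegree_mod_lt _ hpd.ne'⟩
      have := congrArg (aeval θ) (EuclideanDomain.div_add_mod r p)
      simpa [hθ] using this
    rcases hP.extend hmax M.toSubfield (fun x hx => M.algebraMap_mem ⟨x, hx⟩) with h | h
    · have hθF := h hθM
      set t : hP.field := ⟨θ, hθF⟩ with ht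
      have hroot : p.eval t = 0 := by
        have : aeval (algebraMap hP.field L t) p = 0 := hθ
        rw [aeval_algebraMap_apply] at this
        simpa using this
      obtain ⟨u, hu⟩ := dvd_iff_isRoot.2 hroot
      have huu : IsUnit u := (hp.isUnit_or_isUnit hu).resolve_left (not_isUnit_X_sub_C t)
      obtain ⟨r, hr, rfl⟩ := Polynomial.isUnit_iff.1 huu
      rw [hu] at hpab
      simp at hpab
      refine ⟨t, ?_, ?_, hroot⟩
      · by_contra hc
        nlinarith [mul_nonneg (mul_nonneg (sub_nonneg.2 (not_lt.1 hc)) (sub_nonneg.2 ((not_lt.1 hc).trans hab.le))) (mul_self_nonneg r), mul_nonneg (sub_nonneg.2 (not_lt.1 hc)) (sub_nonneg.2 hab.le)]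
      · by_contra hc
        nlinarith [mul_nonneg (mul_nonneg (sub_nonneg.2 (not_lt.1 hc)) (sub_nonneg.2 (hab.le.trans (not_lt.1 hc)))) (mul_self_nonneg r)]
    · have hsum : ∀ q ∈ (sqMon hP M.toSubfield).subsemiringClosure, ∃ g : hP.field[X],
          aeval θ g = q ∧ (∀ c, 0 ≤ g.eval c) ∧ g.natDegree ≤ 2 * (p.natDegree - 1) := by
        intro q hq
        rw [← SetLike.mem_coe, Submonoid.subsemiringClosure_coe] at hq
        induction hq using AddSubmonoid.closure_induction with
        | mem x hx =>
          obtain ⟨c, hc, y, hy, rfl⟩ := hx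
          obtain ⟨r, rfl, hr⟩ := hrep y hy
          set c' : hP.field := ⟨c, hP.le_field hc⟩ with hc'
          have hcn : 0 ≤ c' := (hord c').2 hc
          refine ⟨C c' * r ^ 2, ?_, ?_, ?_⟩
          · rw [map_mul, map_pow, aeval_C]; rfl
          · intro z
            simp only [eval_mul, eval_C, eval_pow]
            positivity
          · refine (natDegree_C_mul_le _ _).trans (natDegree_pow_le.trans ?_)
            omega
        | zero => exact ⟨0, by simp, by simp, by simp⟩
        | add x y _ _ hx hy =>
          obtain ⟨g, h1, h2, h3⟩ := hx
          obtain ⟨g', h1', h2', h3'⟩ := hy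
          refine ⟨g + g', by simp [h1, h1'], fun c => ?_,
            (natDegree_add_le _ _).trans (max_le h3 h3')⟩
          rw [eval_add]
          exact add_nonneg (h2 c) (h2' c)
      obtain ⟨g, hg1, hg2, hg3⟩ := hsum _ h
      obtain ⟨k, hk⟩ := hdvd (1 + g) (by simp [hg1])
      have hpos : ∀ c, 0 < (1 + g).eval c := by
        intro c
        rw [eval_add, eval_one]
        linarith [hg2 c]
      have hk0 : k ≠ 0 := by
        rintro rfl
        have := hpos a
        rw [hk] at this
        simp at this
      have hdeg : p.natDegree + k.natDegree ≤ 2 * (p.natDegree - 1) := by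
        rw [← natDegree_mul hp.ne_zero hk0, ← hk]
        refine (natDegree_add_le _ _).trans (max_le (by simp) hg3)
      have h1 := hpos a
      have h2 := hpos b
      rw [hk, eval_mul] at h1 h2
      have hkab : k.eval a * k.eval b < 0 := by
        have h3 := mul_pos h1 h2
        rw [mul_mul_mul_comm] at h3
        rcases pos_and_pos_or_neg_and_neg_of_mul_pos h3 with h | h
        · exact absurd h.1 hpab.not_gt
        · exact h.2
      obtain ⟨c, -, -, hc⟩ := ih k.natDegree (by omega) k rfl a b hab hkab
      have := hpos c
      rw [hk, eval_mul, hc, mul_zero] at this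
      exact absurd this (lt_irrefl _)
  intro f a b hab h1 h2
  exact key _ f rfl a b hab (mul_neg_of_neg_of_pos h1 h2)

lemma exists_order {P : Set L} (hP : Good P) (hmax : ∀ Q, Good Q → P ⊆ Q → Q ⊆ P) :
    ∃ (_ : LinearOrder hP.field) (_ : IsStrictOrderedRing hP.field),
      ∀ x : hP.field, 0 ≤ x ↔ (x : L) ∈ P := by
  classical
  let C : RingCone hP.field :=
    { carrier := {x | (x : L) ∈ P}
      zero_mem' := hP.zero
      one_mem' := hP.one
      add_mem' := fun ha hb => hP.add _ ha _ hb
      mul_mem' := fun ha hb => hP.mul _ ha _ hb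
      eq_zero_of_mem_of_neg_mem' := fun h1 h2 => Subtype.ext (hP.eq_zero h1 h2) }
  have hC : ∀ x, x ∈ C ↔ (x : L) ∈ P := fun x => Iff.rfl
  have : HasMemOrNegMem C := ⟨fun x => hP.total hmax x.2⟩
  let o : LinearOrder hP.field := LinearOrder.mkOfAddGroupCone C
  have : IsOrderedRing hP.field := IsOrderedRing.mkOfCone C
  refine ⟨o, IsOrderedRing.toIsStrictOrderedRing _, fun x => ?_⟩
  rw [← hC]
  change x - 0 ∈ C ↔ _
  rw [sub_zero]

lemma exists_max {P0 : Set L} (h0 : Good P0) :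
    ∃ P : Set L, P0 ⊆ P ∧ Good P ∧ ∀ Q, Good Q → P ⊆ Q → Q ⊆ P := by
  obtain ⟨P, h1, h2⟩ := zorn_subset_nonempty {P : Set L | Good P} (by
    intro c hc hch hne
    have dir : ∀ a ∈ ⋃₀ c, ∀ b ∈ ⋃₀ c, ∃ s ∈ c, a ∈ s ∧ b ∈ s := by
      rintro a ⟨s, hs, ha⟩ b ⟨t, ht, hb⟩
      rcases hch.total hs ht with h | h
      · exact ⟨t, ht, h ha, hb⟩
      · exact ⟨s, hs, ha, h hb⟩
    obtain ⟨s0, hs0⟩ := hne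
    refine ⟨⋃₀ c, ⟨⟨s0, hs0, (hc hs0).zero⟩, ⟨s0, hs0, (hc hs0).one⟩, ?_, ?_, ?_, ?_, ?_⟩,
      fun s hs => Set.subset_sUnion_of_mem hs⟩
    · intro a ha b hb
      obtain ⟨s, hs, h1, h2⟩ := dir a ha b hb
      exact ⟨s, hs, (hc hs).add _ h1 _ h2⟩
    · intro a ha b hb
      obtain ⟨s, hs, h1, h2⟩ := dir a ha b hb
      exact ⟨s, hs, (hc hs).mul _ h1 _ h2⟩
    · rintro a ⟨s, hs, h1⟩
      exact ⟨s, hs, (hc hs).inv _ h1⟩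
    · intro a ha b hb
      obtain ⟨s, hs, h1, h2⟩ := dir a ha b hb
      exact ⟨s, hs, (hc hs).sq _ h1 _ h2⟩
    · rintro ⟨s, hs, h1⟩
      exact (hc hs).neg h1) P0 h0
  exact ⟨P, h1, h2.1, fun Q hQ hPQ => h2.2 hQ hPQ⟩

end cone

section primecone
variable {A : Type} [CommRing A]

structure PreO (P : Set A) : Prop where
  add : ∀ a ∈ P, ∀ b ∈ P, a + b ∈ P
  mul : ∀ a ∈ P, ∀ b ∈ P, a * b ∈ P
  sq : ∀ a, a ^ 2 ∈ P

lemma PreO.zero {P : Set A} (hP : PreO P) : 0 ∈ P := by simpa using hP.sq 0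
lemma PreO.one {P : Set A} (hP : PreO P) : 1 ∈ P := by simpa using hP.sq 1

lemma PreO.adjoin {P : Set A} (hP : PreO P) (x : A) :
    PreO {y | ∃ a ∈ P, ∃ b ∈ P, y = a + x * b} where
  add := by
    rintro _ ⟨a, ha, b, hb, rfl⟩ _ ⟨c, hc, d, hd, rfl⟩
    exact ⟨_, hP.add a ha c hc, _, hP.add b hb d hd, by ring⟩
  mul := by
    rintro _ ⟨a, ha, b, hb, rfl⟩ _ ⟨c, hc, d, hd, rfl⟩
    exact ⟨_, hP.add _ (hP.mul a ha c hc) _ (hP.mul _ (hP.sq x) _ (hP.mul b hb d hd)), _,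
      hP.add _ (hP.mul a ha d hd) _ (hP.mul b hb c hc), by ring⟩
  sq := fun a => ⟨_, hP.sq a, 0, hP.zero, by ring⟩

lemma exists_primecone {T : Set A} (hT : PreO T) (hneg : -1 ∉ T) :
    ∃ P : Set A, T ⊆ P ∧ PreO P ∧ -1 ∉ P ∧ ∀ x y, x ∉ P → y ∉ P → -(x * y) ∉ P := by
  obtain ⟨P, h1, h2⟩ := zorn_subset_nonempty {P : Set A | PreO P ∧ -1 ∉ P} (by
    intro c hc hch hne
    have dir : ∀ a ∈ ⋃₀ c, ∀ b ∈ ⋃₀ c, ∃ s ∈ c, a ∈ s ∧ b ∈ s := by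
      rintro a ⟨s, hs, ha⟩ b ⟨t, ht, hb⟩
      rcases hch.total hs ht with h | h
      · exact ⟨t, ht, h ha, hb⟩
      · exact ⟨s, hs, ha, h hb⟩
    obtain ⟨s0, hs0⟩ := hne
    refine ⟨⋃₀ c, ⟨⟨?_, ?_, fun a => ⟨s0, hs0, (hc hs0).1.sq a⟩⟩, ?_⟩,
      fun s hs => Set.subset_sUnion_of_mem hs⟩
    · intro a ha b hb
      obtain ⟨s, hs, h1, h2⟩ := dir a ha b hb
      exact ⟨s, hs, (hc hs).1.add _ h1 _ h2⟩
    · intro a ha b hb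
      obtain ⟨s, hs, h1, h2⟩ := dir a ha b hb
      exact ⟨s, hs, (hc hs).1.mul _ h1 _ h2⟩
    · rintro ⟨s, hs, h1⟩
      exact (hc hs).2 h1) T ⟨hT, hneg⟩
  have hP : PreO P := h2.1.1
  have hadj : ∀ x, x ∉ P → ∃ a ∈ P, ∃ b ∈ P, -1 = a + x * b := by
    intro x hx
    by_contra hc
    apply hx
    refine h2.2 (y := {y | ∃ a ∈ P, ∃ b ∈ P, y = a + x * b}) ⟨hP.adjoin x, hc⟩ ?_ ?_
    · intro y hy
      exact ⟨y, hy, 0, hP.zero, by ring⟩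
    · exact ⟨0, hP.zero, 1, hP.one, by ring⟩
  refine ⟨P, h1, hP, h2.1.2, fun x y hx hy hxy => h2.1.2 ?_⟩
  obtain ⟨a, ha, b, hb, e1⟩ := hadj x hx
  obtain ⟨c, hc, d, hd, e2⟩ := hadj y hy
  have : (-1 : A) = a + c + a * c + (-(x * y)) * (b * d) := by
    linear_combination (1 + c) * e1 - (x * b) * e2
  rw [this]
  exact hP.add _ (hP.add _ (hP.add _ ha _ hc) _ (hP.mul _ ha _ hc)) _
    (hP.mul _ hxy _ (hP.mul _ hb _ hd))

lemma exists_field (I : Ideal A) [I.IsPrime] :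
    ∃ (L : Type) (_ : Field L) (_ : IsAlgClosed L) (j : A →+* L), (∀ x, j x = 0 ↔ x ∈ I) ∧
      ∃ M : Subfield L, (∀ a, j a ∈ M) ∧ ∀ z ∈ M, ∃ a b, b ∉ I ∧ z = j a / j b := by
  let K := FractionRing (A ⧸ I)
  let j1 : A →+* K := (algebraMap (A ⧸ I) K).comp (Ideal.Quotient.mk I)
  let i : K →+* AlgebraicClosure K := algebraMap _ _
  have hj1 : ∀ x, j1 x = 0 ↔ x ∈ I := by
    intro x
    rw [← Ideal.Quotient.eq_zero_iff_mem]
    exact (FaithfulSMul.algebraMap_injective (A ⧸ I) K).eq_iff' (map_zero _)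
  refine ⟨AlgebraicClosure K, inferInstance, inferInstance, i.comp j1, fun x => ?_,
    i.fieldRange, fun a => ⟨j1 a, rfl⟩, ?_⟩
  · rw [← hj1]
    exact i.injective.eq_iff' (map_zero _)
  · rintro _ ⟨z, rfl⟩
    obtain ⟨a, b, hb, rfl⟩ := IsFractionRing.div_surjective (A := A ⧸ I) z
    obtain ⟨a, rfl⟩ := Ideal.Quotient.mk_surjective a
    obtain ⟨b, rfl⟩ := Ideal.Quotient.mk_surjective b
    refine ⟨a, b, ?_, ?_⟩
    · rw [← Ideal.Quotient.eq_zero_iff_mem]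
      exact nonZeroDivisors.ne_zero hb
    · rw [map_div₀]; rfl

theorem exists_realclosed {T : Set A} (hT : PreO T) (hneg : -1 ∉ T) :
    ∃ (F : Type) (_ : Field F) (_ : LinearOrder F) (_ : IsStrictOrderedRing F) (j : A →+* F),
      PolyIVT F ∧ ∀ t ∈ T, 0 ≤ j t := by
  obtain ⟨P, hTP, hP, hn, hxy⟩ := exists_primecone hT hneg
  have htot : ∀ x, x ∈ P ∨ -x ∈ P := by
    intro x
    by_contra! h
    apply hxy x (-x) h.1 h.2
    have : -(x * -x) = x ^ 2 := by ring
    rw [this]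
    exact hP.sq x
  let I : Ideal A :=
    { carrier := {x | x ∈ P ∧ -x ∈ P}
      zero_mem' := ⟨hP.zero, by simpa using hP.zero⟩
      add_mem' := by
        rintro a b ⟨h1, h2⟩ ⟨h3, h4⟩
        refine ⟨hP.add _ h1 _ h3, ?_⟩
        rw [neg_add]
        exact hP.add _ h2 _ h4
      smul_mem' := by
        rintro c x ⟨h1, h2⟩
        simp only [smul_eq_mul]
        rcases htot c with h | h
        · exact ⟨hP.mul _ h _ h1, by rw [← mul_neg]; exact hP.mul _ h _ h2⟩
        · refine ⟨?_, by rw [← neg_mul]; exact hP.mul _ h _ h1⟩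
          rw [← neg_mul_neg]; exact hP.mul _ h _ h2 }
  have hI : ∀ x, x ∈ I ↔ x ∈ P ∧ -x ∈ P := fun x => Iff.rfl
  have hprime : I.IsPrime := by
    refine ⟨?_, ?_⟩
    · rw [Ideal.ne_top_iff_one]
      exact fun h => hn ((hI _).1 h).2
    · intro x y h
      by_contra! hc
      rw [hI] at hc h
      rw [hI] at hc
      obtain ⟨h1, h2⟩ := hc
      have key : ∀ x y, x * y ∈ P → -(x * y) ∈ P → x ∈ P ∨ y ∈ P := by
        intro x y _ h2
        by_contra! hc
        exact hxy x y hc.1 hc.2 h2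
      have k1 := key x y h.1 h.2
      have k2 := key (-x) y (by rw [neg_mul]; exact h.2) (by rw [neg_mul, neg_neg]; exact h.1)
      have k3 := key x (-y) (by rw [mul_neg]; exact h.2) (by rw [mul_neg, neg_neg]; exact h.1)
      have k4 := key (-x) (-y) (by rw [neg_mul_neg]; exact h.1) (by rw [neg_mul_neg]; exact h.2)
      tauto
  obtain ⟨L, _, _, j, hj, M, hM1, hM2⟩ := exists_field I
  have hG : Good {z : L | ∃ a ∈ P, ∃ b, b ∉ I ∧ z = j a / (j b) ^ 2} := by
    refine Good.of _ M ?_ ?_ ?_ ?_ ?_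
    · rintro _ ⟨a, ha, b, hb, rfl⟩
      exact M.div_mem (hM1 a) (M.pow_mem (hM1 b) 2)
    · intro z hz
      obtain ⟨a, b, hb, rfl⟩ := hM2 z hz
      exact ⟨a ^ 2, hP.sq a, b, hb, by rw [map_pow, div_pow]⟩
    · rintro _ ⟨a, ha, b, hb, rfl⟩ _ ⟨c, hc, d, hd, rfl⟩
      refine ⟨a * d ^ 2 + c * b ^ 2, hP.add _ (hP.mul _ ha _ (hP.sq d)) _ (hP.mul _ hc _ (hP.sq b)),
        b * d, fun h => (hprime.mem_or_mem h).elim hb hd, ?_⟩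
      have hb' : j b ≠ 0 := fun h => hb ((hj b).1 h)
      have hd' : j d ≠ 0 := fun h => hd ((hj d).1 h)
      simp only [map_add, map_mul, map_pow]
      field_simp
    · rintro _ ⟨a, ha, b, hb, rfl⟩ _ ⟨c, hc, d, hd, rfl⟩
      refine ⟨a * c, hP.mul _ ha _ hc,
        b * d, fun h => (hprime.mem_or_mem h).elim hb hd, ?_⟩
      have hb' : j b ≠ 0 := fun h => hb ((hj b).1 h)
      have hd' : j d ≠ 0 := fun h => hd ((hj d).1 h)
      simp only [map_mul]
      field_simp
    · rintro ⟨a, ha, b, hb, h⟩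
      have hb' : j b ≠ 0 := fun h => hb ((hj b).1 h)
      have h1 : j (a + b ^ 2) = 0 := by
        simp only [map_add, map_pow]
        field_simp at h
        linear_combination -h
      have h2 := (hj _).1 h1
      have h3 : b ^ 2 ∈ I := by
        refine (hI _).2 ⟨hP.sq b, ?_⟩
        have := hP.add _ ha _ ((hI _).1 h2).2
        have e : a + -(a + b ^ 2) = -b ^ 2 := by ring
        rwa [e] at this
      exact hb (hprime.mem_of_pow_mem _ h3)
  obtain ⟨Q, hPQ, hQ, hmax⟩ := exists_max hG
  obtain ⟨o, hs, hord⟩ := exists_order hQ hmax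
  have hPmem : ∀ a ∈ P, j a ∈ Q := fun a ha => hPQ ⟨a, ha, 1, fun h => hprime.ne_top
    ((Ideal.eq_top_iff_one I).2 h), by simp⟩
  have hmem : ∀ a, j a ∈ hQ.field := by
    intro a
    rcases htot a with h | h
    · exact hQ.le_field (hPmem a h)
    · have := hQ.field.neg_mem (hQ.le_field (hPmem _ h))
      rwa [map_neg, neg_neg] at this
  refine ⟨hQ.field, inferInstance, o, hs, j.codRestrict hQ.field hmem, ivt_of_max hQ hmax hord, ?_⟩
  intro t ht
  rw [hord]
  exact hPmem t (hTP ht)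
end primecone
end helpers

section final
open MvPolynomial

lemma isSOS_of_isSumSq {d : ℕ} {p : MvPolynomial (Fin d) ℝ} (h : IsSumSq p) : IsSOS p := by
  induction h with
  | zero => exact ⟨0, Fin.elim0, by simp⟩
  | sq_add a _ ih =>
    obtain ⟨n, q, rfl⟩ := ih
    exact ⟨n + 1, Fin.cons a q, by simp [Fin.sum_univ_succ, sq]⟩

lemma isSumSq_of_isSOS {d : ℕ} {p : MvPolynomial (Fin d) ℝ} (h : IsSOS p) : IsSumSq p := by
  obtain ⟨n, q, rfl⟩ := h
  refine Finset.sum_induction _ IsSumSq (fun _ _ h1 h2 => h1.add h2) IsSumSq.zero ?_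
  intro i _
  rw [sq]
  exact IsSumSq.mul_self _

lemma preO_sos (d : ℕ) : PreO {p : MvPolynomial (Fin d) ℝ | IsSumSq p} where
  add := fun _ h1 _ h2 => IsSumSq.add h1 h2
  mul := fun _ h1 _ h2 => IsSumSq.mul h1 h2
  sq := fun a => by
    change IsSumSq _
    rw [sq]
    exact IsSumSq.mul_self a

section inT
variable {d k : ℕ} (f : Fin k → MvPolynomial (Fin d) ℝ)

lemma inT_add {p q : MvPolynomial (Fin d) ℝ} (hp : InPreordering f p) (hq : InPreordering f q) :
    InPreordering f (p + q) := by
  obtain ⟨σ, hσ, rfl⟩ := hp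
  obtain ⟨τ, hτ, rfl⟩ := hq
  refine ⟨fun e => σ e + τ e, fun e => isSOS_of_isSumSq
    ((isSumSq_of_isSOS (hσ e)).add (isSumSq_of_isSOS (hτ e))), ?_⟩
  simp only [mul_add, Finset.sum_add_distrib]

lemma inT_zero : InPreordering f 0 :=
  ⟨fun _ => 0, fun _ => isSOS_of_isSumSq IsSumSq.zero, by simp⟩

lemma inT_single (e : Fin k → Bool) {s : MvPolynomial (Fin d) ℝ} (hs : IsSumSq s) :
    InPreordering f ((∏ i, if e i then f i else 1) * s) := by
  refine ⟨fun e' => if e' = e then s else 0, fun e' => ?_, ?_⟩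
  · dsimp only
    split_ifs
    · exact isSOS_of_isSumSq hs
    · exact isSOS_of_isSumSq IsSumSq.zero
  · simp

lemma inT_sos {s : MvPolynomial (Fin d) ℝ} (hs : IsSumSq s) : InPreordering f s := by
  simpa using inT_single f (fun _ => false) hs

lemma inT_gen (i : Fin k) : InPreordering f (f i) := by
  have h := inT_single f (fun j => decide (j = i)) (s := 1) (by simp)
  simpa using h

lemma preO_T : PreO {p | InPreordering f p} where
  add := fun _ h1 _ h2 => inT_add f h1 h2
  mul := by
    rintro _ ⟨σ, hσ, rfl⟩ _ ⟨τ, hτ, rfl⟩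
    change InPreordering f _
    rw [Finset.sum_mul_sum]
    refine Finset.sum_induction _ _ (fun _ _ h1 h2 => inT_add f h1 h2) (inT_zero f) fun e _ => ?_
    refine Finset.sum_induction _ _ (fun _ _ h1 h2 => inT_add f h1 h2) (inT_zero f) fun e' _ => ?_
    have := inT_single f (fun i => xor (e i) (e' i))
      (s := ((∏ i, if e i && e' i then f i else 1) * (∏ i, if e i && e' i then f i else 1)) *
        (σ e * τ e'))
      ((IsSumSq.mul_self _).mul ((isSumSq_of_isSOS (hσ e)).mul (isSumSq_of_isSOS (hτ e'))))
    convert this using 1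
    rw [mul_mul_mul_comm]
    conv_rhs => rw [← mul_assoc]
    rw [← Finset.prod_mul_distrib, ← Finset.prod_mul_distrib, ← Finset.prod_mul_distrib]
    congr 1
    refine Finset.prod_congr rfl fun i _ => ?_
    cases e i <;> cases e' i <;> simp
  sq := fun a => inT_sos f (by rw [sq]; exact IsSumSq.mul_self a)
end inT

section arch
variable {d : ℕ} {T : Set (MvPolynomial (Fin d) ℝ)}

lemma const_mem (hT : PreO T) {r : ℝ} (hr : 0 ≤ r) : C r ∈ T := by
  have := hT.sq (C (Real.sqrt r))
  rwa [← C_pow, Real.sq_sqrt hr] at this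

lemma arch_of_ball (hT : PreO T) (N : ℝ) (hN : C N - ∑ i, X i ^ 2 ∈ T)
    (p : MvPolynomial (Fin d) ℝ) : ∃ lam : ℝ, 0 < lam ∧ C lam - p ∈ T ∧ C lam + p ∈ T := by
  have hX : ∀ i : Fin d, ∃ lam : ℝ, 0 < lam ∧ C lam - X i ∈ T ∧ C lam + X i ∈ T := by
    intro i
    have h1 : (C N - X i ^ 2 : MvPolynomial (Fin d) ℝ) ∈ T := by
      have h2 : ∑ j ∈ Finset.univ.erase i, (X j ^ 2 : MvPolynomial (Fin d) ℝ) ∈ T :=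
        Finset.sum_induction _ (· ∈ T) (fun _ _ h1 h2 => hT.add _ h1 _ h2) hT.zero
          (fun j _ => hT.sq _)
      have h3 := hT.add _ hN _ h2
      rw [← Finset.add_sum_erase _ _ (Finset.mem_univ i)] at h3
      convert h3 using 1
      ring
    have h2 : (C (|N| - N) : MvPolynomial (Fin d) ℝ) ∈ T :=
      const_mem hT (sub_nonneg.2 (le_abs_self N))
    refine ⟨|N| + (1 / 2) ^ 2, by positivity, ?_, ?_⟩
    · have h3 := hT.add _ (hT.add _ h1 _ h2) _ (hT.sq (X i - C (1 / 2)))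
      convert h3 using 1
      have e : (C (1 / 2) + C (1 / 2) : MvPolynomial (Fin d) ℝ) = 1 := by
        rw [← C_add]; norm_num
      simp only [C_add, C_sub, C_pow]
      linear_combination (X i) * e
    · have h3 := hT.add _ (hT.add _ h1 _ h2) _ (hT.sq (X i + C (1 / 2)))
      convert h3 using 1
      have e : (C (1 / 2) + C (1 / 2) : MvPolynomial (Fin d) ℝ) = 1 := by
        rw [← C_add]; norm_num
      simp only [C_add, C_sub, C_pow]
      linear_combination -(X i) * e
  have hmul : ∀ p q : MvPolynomial (Fin d) ℝ,
      (∃ lam : ℝ, 0 < lam ∧ C lam - p ∈ T ∧ C lam + p ∈ T) →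
      (∃ lam : ℝ, 0 < lam ∧ C lam - q ∈ T ∧ C lam + q ∈ T) →
      (∃ lam : ℝ, 0 < lam ∧ C lam - p * q ∈ T ∧ C lam + p * q ∈ T) := by
    rintro p q ⟨a, ha, h1, h2⟩ ⟨b, hb, h3, h4⟩
    have e : (C (1 / 2) + C (1 / 2) : MvPolynomial (Fin d) ℝ) = 1 := by
      rw [← C_add]; norm_num
    have hh : (C (1 / 2) : MvPolynomial (Fin d) ℝ) ∈ T := const_mem hT (by norm_num)
    refine ⟨a * b, by positivity, ?_, ?_⟩
    · have h5 := hT.mul _ hh _ (hT.add _ (hT.mul _ h1 _ h4) _ (hT.mul _ h2 _ h3))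
      convert h5 using 1
      simp only [C_mul]
      linear_combination -(C a * C b - p * q) * e
    · have h5 := hT.mul _ hh _ (hT.add _ (hT.mul _ h1 _ h3) _ (hT.mul _ h2 _ h4))
      convert h5 using 1
      simp only [C_mul]
      linear_combination -(C a * C b + p * q) * e
  induction p using MvPolynomial.induction_on with
  | C r =>
    refine ⟨|r| + 1, by positivity, ?_, ?_⟩
    · rw [← C_sub]
      exact const_mem hT (by linarith [le_abs_self r])
    · rw [← C_add]
      exact const_mem hT (by linarith [neg_abs_le r])
  | add p q hp hq =>
    obtain ⟨a, ha, h1, h2⟩ := hp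
    obtain ⟨b, hb, h3, h4⟩ := hq
    refine ⟨a + b, by positivity, ?_, ?_⟩
    · have := hT.add _ h1 _ h3
      rw [C_add]
      convert this using 1
      ring
    · have := hT.add _ h2 _ h4
      rw [C_add]
      convert this using 1
      ring
  | mul_X p i hp => exact hmul p (X i) hp (hX i)

end arch

lemma weak_pos {d k : ℕ} (f : Fin k → MvPolynomial (Fin d) ℝ) (N : ℝ)
    (hN : ∀ x ∈ SemiAlgSet f, ∑ i, x i ^ 2 < N) :
    ∃ t0 t1, InPreordering f t0 ∧ InPreordering f t1 ∧ (C N - ∑ i, X i ^ 2) * t1 = 1 + t0 := by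
  classical
  set g : MvPolynomial (Fin d) ℝ := C N - ∑ i, X i ^ 2 with hg
  by_cases hneg : (-1 : MvPolynomial (Fin d) ℝ) ∈
      {y | ∃ a ∈ {p | InPreordering f p}, ∃ b ∈ {p | InPreordering f p}, y = a + (-g) * b}
  · obtain ⟨a, ha, b, hb, h⟩ := hneg
    exact ⟨a, b, ha, hb, by linear_combination h⟩
  exfalso
  obtain ⟨F, _, _, _, j, hF, hj⟩ := exists_realclosed ((preO_T f).adjoin (-g)) hneg
  obtain ⟨x, hx⟩ := transfer hF (j.comp C) d (insert (-g) (Finset.univ.image f)) (fun i => j (X i))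
  have he : ∀ p, eval₂ (j.comp C) (fun i => j (X i)) p = j p := by
    intro p
    have : eval₂Hom (j.comp C) (fun i => j (X i)) = j := by
      apply MvPolynomial.ringHom_ext <;> simp
    exact congrArg (fun t => t p) this
  have hpos : ∀ p ∈ insert (-g) (Finset.univ.image f), 0 ≤ j p → 0 ≤ eval x p := by
    intro p hp h
    have h1 := hx p hp
    rw [he] at h1
    rw [← sign_nonneg_iff, h1, sign_nonneg_iff]
    exact h
  have h1 : x ∈ SemiAlgSet f := fun i => hpos _ (by simp) (hj _
    ⟨f i, inT_gen f i, 0, inT_zero f, by ring⟩)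
  have h2 := hpos (-g) (by simp) (hj _ ⟨0, inT_zero f, 1, (preO_T f).one, by ring⟩)
  have h3 := hN x h1
  simp [hg] at h2
  linarith

theorem main_aux {d k : ℕ}
    (f : Fin k → MvPolynomial (Fin d) ℝ) (hK : IsCompact (SemiAlgSet f))
    (p : MvPolynomial (Fin d) ℝ) : ∃ lam : ℝ, 0 < lam ∧
      InPreordering f (MvPolynomial.C lam - p) ∧
      InPreordering f (MvPolynomial.C lam + p) := by
  obtain ⟨N, hN0, hN⟩ : ∃ N : ℝ, 0 < N ∧ ∀ x ∈ SemiAlgSet f, ∑ i, x i ^ 2 < N := by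
    obtain ⟨c, hc⟩ := hK.exists_bound_of_continuousOn (f := fun x : Fin d → ℝ => ∑ i, x i ^ 2)
      (Continuous.continuousOn (by fun_prop))
    refine ⟨|c| + 1, by positivity, fun x hx => ?_⟩
    have := hc x hx
    rw [Real.norm_eq_abs] at this
    linarith [le_abs_self c, le_abs_self (∑ i, x i ^ 2)]
  obtain ⟨t0, t1, ht0, ht1, h⟩ := weak_pos f N hN
  have hT := preO_T f
  set g : MvPolynomial (Fin d) ℝ := C N - ∑ i, X i ^ 2 with hg
  have hgT : (1 + t0) * g ∈ {p | InPreordering f p} := by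
    have := hT.mul _ ht1 _ (hT.sq g)
    convert this using 1
    rw [← h]
    ring
  obtain ⟨lam, hlam, ⟨s0, hs0, s1, hs1, h1⟩, -⟩ := arch_of_ball ((preO_sos d).adjoin g) N
    ⟨0, (preO_sos d).zero, 1, (preO_sos d).one, by ring⟩ t0
  have h2 : (1 + t0) * (C lam - t0) ∈ {p | InPreordering f p} := by
    have := hT.add _ (hT.mul _ (hT.add _ hT.one _ ht0) _ (inT_sos f hs0)) _
      (hT.mul _ hgT _ (inT_sos f hs1))
    convert this using 1
    rw [h1]
    ring
  have h3 : C (lam + (lam / 2) ^ 2) - t0 ∈ {p | InPreordering f p} := by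
    have := hT.add _ h2 _ (hT.sq (C (lam / 2) - t0))
    convert this using 1
    have e : (C (lam / 2) + C (lam / 2) : MvPolynomial (Fin d) ℝ) = C lam := by
      rw [← C_add, add_halves]
    simp only [C_add, C_pow]
    linear_combination t0 * e
  have h4 : ∑ i, (X i ^ 2 : MvPolynomial (Fin d) ℝ) ∈ {p | InPreordering f p} :=
    Finset.sum_induction _ (· ∈ {p | InPreordering f p}) (fun _ _ h1 h2 => hT.add _ h1 _ h2) hT.zero
          (fun j _ => hT.sq _)
  refine arch_of_ball hT (N + N * (lam + (lam / 2) ^ 2)) ?_ p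
  have := hT.add _ (hT.add _ hgT _ (hT.mul _ ht0 _ h4)) _
    (hT.mul _ (const_mem hT hN0.le) _ h3)
  convert this using 1
  rw [hg]
  simp only [C_add, C_mul]
  ring
end final

/-- If `K(f)` is compact, then the preordering `T(f)` is Archimedean. -/
theorem preordering_archimedean_of_compact {d k : ℕ}
    (f : Fin k → MvPolynomial (Fin d) ℝ) (hK : IsCompact (SemiAlgSet f)) :
    ∀ p : MvPolynomial (Fin d) ℝ, ∃ lam : ℝ, 0 < lam ∧
      InPreordering f (MvPolynomial.C lam - p) ∧
      InPreordering f (MvPolynomial.C lam + p) := by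
  intro p
  exact main_aux f hK p
end

section
/- Nussbaum's theorem: Let d ∈ ℕ and let s = (s_α)_{α∈ℕ₀^d} be a positive semidefinite real multisequence satisfying the multivariate Carleman condition: for each j = 1,…,d, ∑_{n=1}^∞ (s_{2n·e_j})^{−1/(2n)} = +∞ (with the convention 0^{−1/(2n)} = 0), where e_j is the j-th standard unit multi-index. Then s is a moment sequence with a unique representing measure: there exists exactly one Radon measure μ on ℝ^d such that every monomial x^α is μ-integrable and s_α = ∫_{ℝ^d} x^α dμ(x) for all α ∈ ℕ₀^d. -/
open MeasureTheory

/-- A Radon measure: finite on compact sets and inner regular with respect to compact sets. -/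
def IsRadon {X : Type*} [TopologicalSpace X] [MeasurableSpace X] (μ : Measure X) : Prop :=
  IsFiniteMeasureOnCompacts μ ∧ μ.InnerRegular

namespace Nuss
open scoped InnerProductSpace ComplexConjugate
open CompactlySupported


noncomputable def toCx {X : Type*} [TopologicalSpace X] (f : C(X, ℝ)) : C(X, ℂ) :=
  ⟨fun x => (f x : ℂ), by fun_prop⟩

lemma rmk {X : Type*} [TopologicalSpace X] [CompactSpace X] [T2Space X] [MeasurableSpace X]
    [BorelSpace X] {H : Type*} [NormedAddCommGroup H] [InnerProductSpace ℂ H] [CompleteSpace H]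
    (Ψ : C(X, ℂ) →⋆ₐ[ℂ] (H →L[ℂ] H)) (v : H) :
    ∃ μ : Measure X, IsFiniteMeasure μ ∧ ∀ f : C(X, ℂ), ∫ x, f x ∂μ = ⟪v, Ψ f v⟫_ℂ := by
  have hpos : ∀ f : C(X, ℝ), (∀ x, 0 ≤ f x) → 0 ≤ (⟪v, Ψ (toCx f) v⟫_ℂ).re := by
    intro f hf
    let g : C(X, ℝ) := ⟨fun x => √(f x), by fun_prop⟩
    have h1 : toCx f = star (toCx g) * toCx g := by
      ext x
      simp only [toCx, g, ContinuousMap.coe_mk, ContinuousMap.mul_apply, ContinuousMap.star_apply,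
        RCLike.star_def, Complex.conj_ofReal, ← Complex.ofReal_mul]
      rw [Real.mul_self_sqrt (hf x)]
    rw [h1, map_mul, map_star, ContinuousLinearMap.mul_apply, ContinuousLinearMap.star_eq_adjoint,
      ContinuousLinearMap.adjoint_inner_right]
    exact inner_self_nonneg (𝕜 := ℂ)
  have hself : ∀ f : C(X, ℝ), (⟪v, Ψ (toCx f) v⟫_ℂ).im = 0 := by
    intro f
    have h1 : toCx f = star (toCx f) := by
      ext x
      simp [toCx]
    have h2 : ⟪v, Ψ (toCx f) v⟫_ℂ = ⟪Ψ (toCx f) v, v⟫_ℂ := by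
      conv_lhs => rw [h1, map_star, ContinuousLinearMap.star_eq_adjoint,
        ContinuousLinearMap.adjoint_inner_right]
    have h3 := inner_conj_symm (𝕜 := ℂ) v (Ψ (toCx f) v)
    rw [← h2] at h3
    exact Complex.conj_eq_iff_im.1 h3
  let Λ₀ : C_c(X, ℝ) →ₗ[ℝ] ℝ :=
    { toFun := fun f => (⟪v, Ψ (toCx (f : C(X, ℝ))) v⟫_ℂ).re
      map_add' := by
        intro f g
        have : toCx ((f + g : C_c(X, ℝ)) : C(X, ℝ)) = toCx (f : C(X, ℝ)) + toCx (g : C(X, ℝ)) := by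
          ext x; simp [toCx]
        rw [this, map_add, ContinuousLinearMap.add_apply, inner_add_right, Complex.add_re]
      map_smul' := by
        intro c f
        have : toCx ((c • f : C_c(X, ℝ)) : C(X, ℝ)) = (c : ℂ) • toCx (f : C(X, ℝ)) := by
          ext x; simp [toCx]
        rw [this, map_smul, ContinuousLinearMap.smul_apply, inner_smul_right, Complex.re_ofReal_mul]
        rfl }
  let Λ : C_c(X, ℝ) →ₚ[ℝ] ℝ := PositiveLinearMap.mk₀ Λ₀ (by
    intro f hf
    exact hpos f (fun x => hf x))
  let μ := RealRMK.rieszMeasure Λ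
  have hfin : IsFiniteMeasure μ := by
    have : IsFiniteMeasureOnCompacts μ := by
      have : μ.Regular := by
        show (RealRMK.rieszMeasure Λ).Regular
        infer_instance
      infer_instance
    exact ⟨isCompact_univ.measure_lt_top⟩
  refine ⟨μ, hfin, ?_⟩
  have hreal : ∀ f : C(X, ℝ), ((∫ x, f x ∂μ : ℝ) : ℂ) = ⟪v, Ψ (toCx f) v⟫_ℂ := by
    intro f
    let f' : C_c(X, ℝ) := ⟨f, HasCompactSupport.of_compactSpace f⟩
    have h1 : ∫ x, f x ∂μ = (⟪v, Ψ (toCx f) v⟫_ℂ).re := RealRMK.integral_rieszMeasure Λ f'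
    rw [h1]
    apply Complex.ext
    · simp
    · rw [hself f]; simp
  intro f
  let fr : C(X, ℝ) := ⟨fun x => (f x).re, by fun_prop⟩
  let fi : C(X, ℝ) := ⟨fun x => (f x).im, by fun_prop⟩
  have hf : f = toCx fr + Complex.I • toCx fi := by
    ext x
    simp [toCx, fr, fi, mul_comm Complex.I, Complex.re_add_im]
  have hint : Integrable f μ := by
    refine (BoundedContinuousFunction.mkOfCompact f).integrable μ
  rw [← integral_re_add_im hint]
  have e1 := hreal fr
  have e2 := hreal fi
  simp only [fr, fi, ContinuousMap.coe_mk] at e1 e2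
  conv_rhs => rw [hf]
  rw [map_add, map_smul, ContinuousLinearMap.add_apply, ContinuousLinearMap.smul_apply,
    inner_add_right, inner_smul_right, ← e1, ← e2]
  simp [mul_comm]

def coordC (d : ℕ) (j : Fin d) : C(Fin d → ℂ, ℂ) := ⟨fun z => z j, by fun_prop⟩

lemma spectral_aux {A : Type*} [CommCStarAlgebra A] {H : Type*} [NormedAddCommGroup H]
    [InnerProductSpace ℂ H] [CompleteSpace H] (π : A →⋆ₐ[ℂ] (H →L[ℂ] H)) {d : ℕ} (r : Fin d → A) :
    ∃ Ψ : C(Fin d → ℂ, ℂ) →⋆ₐ[ℂ] (H →L[ℂ] H), (∀ j, Ψ (coordC d j) = π (r j)) ∧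
      ∀ v : H, ∃ μ : Measure (Fin d → ℂ), IsFiniteMeasure μ ∧
        ∀ f : C(Fin d → ℂ, ℂ), Integrable f μ ∧ ∫ z, f z ∂μ = ⟪v, Ψ f v⟫_ℂ := by
  let X := WeakDual.characterSpace ℂ A
  let Φ : C(X, ℂ) →⋆ₐ[ℂ] (H →L[ℂ] H) :=
    π.comp ((gelfandStarTransform A).symm : C(X, ℂ) →⋆ₐ[ℂ] A)
  let ρ : C(X, Fin d → ℂ) := ⟨fun x j => gelfandStarTransform A (r j) x, by fun_prop⟩
  let Ψ : C(Fin d → ℂ, ℂ) →⋆ₐ[ℂ] (H →L[ℂ] H) := Φ.comp (ContinuousMap.compStarAlgHom' ℂ ℂ ρ)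
  refine ⟨Ψ, ?_, ?_⟩
  · intro j
    have : (coordC d j).comp ρ = gelfandStarTransform A (r j) := by
      ext x; rfl
    show π ((gelfandStarTransform A).symm ((coordC d j).comp ρ)) = _
    rw [this, StarAlgEquiv.symm_apply_apply]
  · intro v
    let : MeasurableSpace X := borel X
    have : BorelSpace X := ⟨rfl⟩
    obtain ⟨μ, hμ, h⟩ := rmk Φ v
    have hρ : Measurable ρ := ρ.continuous.measurable
    refine ⟨μ.map ρ, inferInstance, fun f => ⟨?_, ?_⟩⟩
    · rw [integrable_map_measure f.continuous.aestronglyMeasurable hρ.aemeasurable]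
      exact (BoundedContinuousFunction.mkOfCompact (f.comp ρ)).integrable μ
    · rw [integral_map hρ.aemeasurable f.continuous.aestronglyMeasurable]
      exact h (f.comp ρ)

lemma spectral {H : Type*} [NormedAddCommGroup H]
    [InnerProductSpace ℂ H] [CompleteSpace H] {d : ℕ} (R : Fin d → H →L[ℂ] H)
    (hc : ∀ j k, R j * R k = R k * R j) (hs : ∀ j k, R j * star (R k) = star (R k) * R j) :
    ∃ Ψ : C(Fin d → ℂ, ℂ) →⋆ₐ[ℂ] (H →L[ℂ] H), (∀ j, Ψ (coordC d j) = R j) ∧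
      ∀ v : H, ∃ μ : Measure (Fin d → ℂ), IsFiniteMeasure μ ∧
        ∀ f : C(Fin d → ℂ, ℂ), Integrable f μ ∧ ∫ z, f z ∂μ = ⟪v, Ψ f v⟫_ℂ := by
  have hcomm : IsMulCommutative (StarAlgebra.adjoin ℂ (Set.range R)) := by
    apply StarAlgebra.isMulCommutative_adjoin
    · rintro _ ⟨j, rfl⟩ _ ⟨k, rfl⟩; exact hc j k
    · rintro _ ⟨j, rfl⟩ _ ⟨k, rfl⟩; exact hs j k
  let A := (StarAlgebra.adjoin ℂ (Set.range R)).topologicalClosure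
  have : IsClosed (A : Set (H →L[ℂ] H)) := StarSubalgebra.isClosed_topologicalClosure _
  have hA : ∀ a b : A, a * b = b * a :=
    (StarSubalgebra.commSemiringTopologicalClosure (StarAlgebra.adjoin ℂ (Set.range R))
      (fun a b => hcomm.is_comm.comm a b)).mul_comm
  let : CommCStarAlgebra A := { StarSubalgebra.cstarAlgebra A with mul_comm := hA }
  let r : Fin d → A := fun j => ⟨R j, StarSubalgebra.le_topologicalClosure _
    (StarAlgebra.subset_adjoin ℂ _ ⟨j, rfl⟩)⟩
  exact spectral_aux A.subtype r

open Finset in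
lemma carleman_summable (b : ℕ → ℝ) (hb : ∀ n, 0 < b n) (hs : Summable b) :
    Summable fun n : ℕ => (∏ k ∈ range (n + 1), b k) ^ (1 / ((n : ℝ) + 1)) := by
  set T : ℕ → ℝ := fun n => ∑ k ∈ range n, ((k : ℝ) + 1) * b k with hT
  have hTn : ∀ n, 0 ≤ T n := fun n => Finset.sum_nonneg fun k _ => by
    have := (hb k).le; positivity
  have hind : ∀ N : ℕ, ∑ n ∈ range N, T (n + 1) / ((n : ℝ) + 1) ^ 2 ≤
      2 * ∑ k ∈ range N, b k - 2 * T N / ((N : ℝ) + 1) := by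
    intro N
    induction N with
    | zero => simp [hT]
    | succ N ih =>
      rw [sum_range_succ, sum_range_succ]
      have e : T N = T (N + 1) - ((N : ℝ) + 1) * b N := by simp [hT, sum_range_succ]
      rw [e] at ih
      have h1 := hTn (N + 1)
      have e2 : 2 * (T (N + 1) - ((N : ℝ) + 1) * b N) / ((N : ℝ) + 1)
        = 2 * T (N + 1) / ((N : ℝ) + 1) - 2 * b N := by field_simp
      rw [e2] at ih
      have e3 : T (N + 1) / ((N : ℝ) + 1) ^ 2 ≤ 2 * T (N + 1) / ((N : ℝ) + 1)
          - 2 * T (N + 1) / (((N + 1 : ℕ) : ℝ) + 1) := by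
        push_cast
        rw [div_sub_div _ _ (by positivity) (by positivity), div_le_div_iff₀ (by positivity)
          (by positivity)]
        have hN : (0 : ℝ) ≤ N := by positivity
        nlinarith [mul_nonneg h1 hN, mul_nonneg h1 (mul_nonneg hN hN),
          mul_nonneg h1 (mul_nonneg hN (mul_nonneg hN hN))]
      linarith
  have hsum : Summable fun n : ℕ => T (n + 1) / ((n : ℝ) + 1) ^ 2 := by
    refine summable_of_sum_range_le (c := 2 * ∑' k, b k) (fun n => ?_) (fun N => ?_)
    · have := hTn (n + 1); positivity
    · refine (hind N).trans ?_
      have h1 := hs.sum_le_tsum (range N) (fun k _ => (hb k).le)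
      have h2 : 0 ≤ 2 * T N / ((N : ℝ) + 1) := by have := hTn N; positivity
      linarith
  refine Summable.of_nonneg_of_le (fun n => ?_) (fun n => ?_) (hsum.mul_left (Real.exp 1))
  · exact Real.rpow_nonneg (Finset.prod_nonneg fun k _ => (hb k).le) _
  · have hn : (0 : ℝ) < (n : ℝ) + 1 := by positivity
    have hP : 0 < ∏ k ∈ range (n + 1), b k := Finset.prod_pos fun k _ => hb k
    have amgm := Real.geom_mean_le_arith_mean_weighted (range (n + 1))
      (fun _ => 1 / ((n : ℝ) + 1)) (fun k => ((k : ℝ) + 1) * b k) (fun _ _ => by positivity)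
      (by simp; field_simp) (fun k _ => by have := (hb k).le; positivity)
    rw [Real.finsetProd_rpow _ _ (fun k _ => by have := (hb k).le; positivity),
      ← Finset.mul_sum, Finset.prod_mul_distrib,
      Real.mul_rpow (Finset.prod_nonneg fun k _ => by positivity) hP.le] at amgm
    have hfac : ∏ k ∈ range (n + 1), ((k : ℝ) + 1) = ((n + 1).factorial : ℝ) := by
      rw [← Finset.prod_range_add_one_eq_factorial]; push_cast; rfl
    rw [hfac] at amgm
    have hst : ((n : ℝ) + 1) / Real.exp 1 ≤ ((n + 1).factorial : ℝ) ^ (1 / ((n : ℝ) + 1)) := by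
      have h := Real.pow_div_factorial_le_exp ((n : ℝ) + 1) hn.le (n + 1)
      have hf : (0 : ℝ) < ((n + 1).factorial : ℝ) := by positivity
      have h2 : (((n : ℝ) + 1) / Real.exp 1) ^ (n + 1) ≤ ((n + 1).factorial : ℝ) := by
        rw [div_pow, ← Real.exp_nat_mul, div_le_iff₀ (by positivity)]
        rw [div_le_iff₀ hf] at h
        push_cast
        rw [mul_one]; linarith
      calc ((n : ℝ) + 1) / Real.exp 1
          = ((((n : ℝ) + 1) / Real.exp 1) ^ (n + 1)) ^ (1 / ((n : ℝ) + 1)) := by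
            rw [← Real.rpow_natCast, ← Real.rpow_mul (by positivity)]
            push_cast
            rw [mul_one_div_cancel hn.ne', Real.rpow_one]
        _ ≤ _ := Real.rpow_le_rpow (by positivity) h2 (by positivity)
    set Q := (∏ k ∈ range (n + 1), b k) ^ (1 / ((n : ℝ) + 1)) with hQ
    have hQ0 : 0 ≤ Q := Real.rpow_nonneg hP.le _
    have h3 : ((n : ℝ) + 1) / Real.exp 1 * Q ≤ 1 / ((n : ℝ) + 1) * T (n + 1) :=
      (mul_le_mul_of_nonneg_right hst hQ0).trans amgm
    have he := Real.exp_pos 1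
    have : Q = (((n : ℝ) + 1) / Real.exp 1 * Q) * (Real.exp 1 / ((n : ℝ) + 1)) := by
      field_simp
    rw [this]
    calc _ ≤ (1 / ((n : ℝ) + 1) * T (n + 1)) * (Real.exp 1 / ((n : ℝ) + 1)) := by gcongr
      _ = _ := by field_simp


lemma key {H : Type*} [NormedAddCommGroup H] [InnerProductSpace ℂ H] (v : ℕ → H)
    (hsym : ∀ m n, ⟪v (m + 1), v n⟫_ℂ = ⟪v m, v (n + 1)⟫_ℂ) (φ : H) (l : ℂ) (hl : l.im ≠ 0)
    (hφ : ∀ n, ⟪φ, v (n + 1)⟫_ℂ = l * ⟪φ, v n⟫_ℂ) (M : ℕ → ℝ) (hM : ∀ n, ‖v (n + 1)‖ ≤ M n)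
    (hMpos : ∀ n, 0 < M n)
    (hdiv : ¬ Summable fun n : ℕ => M n ^ (-(1 / ((n : ℝ) + 1)))) : ⟪φ, v 0⟫_ℂ = 0 := by
  by_contra hne
  let V : ℕ → Submodule ℂ H := fun n => Submodule.span ℂ (v '' Set.Iio n)
  have hVfin : ∀ n, FiniteDimensional ℂ (V n) := fun n =>
    FiniteDimensional.span_of_finite ℂ ((Set.finite_Iio n).image v)
  have hVle : ∀ n, V n ≤ V (n + 1) := fun n =>
    Submodule.span_mono (Set.image_mono (Set.Iio_subset_Iio (Nat.le_succ n)))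
  have hvV : ∀ n, v n ∈ V (n + 1) := fun n =>
    Submodule.subset_span ⟨n, Nat.lt_succ_self n, rfl⟩
  have hVsucc : ∀ n y, y ∈ V (n + 1) → ∃ t : ℂ, ∃ u ∈ V n, y = t • v n + u := by
    intro n y hy
    have : v '' Set.Iio (n + 1) = insert (v n) (v '' Set.Iio n) := by
      rw [← Set.image_insert_eq]; congr 1; ext k; simp [Nat.lt_succ_iff_lt_or_eq, or_comm, Nat.le_iff_lt_or_eq]
    simp only [V] at hy ⊢
    rw [this, Submodule.mem_span_insert] at hy
    exact hy
  let G : Submodule ℂ (H × H) := Submodule.span ℂ (Set.range fun k => (v k, v (k + 1)))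
  have hG1 : ∀ p ∈ G, ⟪φ, p.2⟫_ℂ = l * ⟪φ, p.1⟫_ℂ := by
    intro p hp
    induction hp using Submodule.span_induction with
    | mem x hx => obtain ⟨k, rfl⟩ := hx; exact hφ k
    | zero => simp
    | add x y _ _ hx hy => simp only [Prod.snd_add, Prod.fst_add, inner_add_right, hx, hy]; ring
    | smul a x _ hx => simp only [Prod.smul_snd, Prod.smul_fst, inner_smul_right, hx]; ring
  have hG2 : ∀ p ∈ G, ∀ q ∈ G, ⟪p.2, q.1⟫_ℂ = ⟪p.1, q.2⟫_ℂ := by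
    intro p hp q hq
    induction hp using Submodule.span_induction with
    | mem x hx =>
      obtain ⟨k, rfl⟩ := hx
      induction hq using Submodule.span_induction with
      | mem x hx => obtain ⟨m, rfl⟩ := hx; exact hsym k m
      | zero => simp
      | add x y _ _ hx hy => simp only [Prod.snd_add, Prod.fst_add, inner_add_right, hx, hy]
      | smul a x _ hx => simp only [Prod.smul_snd, Prod.smul_fst, inner_smul_right, hx]
    | zero => simp
    | add x y _ _ hx hy => simp only [Prod.snd_add, Prod.fst_add, inner_add_left, hx, hy]
    | smul a x _ hx => simp only [Prod.smul_snd, Prod.smul_fst, inner_smul_left, hx]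
  have hG3 : ∀ n, ∀ y ∈ V n, ∃ y' ∈ V (n + 1), (y, y') ∈ G := by
    intro n y hy
    induction hy using Submodule.span_induction with
    | mem x hx =>
      obtain ⟨k, hk, rfl⟩ := hx
      refine ⟨v (k + 1), Submodule.subset_span ⟨k + 1, ?_, rfl⟩, Submodule.subset_span ⟨k, rfl⟩⟩
      simp at hk ⊢; omega
    | zero => exact ⟨0, zero_mem _, zero_mem G⟩
    | add x y _ _ hx hy =>
      obtain ⟨x', h1, h2⟩ := hx
      obtain ⟨y', h3, h4⟩ := hy
      exact ⟨x' + y', add_mem h1 h3, add_mem h2 h4⟩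
    | smul a x _ hx =>
      obtain ⟨x', h1, h2⟩ := hx
      exact ⟨a • x', Submodule.smul_mem _ _ h1, Submodule.smul_mem G a h2⟩
  -- projections
  let pr : ℕ → H →L[ℂ] H := fun n => (V n).starProjection
  have hprm : ∀ n x, pr n x ∈ V n := fun n x => Submodule.starProjection_apply_mem _ _
  have hpro : ∀ n x w, w ∈ V n → ⟪x - pr n x, w⟫_ℂ = 0 := fun n x w hw =>
    Submodule.starProjection_inner_eq_zero x w hw
  have hpr' : ∀ n x w, w ∈ V n → ⟪x, w⟫_ℂ = ⟪pr n x, w⟫_ℂ := fun n x w hw => by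
    have := hpro n x w hw
    rw [inner_sub_left, sub_eq_zero] at this
    exact this
  have hprid : ∀ n x, x ∈ V n → pr n x = x := fun n x hx =>
    Submodule.starProjection_eq_self_iff.2 hx
  have hprpr : ∀ n x, pr n (pr (n + 1) x) = pr n x := by
    intro n x
    have := Submodule.starProjection_comp_starProjection_of_le (hVle n)
    exact congrArg (fun T : H →L[ℂ] H => T x) this
  let f : ℕ → H := fun n => pr n φ
  let D : ℕ → H := fun n => f (n + 1) - f n
  let P : ℕ → H := fun n => v n - pr n (v n)
  have hDV : ∀ n w, w ∈ V n → ⟪D n, w⟫_ℂ = 0 := by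
    intro n w hw
    rw [inner_sub_left, ← hpr' n φ w hw, ← hpr' (n + 1) φ w (hVle n hw), sub_self]
  have hpyth : ∀ n, ‖f (n + 1)‖ ^ 2 = ‖f n‖ ^ 2 + ‖D n‖ ^ 2 := by
    intro n
    have h1 : f (n + 1) = D n + f n := by simp [D]
    have h2 := hDV n (f n) (hprm n φ)
    have := norm_add_sq (𝕜 := ℂ) (D n) (f n)
    rw [h2] at this
    rw [h1, this]; simp; ring
  have hfφ : ∀ n, ⟪φ, f n⟫_ℂ = ((‖f n‖ ^ 2 : ℝ) : ℂ) := by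
    intro n
    rw [hpr' n φ (f n) (hprm n φ)]
    show ⟪f n, f n⟫_ℂ = _
    rw [inner_self_eq_norm_sq_to_K]; simp
  have claim : ∀ n, |l.im| * ‖f (n + 1)‖ ^ 2 * ‖P n‖ ≤ ‖D n‖ * ‖D (n + 1)‖ * ‖P (n + 1)‖ := by
    intro n
    obtain ⟨t, u, hu, hf⟩ := hVsucc n (f (n + 1)) (hprm (n + 1) φ)
    obtain ⟨u', hu', huG⟩ := hG3 n u hu
    set y' := t • v (n + 1) + u' with hy'
    have hyG : (f (n + 1), y') ∈ G := by
      have := add_mem (Submodule.smul_mem G t (Submodule.subset_span ⟨n, rfl⟩)) huG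
      rw [hf]; exact this
    have hyV : y' ∈ V (n + 2) := add_mem (Submodule.smul_mem _ _ (hvV (n + 1))) (hVle _ hu')
    have hDt : D n = t • P n := by
      have h1 : f n = pr n (f (n + 1)) := (hprpr n φ).symm
      have h2 : pr n (f (n + 1)) = t • pr n (v n) + u := by
        rw [hf, map_add, map_smul, hprid n u hu]
      show f (n + 1) - f n = t • (v n - pr n (v n))
      rw [h1, h2, smul_sub]
      conv_lhs => rw [hf]
      abel
    have e1 := hG1 _ hyG
    simp only at e1
    rw [hfφ] at e1
    have e2 : ⟪φ, y'⟫_ℂ = ⟪f (n + 1), y'⟫_ℂ + ⟪D (n + 1), y'⟫_ℂ := by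
      rw [hpr' (n + 2) φ y' hyV, ← inner_add_left]
      simp [D, f]
    have e3 : (⟪f (n + 1), y'⟫_ℂ).im = 0 := by
      have h1 := hG2 _ hyG _ hyG
      simp only at h1
      have h3 := inner_conj_symm (𝕜 := ℂ) (f (n + 1)) y'
      rw [h1] at h3
      exact Complex.conj_eq_iff_im.1 h3
    have e4 : ⟪D (n + 1), y'⟫_ℂ = t * ⟪D (n + 1), P (n + 1)⟫_ℂ := by
      rw [hy', inner_add_right, hDV (n + 1) u' hu', add_zero, inner_smul_right]
      congr 1
      show _ = ⟪D (n + 1), v (n + 1) - pr (n + 1) (v (n + 1))⟫_ℂ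
      rw [inner_sub_right, hDV (n + 1) _ (hprm (n + 1) _), sub_zero]
    have e5 : |l.im| * ‖f (n + 1)‖ ^ 2 ≤ ‖t‖ * (‖D (n + 1)‖ * ‖P (n + 1)‖) := by
      have h1 : l.im * ‖f (n + 1)‖ ^ 2 = (t * ⟪D (n + 1), P (n + 1)⟫_ℂ).im := by
        have := congrArg Complex.im (e1.symm.trans e2)
        rw [Complex.add_im, e3, zero_add, e4, Complex.im_mul_ofReal] at this
        exact this
      have h2 : |l.im| * ‖f (n + 1)‖ ^ 2 = |(t * ⟪D (n + 1), P (n + 1)⟫_ℂ).im| := by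
        rw [← h1, abs_mul, abs_of_nonneg (sq_nonneg ‖f (n + 1)‖)]
      rw [h2]
      refine (Complex.abs_im_le_norm _).trans ?_
      rw [norm_mul]
      gcongr
      exact norm_inner_le_norm _ _
    have e6 : ‖D n‖ = ‖t‖ * ‖P n‖ := by rw [hDt, norm_smul]
    rw [e6]
    calc _ ≤ ‖t‖ * (‖D (n + 1)‖ * ‖P (n + 1)‖) * ‖P n‖ := by gcongr
      _ = _ := by ring
  have hf1 : 0 < ‖f 1‖ ^ 2 := by
    have : f 1 ≠ 0 := by
      intro h
      apply hne
      rw [hpr' 1 φ (v 0) (hvV 0)]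
      show ⟪f 1, v 0⟫_ℂ = 0
      rw [h, inner_zero_left]
    positivity
  have hfm : ∀ n, ‖f 1‖ ^ 2 ≤ ‖f (n + 1)‖ ^ 2 := by
    intro n
    induction n with
    | zero => exact le_rfl
    | succ n ih => rw [hpyth (n + 1)]; nlinarith [sq_nonneg ‖D (n + 1)‖]
  set c := |l.im| * ‖f 1‖ ^ 2 with hc
  have hcpos : 0 < c := mul_pos (abs_pos.2 hl) hf1
  have claim' : ∀ n, c * ‖P n‖ ≤ ‖D n‖ * ‖D (n + 1)‖ * ‖P (n + 1)‖ := fun n => by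
    refine le_trans ?_ (claim n)
    have := hfm n
    rw [hc]
    gcongr
  have hP0 : ∀ n, 0 < ‖P n‖ := by
    intro n
    induction n with
    | zero =>
      have hV0 : ∀ w ∈ V 0, w = 0 := by
        intro w hw
        simpa [V] using hw
      have : P 0 = v 0 := by
        show v 0 - pr 0 (v 0) = v 0
        rw [hV0 _ (hprm 0 (v 0)), sub_zero]
      rw [this, norm_pos_iff]
      intro h; apply hne; rw [h, inner_zero_right]
    | succ n ih =>
      have h1 := claim' n
      have h2 : 0 < c * ‖P n‖ := mul_pos hcpos ih
      by_contra h3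
      have h4 : ‖P (n + 1)‖ = 0 := le_antisymm (not_lt.1 h3) (norm_nonneg _)
      rw [h4] at h1; linarith
  have hDs : Summable fun n => ‖D n‖ ^ 2 := by
    refine summable_of_sum_range_le (c := ‖φ‖ ^ 2) (fun n => by positivity) (fun N => ?_)
    have h1 : ∑ n ∈ Finset.range N, ‖D n‖ ^ 2 = ‖f N‖ ^ 2 - ‖f 0‖ ^ 2 := by
      rw [← Finset.sum_range_sub (fun n => ‖f n‖ ^ 2)]
      exact Finset.sum_congr rfl fun n _ => by rw [hpyth n]; ring
    have h2 : ‖f N‖ ≤ ‖φ‖ := Submodule.norm_starProjection_apply_le _ _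
    rw [h1]
    nlinarith [sq_nonneg ‖f 0‖, norm_nonneg (f N)]
  have hbs : Summable fun n => ‖P n‖ / ‖P (n + 1)‖ := by
    refine Summable.of_nonneg_of_le (fun n => by positivity) (fun n => ?_)
      ((hDs.add ((summable_nat_add_iff 1).2 hDs)).mul_left (1 / c))
    have h1 := claim' n
    have h2 := hP0 (n + 1)
    rw [div_le_iff₀ h2, one_div, inv_mul_eq_div, div_mul_eq_mul_div, le_div_iff₀ hcpos]
    have h3 : ‖D n‖ * ‖D (n + 1)‖ ≤ ‖D n‖ ^ 2 + ‖D (n + 1)‖ ^ 2 := by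
      nlinarith [sq_nonneg (‖D n‖ - ‖D (n + 1)‖), sq_nonneg (‖D n‖), sq_nonneg (‖D (n + 1)‖)]
    calc ‖P n‖ * c = c * ‖P n‖ := mul_comm _ _
      _ ≤ _ := h1
      _ ≤ _ := by gcongr
  have hcar := carleman_summable _ (fun n => div_pos (hP0 n) (hP0 (n + 1))) hbs
  apply hdiv
  have hprod : ∀ n, ∏ k ∈ Finset.range (n + 1), ‖P k‖ / ‖P (k + 1)‖ = ‖P 0‖ / ‖P (n + 1)‖ := by
    intro n
    induction n with
    | zero => simp
    | succ n ih =>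
      rw [Finset.prod_range_succ, ih]
      have := (hP0 (n + 1)).ne'
      field_simp
  have hPv : ∀ n, ‖P n‖ ≤ ‖v n‖ := by
    intro n
    have h2 := hpro n (v n) (pr n (v n)) (hprm n _)
    have := norm_add_sq (𝕜 := ℂ) (P n) (pr n (v n))
    rw [h2] at this
    have e : P n + pr n (v n) = v n := by simp [P]
    rw [e] at this
    simp at this
    exact le_of_sq_le_sq (by nlinarith [sq_nonneg ‖pr n (v n)‖]) (norm_nonneg _)
  set m := min 1 ‖P 0‖ with hm
  have hmpos : 0 < m := lt_min one_pos (hP0 0)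
  refine Summable.of_nonneg_of_le (fun n => Real.rpow_nonneg (hMpos n).le _) (fun n => ?_)
    (hcar.mul_left (1 / m))
  rw [hprod]
  have hn : (0 : ℝ) < (n : ℝ) + 1 := by positivity
  have hexp : 1 / ((n : ℝ) + 1) ≤ 1 := by rw [div_le_one hn]; linarith [Nat.cast_nonneg (α := ℝ) n]
  have h1 : m ≤ m ^ (1 / ((n : ℝ) + 1)) := by
    conv_lhs => rw [← Real.rpow_one m]
    exact Real.rpow_le_rpow_of_exponent_ge hmpos (min_le_left _ _) hexp
  have h2 : m / M n ≤ ‖P 0‖ / ‖P (n + 1)‖ :=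
    div_le_div₀ (norm_nonneg _) (min_le_right _ _) (hP0 _) ((hPv (n + 1)).trans (hM n))
  have h3 : m * M n ^ (-(1 / ((n : ℝ) + 1))) ≤ (‖P 0‖ / ‖P (n + 1)‖) ^ (1 / ((n : ℝ) + 1)) := by
    calc m * M n ^ (-(1 / ((n : ℝ) + 1)))
        ≤ m ^ (1 / ((n : ℝ) + 1)) * M n ^ (-(1 / ((n : ℝ) + 1))) := by
          have := Real.rpow_nonneg (hMpos n).le (-(1 / ((n : ℝ) + 1)))
          gcongr
      _ = (m / M n) ^ (1 / ((n : ℝ) + 1)) := by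
          rw [Real.div_rpow hmpos.le (hMpos n).le, Real.rpow_neg (hMpos n).le]; rfl
      _ ≤ _ := Real.rpow_le_rpow (div_nonneg hmpos.le (hMpos n).le) h2 (by positivity)
  calc _ = 1 / m * (m * M n ^ (-(1 / ((n : ℝ) + 1)))) := by field_simp
    _ ≤ _ := by gcongr

lemma powbound {c e : ℝ} (hc : 0 < c) (h1 : -1 ≤ e) (h2 : e ≤ 1) : c ^ e ≤ max c c⁻¹ := by
  rcases le_total 1 c with h | h
  · refine le_trans ?_ (le_max_left _ _)
    conv_rhs => rw [← Real.rpow_one c]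
    exact Real.rpow_le_rpow_of_exponent_le h h2
  · refine le_trans ?_ (le_max_right _ _)
    rw [← Real.rpow_neg_one c]
    exact Real.rpow_le_rpow_of_exponent_ge hc h h1

lemma tpos (t : ℕ → ℝ) (ht : ∀ n, 0 ≤ t n) (hlc : ∀ n, t (n + 1) ^ 2 ≤ t n * t (n + 2))
    (hd : ¬ Summable fun n : ℕ => t (n + 1) ^ (-(1 / (2 * ((n : ℝ) + 1))))) : ∀ n, 0 < t n := by
  have h1 : ∀ n, 0 < t (n + 1) := by
    by_contra hcon
    push Not at hcon
    obtain ⟨n, hn⟩ := hcon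
    have hz : ∀ k, t (n + k + 1) = 0 := by
      intro k
      induction k with
      | zero => exact le_antisymm hn (ht _)
      | succ k ih =>
        have := hlc (n + k + 1)
        rw [ih, zero_mul] at this
        exact pow_eq_zero_iff (two_ne_zero) |>.1 (le_antisymm this (sq_nonneg _))
    apply hd
    rw [← summable_nat_add_iff n]
    refine summable_zero.congr ?_
    intro k
    rw [add_comm k n, hz k, Real.zero_rpow]
    push_cast
    have : (0 : ℝ) < 1 / (2 * ((n : ℝ) + k + 1)) := by positivity
    linarith
  intro n
  cases n with
  | succ n => exact h1 n
  | zero =>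
    have h2 := hlc 0
    have h3 := h1 0
    have h4 := h1 1
    simp only [zero_add] at h2 h3
    by_contra h5
    have h6 : t 0 = 0 := le_antisymm (not_lt.1 h5) (ht 0)
    rw [h6] at h2
    nlinarith

lemma doubling (t : ℕ → ℝ) (ht : ∀ n, 0 ≤ t n) (hlc : ∀ n, t (n + 1) ^ 2 ≤ t n * t (n + 2))
    (hd : ¬ Summable fun n : ℕ => t (n + 1) ^ (-(1 / (2 * ((n : ℝ) + 1))))) (C : ℝ) (hC : 0 < C) :
    ¬ Summable fun n : ℕ => (C * t (2 * (n + 1)) ^ (1 / 4 : ℝ)) ^ (-(1 / ((n : ℝ) + 1))) := by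
  have hp := tpos t ht hlc hd
  intro hS
  apply hd
  set u : ℕ → ℝ := fun n => t n / t 0 with hu
  have hup : ∀ n, 0 < u n := fun n => div_pos (hp n) (hp 0)
  have hu0 : u 0 = 1 := div_self (hp 0).ne'
  have hul : ∀ n, u (n + 1) ^ 2 ≤ u n * u (n + 2) := by
    intro n
    simp only [hu]
    rw [div_pow, div_mul_div_comm, ← sq]
    have := hp 0
    gcongr
    exact hlc n
  have hmono : ∀ n, u n ^ (n + 1) ≤ u (n + 1) ^ n := by
    intro n
    induction n with
    | zero => simp [hu0]
    | succ n ih =>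
      have h1 : (u (n + 1) ^ 2) ^ (n + 1) ≤ (u n * u (n + 2)) ^ (n + 1) := by
        have := hul n; gcongr
      rw [mul_pow] at h1
      have h2 : u n ^ (n + 1) * u (n + 2) ^ (n + 1) ≤ u (n + 1) ^ n * u (n + 2) ^ (n + 1) := by
        have := (hup (n + 2)).le
        gcongr
      have h3 : u (n + 1) ^ n * u (n + 1) ^ (n + 2) ≤ u (n + 1) ^ n * u (n + 2) ^ (n + 1) := by
        refine le_trans (le_of_eq ?_) (h1.trans h2)
        ring
      exact le_of_mul_le_mul_left h3 (pow_pos (hup _) _)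
  set a : ℕ → ℝ := fun m => u (m + 1) ^ (-(1 / (2 * ((m : ℝ) + 1)))) with ha
  have hapos : ∀ m, 0 ≤ a m := fun m => Real.rpow_nonneg (hup _).le _
  have hanti : ∀ m, a (m + 1) ≤ a m := by
    intro m
    have h := hmono (m + 1)
    have h1 := Real.rpow_le_rpow_of_nonpos (pow_pos (hup (m + 1)) (m + 2)) h
      (z := -(1 / (2 * ((m : ℝ) + 1) * ((m : ℝ) + 2)))) (by
        have : (0 : ℝ) < 1 / (2 * ((m : ℝ) + 1) * ((m : ℝ) + 2)) := by positivity
        linarith)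
    rw [← Real.rpow_natCast, ← Real.rpow_natCast, ← Real.rpow_mul (hup _).le,
      ← Real.rpow_mul (hup _).le] at h1
    simp only [ha]
    convert h1 using 2
    · push_cast
      have : ((m : ℝ) + 1) ≠ 0 := by positivity
      have : ((m : ℝ) + 2) ≠ 0 := by positivity
      have : ((m : ℝ) + 1 + 1) ≠ 0 := by positivity
      field_simp
      ring
    · push_cast
      have : ((m : ℝ) + 1) ≠ 0 := by positivity
      have : ((m : ℝ) + 2) ≠ 0 := by positivity
      field_simp
  have ht0 := hp 0
  set K := max (t 0) (t 0)⁻¹ with hK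
  set K' := max C C⁻¹ with hK'
  have hKp : 0 ≤ K := le_trans ht0.le (le_max_left _ _)
  have hta : ∀ m, t (m + 1) ^ (-(1 / (2 * ((m : ℝ) + 1)))) =
      t 0 ^ (-(1 / (2 * ((m : ℝ) + 1)))) * a m := by
    intro m
    simp only [ha]
    rw [← Real.mul_rpow ht0.le (hup _).le]
    congr 1
    simp only [hu]
    field_simp
  have hodd : Summable fun n => a (2 * n + 1) := by
    refine Summable.of_nonneg_of_le (fun n => hapos _) (fun n => ?_) (hS.mul_left (K * K'))
    have hn : (0 : ℝ) < (n : ℝ) + 1 := by positivity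
    have hn0 : (0 : ℝ) ≤ (n : ℝ) := by positivity
    have e1 : (C * t (2 * (n + 1)) ^ (1 / 4 : ℝ)) ^ (-(1 / ((n : ℝ) + 1))) =
        C ^ (-(1 / ((n : ℝ) + 1))) * (t 0 ^ (-(1 / (4 * ((n : ℝ) + 1)))) * a (2 * n + 1)) := by
      rw [Real.mul_rpow hC.le (Real.rpow_nonneg (ht _) _), ← Real.rpow_mul (ht _)]
      congr 1
      have := hta (2 * n + 1)
      push_cast at this
      have e : 2 * (2 * (n : ℝ) + 1 + 1) = 4 * ((n : ℝ) + 1) := by ring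
      rw [e] at this
      rw [← this]
      congr 1
      field_simp
    rw [e1]
    have e2 : a (2 * n + 1) = (t 0 ^ (1 / (4 * ((n : ℝ) + 1))) * C ^ (1 / ((n : ℝ) + 1))) *
       (C ^ (-(1 / ((n : ℝ) + 1))) * (t 0 ^ (-(1 / (4 * ((n : ℝ) + 1)))) * a (2 * n + 1))) := by
      rw [Real.rpow_neg hC.le, Real.rpow_neg ht0.le]
      have h1 := (Real.rpow_pos_of_pos hC (1 / ((n : ℝ) + 1))).ne'
      have h2 := (Real.rpow_pos_of_pos ht0 (1 / (4 * ((n : ℝ) + 1)))).ne'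
      generalize C ^ (1 / ((n : ℝ) + 1)) = X at *
      generalize t 0 ^ (1 / (4 * ((n : ℝ) + 1))) = Y at *
      field_simp
    conv_lhs => rw [e2]
    have h0 : 0 ≤ (C ^ (-(1 / ((n : ℝ) + 1))) *
        (t 0 ^ (-(1 / (4 * ((n : ℝ) + 1)))) * a (2 * n + 1))) :=
      mul_nonneg (Real.rpow_nonneg hC.le _) (mul_nonneg (Real.rpow_nonneg ht0.le _) (hapos _))
    apply mul_le_mul_of_nonneg_right _ h0
    have p1 : (0 : ℝ) ≤ 1 / (4 * ((n : ℝ) + 1)) := by positivity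
    have p2 : (0 : ℝ) ≤ 1 / ((n : ℝ) + 1) := by positivity
    exact mul_le_mul (powbound ht0 (by linarith)
      (by rw [div_le_one (by positivity)]; linarith)) (powbound hC (by linarith)
      (by rw [div_le_one (by positivity)]; linarith)) (Real.rpow_nonneg hC.le _) hKp
  have heven : Summable fun n => a (2 * n + 2) :=
    Summable.of_nonneg_of_le (fun n => hapos _) (fun n => hanti _) hodd
  have hall : Summable a := by
    rw [← summable_nat_add_iff 1]
    exact (HasSum.even_add_odd (f := fun n => a (n + 1)) hodd.hasSum heven.hasSum).summable
  refine Summable.of_nonneg_of_le (fun n => Real.rpow_nonneg (ht _) _) (fun n => ?_)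
    (hall.mul_left K)
  rw [hta]
  have hn0 : (0 : ℝ) ≤ (n : ℝ) := by positivity
  have p1 : (0 : ℝ) ≤ 1 / (2 * ((n : ℝ) + 1)) := by positivity
  have p2 : 1 / (2 * ((n : ℝ) + 1)) ≤ 1 := by rw [div_le_one (by positivity)]; linarith
  exact mul_le_mul_of_nonneg_right (powbound ht0 (by linarith) (by linarith)) (hapos _)


noncomputable abbrev Pol (d : ℕ) := MvPolynomial (Fin d) ℂ

noncomputable def conjP {d : ℕ} : Pol d →+* Pol d := MvPolynomial.map (starRingEnd ℂ)

@[simp] lemma conjP_X {d : ℕ} (j : Fin d) : conjP (MvPolynomial.X j : Pol d) = MvPolynomial.X j :=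
  MvPolynomial.map_X _ _

@[simp] lemma conjP_C {d : ℕ} (c : ℂ) :
    conjP (MvPolynomial.C c : Pol d) = MvPolynomial.C (conj c) :=
  MvPolynomial.map_C _ _

@[simp] lemma conjP_conjP {d : ℕ} (p : Pol d) : conjP (conjP p) = p := by
  rw [conjP, MvPolynomial.map_map]
  have : (starRingEnd ℂ).comp (starRingEnd ℂ) = RingHom.id ℂ := by ext x; simp
  rw [this, MvPolynomial.map_id]

noncomputable def Lf {d : ℕ} (s : (Fin d → ℕ) → ℝ) : Pol d →ₗ[ℂ] ℂ :=
  (MvPolynomial.basisMonomials (Fin d) ℂ).constr ℂ (fun m => (s m : ℂ))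

lemma Lf_monomial {d : ℕ} (s : (Fin d → ℕ) → ℝ) (m : Fin d →₀ ℕ) (c : ℂ) :
    Lf s (MvPolynomial.monomial m c) = c * s m := by
  have h1 : MvPolynomial.monomial m c = c • MvPolynomial.basisMonomials (Fin d) ℂ m := by
    rw [MvPolynomial.coe_basisMonomials, MvPolynomial.smul_monomial]; simp
  rw [h1, map_smul, Lf, Module.Basis.constr_basis]; rfl

lemma Lf_conj {d : ℕ} (s : (Fin d → ℕ) → ℝ) (p : Pol d) : Lf s (conjP p) = conj (Lf s p) := by
  induction p using MvPolynomial.induction_on' with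
  | monomial m c => rw [conjP, MvPolynomial.map_monomial, Lf_monomial, Lf_monomial]; simp
  | add p q hp hq => rw [map_add, map_add, hp, hq, map_add, map_add]

lemma psd_finset {d : ℕ} (s : (Fin d → ℕ) → ℝ)
    (hpsd : ∀ ξ : (Fin d → ℕ) →₀ ℝ,
      0 ≤ ∑ α ∈ ξ.support, ∑ β ∈ ξ.support, s (α + β) * ξ α * ξ β)
    (T : Finset (Fin d →₀ ℕ)) (g : (Fin d →₀ ℕ) → ℝ) :
    0 ≤ ∑ m ∈ T, ∑ n ∈ T, s (⇑m + ⇑n) * g m * g n := by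
  have h := hpsd (∑ m ∈ T, Finsupp.single (⇑m) (g m))
  set ξ : (Fin d → ℕ) →₀ ℝ := ∑ m ∈ T, Finsupp.single (⇑m) (g m) with hξ
  have e : ∑ α ∈ ξ.support, ∑ β ∈ ξ.support, s (α + β) * ξ α * ξ β =
      ξ.sum fun α a => ξ.sum fun β b => s (α + β) * a * b := rfl
  rw [e] at h
  have e2 : ∀ (F : (Fin d → ℕ) → ℝ → ℝ), (∀ α, F α 0 = 0) →
      (∀ α a b, F α (a + b) = F α a + F α b) → ξ.sum F = ∑ m ∈ T, F (⇑m) (g m) := by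
    intro F h0 h1
    rw [hξ, ← Finsupp.sum_finsetSum_index h0 h1]
    exact Finset.sum_congr rfl fun m _ => Finsupp.sum_single_index (h0 _)
  rw [e2] at h
  · refine h.trans (le_of_eq (Finset.sum_congr rfl fun m _ => ?_))
    rw [e2]
    · simp
    · intros; ring
  · intro α; simp [Finsupp.sum]
  · intro α a b
    rw [← Finsupp.sum_add]
    exact Finsupp.sum_congr fun _ _ => by ring

lemma Lf_pos {d : ℕ} (s : (Fin d → ℕ) → ℝ)
    (hpsd : ∀ ξ : (Fin d → ℕ) →₀ ℝ,
      0 ≤ ∑ α ∈ ξ.support, ∑ β ∈ ξ.support, s (α + β) * ξ α * ξ β) (p : Pol d) :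
    0 ≤ (Lf s (conjP p * p)).re := by
  have h1 : conjP p * p = ∑ m ∈ p.support, ∑ n ∈ p.support,
      MvPolynomial.monomial (m + n) (conj (p.coeff m) * p.coeff n) := by
    have hp := p.as_sum
    have hc : conjP p = ∑ m ∈ p.support, MvPolynomial.monomial m (conj (p.coeff m)) := by
      conv_lhs => rw [hp]
      rw [map_sum]
      exact Finset.sum_congr rfl fun m _ => by rw [conjP, MvPolynomial.map_monomial]
    rw [hc]
    nth_rewrite 3 [hp]
    rw [Finset.sum_mul_sum]
    exact Finset.sum_congr rfl fun m _ => Finset.sum_congr rfl fun n _ => by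
      rw [MvPolynomial.monomial_mul]
  rw [h1, map_sum, Complex.re_sum]
  have h2 := psd_finset s hpsd p.support (fun m => (p.coeff m).re)
  have h3 := psd_finset s hpsd p.support (fun m => (p.coeff m).im)
  refine (add_nonneg h2 h3).trans (le_of_eq ?_)
  rw [← Finset.sum_add_distrib]
  refine Finset.sum_congr rfl fun m _ => ?_
  rw [map_sum, Complex.re_sum, ← Finset.sum_add_distrib]
  refine Finset.sum_congr rfl fun n _ => ?_
  rw [Lf_monomial]
  rw [Complex.re_mul_ofReal, Complex.mul_re, Complex.conj_re, Complex.conj_im, Finsupp.coe_add]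
  ring

lemma completion_of_core {E : Type} [AddCommGroup E] [Module ℂ E]
    (core : PreInnerProductSpace.Core ℂ E) :
    ∃ (H : Type) (_ : NormedAddCommGroup H) (_ : InnerProductSpace ℂ H) (_ : CompleteSpace H)
      (ι : E →ₗ[ℂ] H), DenseRange ι ∧ ∀ p q, ⟪ι p, ι q⟫_ℂ = core.inner p q := by
  let : SeminormedAddCommGroup E :=
    InnerProductSpace.Core.toSeminormedAddCommGroup (c := core)
  let : InnerProductSpace ℂ E := InnerProductSpace.ofCore core
  refine ⟨UniformSpace.Completion E, inferInstance, inferInstance, inferInstance,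
    (UniformSpace.Completion.toComplₗᵢ (𝕜 := ℂ) (E := E)).toLinearMap, ?_, ?_⟩
  · exact UniformSpace.Completion.denseRange_coe
  · intro p q
    exact UniformSpace.Completion.inner_coe p q

lemma gns {d : ℕ} (L : Pol d →ₗ[ℂ] ℂ) (h1 : ∀ p, L (conjP p) = conj (L p))
    (h2 : ∀ p, 0 ≤ (L (conjP p * p)).re) :
    ∃ (H : Type) (_ : NormedAddCommGroup H) (_ : InnerProductSpace ℂ H) (_ : CompleteSpace H)
      (ι : Pol d →ₗ[ℂ] H), DenseRange ι ∧ ∀ p q, ⟪ι p, ι q⟫_ℂ = L (conjP p * q) := by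
  let core : PreInnerProductSpace.Core ℂ (Pol d) :=
    { inner := fun p q => L (conjP p * q)
      conj_inner_symm := by
        intro p q
        rw [← h1, map_mul, conjP_conjP, mul_comm]
      re_inner_nonneg := h2
      add_left := by intro p q r; rw [map_add, add_mul, map_add]
      smul_left := by
        intro p q c
        rw [MvPolynomial.smul_eq_C_mul, map_mul conjP, conjP_C, mul_assoc,
          ← MvPolynomial.smul_eq_C_mul, map_smul]; rfl }
  exact completion_of_core core

section dens
variable {d : ℕ} {s : (Fin d → ℕ) → ℝ} {H : Type} [NormedAddCommGroup H] [InnerProductSpace ℂ H]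

lemma Lf_Xpow (s : (Fin d → ℕ) → ℝ) (j : Fin d) (k : ℕ) :
    Lf s (MvPolynomial.X j ^ k) = s (fun i => if i = j then k else 0) := by
  rw [MvPolynomial.X_pow_eq_monomial, Lf_monomial, one_mul]
  congr 2
  ext i
  rw [Finsupp.single_apply]
  simp [eq_comm]

lemma norm_sq_ι {ι : Pol d →ₗ[ℂ] H} (hι : ∀ p q, ⟪ι p, ι q⟫_ℂ = Lf s (conjP p * q)) (p : Pol d) :
    ‖ι p‖ ^ 2 = (Lf s (conjP p * p)).re := by
  rw [← hι]
  exact (inner_self_eq_norm_sq (𝕜 := ℂ) (ι p)).symm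

lemma ortho {ι : Pol d →ₗ[ℂ] H} (hι : ∀ p q, ⟪ι p, ι q⟫_ℂ = Lf s (conjP p * q)) (j : Fin d)
    (hcarl : ¬ Summable fun n : ℕ =>
      s (fun i => if i = j then 2 * (n + 1) else 0) ^ (-(1 / (2 * ((n : ℝ) + 1)))))
    (φ : H) (l : ℂ) (hl : l.im ≠ 0) (p : Pol d)
    (h : ∀ n : ℕ, ⟪φ, ι (MvPolynomial.X j ^ (n + 1) * p)⟫_ℂ =
      l * ⟪φ, ι (MvPolynomial.X j ^ n * p)⟫_ℂ) : ⟪φ, ι p⟫_ℂ = 0 := by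
  set t : ℕ → ℝ := fun n => s (fun i => if i = j then 2 * n else 0) with ht
  have htn : ∀ n, t n = ‖ι (MvPolynomial.X j ^ n)‖ ^ 2 := by
    intro n
    rw [norm_sq_ι hι, map_pow, conjP_X, ← pow_add, ← two_mul, Lf_Xpow, Complex.ofReal_re]
  have ht0 : ∀ n, 0 ≤ t n := fun n => by rw [htn]; positivity
  have hlc : ∀ n, t (n + 1) ^ 2 ≤ t n * t (n + 2) := by
    intro n
    have h1 := norm_inner_le_norm (𝕜 := ℂ) (ι (MvPolynomial.X j ^ n)) (ι (MvPolynomial.X j ^ (n + 2)))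
    rw [hι, map_pow, conjP_X, ← pow_add] at h1
    have e : n + (n + 2) = 2 * (n + 1) := by ring
    rw [e, Lf_Xpow, Complex.norm_real] at h1
    have h2 : t (n + 1) ≤ ‖ι (MvPolynomial.X j ^ n)‖ * ‖ι (MvPolynomial.X j ^ (n + 2))‖ :=
      (Real.le_norm_self _).trans h1
    rw [htn n, htn (n + 2), ← mul_pow]
    exact pow_le_pow_left₀ (ht0 _) h2 2
  have hp := tpos t ht0 hlc hcarl
  set B := ‖ι (conjP p * p)‖ with hB
  set C := √B + 1 with hC
  have hCpos : 0 < C := by positivity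
  have hd := doubling t ht0 hlc hcarl C hCpos
  have hbound : ∀ n, ‖ι (MvPolynomial.X j ^ n * p)‖ ≤ C * t (2 * n) ^ (1 / 4 : ℝ) := by
    intro n
    have h1 : ‖ι (MvPolynomial.X j ^ n * p)‖ ^ 2 ≤ √(t (2 * n)) * B := by
      rw [norm_sq_ι hι]
      have e : conjP (MvPolynomial.X j ^ n * p) * (MvPolynomial.X j ^ n * p) =
          conjP (MvPolynomial.X j ^ (2 * n)) * (conjP p * p) := by
        rw [map_mul, map_pow, map_pow, conjP_X]; ring
      rw [e, ← hι]
      refine (Complex.re_le_norm _).trans ((norm_inner_le_norm _ _).trans ?_)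
      rw [htn, Real.sqrt_sq (norm_nonneg _)]
    have h2 : (C * t (2 * n) ^ (1 / 4 : ℝ)) ^ 2 = √(t (2 * n)) * C ^ 2 := by
      rw [mul_pow, ← Real.rpow_natCast (t (2 * n) ^ (1 / 4 : ℝ)), ← Real.rpow_mul (ht0 _),
        Real.sqrt_eq_rpow]
      norm_num
      ring
    have h3 : B ≤ C ^ 2 := by
      have := Real.sq_sqrt (norm_nonneg (ι (conjP p * p)))
      have h4 := Real.sqrt_nonneg B
      rw [hC]; nlinarith
    refine le_of_sq_le_sq ?_ (mul_nonneg hCpos.le (Real.rpow_nonneg (ht0 _) _))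
    rw [h2]
    refine h1.trans ?_
    gcongr
  have := key (fun n => ι (MvPolynomial.X j ^ n * p)) (by
      intro m n
      rw [hι, hι]
      congr 1
      simp only [map_mul, map_pow, conjP_X]
      ring) φ l hl h
    (fun n => C * t (2 * (n + 1)) ^ (1 / 4 : ℝ)) (fun n => hbound (n + 1))
    (fun n => mul_pos hCpos (Real.rpow_pos_of_pos (hp _) _)) hd
  simpa using this

lemma dense_step [CompleteSpace H] {ι : Pol d →ₗ[ℂ] H}
    (hι : ∀ p q, ⟪ι p, ι q⟫_ℂ = Lf s (conjP p * q)) (j : Fin d)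
    (hcarl : ¬ Summable fun n : ℕ =>
      s (fun i => if i = j then 2 * (n + 1) else 0) ^ (-(1 / (2 * ((n : ℝ) + 1)))))
    (g : Pol d) (hg : DenseRange fun p => ι (g * p)) (l : ℂ) (hl : l.im ≠ 0) :
    DenseRange fun p => ι ((MvPolynomial.X j + MvPolynomial.C l) * g * p) := by
  let T : Pol d →ₗ[ℂ] H :=
    ι ∘ₗ LinearMap.mulLeft ℂ ((MvPolynomial.X j + MvPolynomial.C l) * g)
  have hT : (T.range : Submodule ℂ H)ᗮ = ⊥ := by
    rw [eq_bot_iff]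
    intro φ hφ
    rw [Submodule.mem_orthogonal'] at hφ
    have h0 : ∀ p, ⟪φ, ι (g * p)⟫_ℂ = 0 := by
      intro p
      apply ortho hι j hcarl φ (-l) (by simpa using hl)
      intro n
      have h1 := hφ (T (MvPolynomial.X j ^ n * p)) ⟨_, rfl⟩
      have e : T (MvPolynomial.X j ^ n * p) = ι (MvPolynomial.X j ^ (n + 1) * (g * p)) +
          l • ι (MvPolynomial.X j ^ n * (g * p)) := by
        rw [← map_smul, ← map_add, MvPolynomial.smul_eq_C_mul]
        show ι _ = ι _
        congr 1
        rw [LinearMap.mulLeft_apply]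
        ring
      rw [e, inner_add_right, inner_smul_right] at h1
      linear_combination h1
    have : ∀ x, ⟪φ, x⟫_ℂ = 0 := by
      intro x
      refine hg.induction_on (p := fun x => ⟪φ, x⟫_ℂ = 0) x ?_ (fun p => h0 p)
      exact isClosed_eq (by fun_prop) continuous_const
    exact (Submodule.mem_bot ℂ).2 (inner_self_eq_zero.1 (this φ))
  rw [← Submodule.topologicalClosure_eq_top_iff,
    ← Submodule.dense_iff_topologicalClosure_eq_top] at hT
  exact hT
end dens

section ops
variable {d : ℕ} {s : (Fin d → ℕ) → ℝ} {H : Type} [NormedAddCommGroup H] [InnerProductSpace ℂ H]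

lemma norm_shift {ι : Pol d →ₗ[ℂ] H} (hι : ∀ p q, ⟪ι p, ι q⟫_ℂ = Lf s (conjP p * q)) (j : Fin d)
    (l : ℂ) (hl : l = Complex.I ∨ l = -Complex.I) (p : Pol d) :
    ‖ι p‖ ≤ ‖ι ((MvPolynomial.X j + MvPolynomial.C l) * p)‖ := by
  have h1 : conjP ((MvPolynomial.X j + MvPolynomial.C l) * p) *
      ((MvPolynomial.X j + MvPolynomial.C l) * p) =
      conjP (MvPolynomial.X j * p) * (MvPolynomial.X j * p) + conjP p * p := by
    have hc : (starRingEnd ℂ) l = - l := by rcases hl with rfl | rfl <;> simp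
    have hll : (MvPolynomial.C l : Pol d) * MvPolynomial.C l = -1 := by
      rw [← MvPolynomial.C_mul]
      have : l * l = -1 := by rcases hl with rfl | rfl <;> simp
      rw [this]; simp
    simp only [map_mul, map_add, conjP_X, conjP_C, hc, map_neg]
    linear_combination (-(conjP p * p)) * hll
  have h2 : ‖ι p‖ ^ 2 ≤ ‖ι ((MvPolynomial.X j + MvPolynomial.C l) * p)‖ ^ 2 := by
    have h3 := norm_sq_ι hι (MvPolynomial.X j * p)
    rw [norm_sq_ι hι ((MvPolynomial.X j + MvPolynomial.C l) * p), h1, map_add, Complex.add_re,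
      ← h3, ← norm_sq_ι hι p]
    nlinarith [sq_nonneg ‖ι (MvPolynomial.X j * p)‖]
  exact le_of_sq_le_sq h2 (norm_nonneg _)

lemma resolvent [CompleteSpace H] {ι : Pol d →ₗ[ℂ] H} (hdense : DenseRange ι)
    (hι : ∀ p q, ⟪ι p, ι q⟫_ℂ = Lf s (conjP p * q)) (j : Fin d)
    (hcarl : ¬ Summable fun n : ℕ =>
      s (fun i => if i = j then 2 * (n + 1) else 0) ^ (-(1 / (2 * ((n : ℝ) + 1)))))
    (l : ℂ) (hl : l = Complex.I ∨ l = -Complex.I) :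
    ∃ R : H →L[ℂ] H, ∀ p, R (ι ((MvPolynomial.X j + MvPolynomial.C l) * p)) = ι p := by
  let e : Pol d →ₗ[ℂ] H := ι ∘ₗ LinearMap.mulLeft ℂ (MvPolynomial.X j + MvPolynomial.C l)
  have hd : DenseRange e := by
    have := dense_step hι j hcarl 1 (by simpa using hdense) l (by rcases hl with rfl | rfl <;> simp)
    simp only [mul_one] at this
    exact this
  refine ⟨ι.extendOfNorm e, fun p => ?_⟩
  exact LinearMap.extendOfNorm_eq hd ⟨1, fun x => by
    rw [one_mul]; exact norm_shift hι j l hl x⟩ p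

lemma clm_ext_dense {u : Pol d → H} (hu : DenseRange u) {A B : H →L[ℂ] H}
    (h : ∀ p, A (u p) = B (u p)) : A = B := by
  ext x
  refine hu.induction_on (p := fun x => A x = B x) x ?_ h
  exact isClosed_eq A.continuous B.continuous

lemma ops [CompleteSpace H] {ι : Pol d →ₗ[ℂ] H} (hdense : DenseRange ι)
    (hι : ∀ p q, ⟪ι p, ι q⟫_ℂ = Lf s (conjP p * q))
    (hcarl : ∀ j : Fin d, ¬ Summable fun n : ℕ =>
      s (fun i => if i = j then 2 * (n + 1) else 0) ^ (-(1 / (2 * ((n : ℝ) + 1))))) :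
    ∃ R : Fin d → H →L[ℂ] H,
      (∀ j p, R j (ι ((MvPolynomial.X j + MvPolynomial.C Complex.I) * p)) = ι p) ∧
      (∀ j k, R j * R k = R k * R j) ∧ (∀ j k, R j * star (R k) = star (R k) * R j) ∧
      ∀ j, R j - star (R j) + (2 * Complex.I) • (R j * star (R j)) = 0 := by
  choose R hR using fun j => resolvent hdense hι j (hcarl j) Complex.I (Or.inl rfl)
  choose S hS using fun j => resolvent hdense hι j (hcarl j) (-Complex.I) (Or.inr rfl)
  have hd1 : ∀ j l, l = Complex.I ∨ l = -Complex.I →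
      DenseRange fun p => ι ((MvPolynomial.X j + MvPolynomial.C l) * p) := by
    intro j l hl
    have := dense_step hι j (hcarl j) 1 (by simpa using hdense) l
      (by rcases hl with rfl | rfl <;> simp)
    simp only [mul_one] at this
    exact this
  have hd2 : ∀ j l k l', l = Complex.I ∨ l = -Complex.I → l' = Complex.I ∨ l' = -Complex.I →
      DenseRange fun p => ι ((MvPolynomial.X j + MvPolynomial.C l) *
        (MvPolynomial.X k + MvPolynomial.C l') * p) := by
    intro j l k l' hl hl'
    exact dense_step hι j (hcarl j) _ (hd1 k l' hl') l (by rcases hl with rfl | rfl <;> simp)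
  have hcomm : ∀ j l k l' (A B : H →L[ℂ] H), l = Complex.I ∨ l = -Complex.I →
      l' = Complex.I ∨ l' = -Complex.I →
      (∀ p, A (ι ((MvPolynomial.X j + MvPolynomial.C l) * p)) = ι p) →
      (∀ p, B (ι ((MvPolynomial.X k + MvPolynomial.C l') * p)) = ι p) → A * B = B * A := by
    intro j l k l' A B hl hl' hA hB
    refine clm_ext_dense (hd2 j l k l' hl hl') fun p => ?_
    show A (B _) = B (A _)
    rw [mul_assoc, hA, hB, mul_left_comm, hB, hA]
  have hstar : ∀ j, star (R j) = S j := by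
    intro j
    rw [ContinuousLinearMap.star_eq_adjoint]
    symm
    rw [ContinuousLinearMap.eq_adjoint_iff]
    intro x y
    refine (hd1 j (-Complex.I) (Or.inr rfl)).induction_on
      (p := fun x => ⟪S j x, y⟫_ℂ = ⟪x, R j y⟫_ℂ) x
      (isClosed_eq (by fun_prop) (by fun_prop)) fun p => ?_
    refine (hd1 j (Complex.I) (Or.inl rfl)).induction_on
      (p := fun y => ⟪S j (ι ((MvPolynomial.X j + MvPolynomial.C (-Complex.I)) * p)), y⟫_ℂ =
        ⟪ι ((MvPolynomial.X j + MvPolynomial.C (-Complex.I)) * p), R j y⟫_ℂ) y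
      (isClosed_eq (by fun_prop) (by fun_prop)) fun q => ?_
    rw [hS, hR, hι, hι]
    congr 1
    simp only [map_mul, map_add, conjP_X, conjP_C, map_neg, Complex.conj_I, neg_neg]
    ring
  refine ⟨R, hR, ?_, ?_, ?_⟩
  · intro j k
    exact hcomm j _ k _ _ _ (Or.inl rfl) (Or.inl rfl) (hR j) (hR k)
  · intro j k
    rw [hstar]
    exact hcomm j _ k _ _ _ (Or.inl rfl) (Or.inr rfl) (hR j) (hS k)
  · intro j
    rw [hstar]
    refine clm_ext_dense (hd2 j Complex.I j (-Complex.I) (Or.inl rfl) (Or.inr rfl)) fun p => ?_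
    have e1 : R j (ι ((MvPolynomial.X j + MvPolynomial.C Complex.I) *
        (MvPolynomial.X j + MvPolynomial.C (-Complex.I)) * p)) =
        ι ((MvPolynomial.X j + MvPolynomial.C (-Complex.I)) * p) := by
      rw [mul_assoc, hR]
    have e2 : S j (ι ((MvPolynomial.X j + MvPolynomial.C Complex.I) *
        (MvPolynomial.X j + MvPolynomial.C (-Complex.I)) * p)) =
        ι ((MvPolynomial.X j + MvPolynomial.C (Complex.I)) * p) := by
      rw [mul_assoc, mul_left_comm, hS]
    show R j _ - S j _ + (2 * Complex.I) • (R j (S j _)) = 0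
    rw [e1, e2, hR, ← map_smul, ← map_sub, ← map_add, MvPolynomial.smul_eq_C_mul]
    convert map_zero ι using 2
    simp only [map_mul, map_neg, map_ofNat]
    ring
end ops

section exi
variable {d : ℕ} {s : (Fin d → ℕ) → ℝ} {H : Type} [NormedAddCommGroup H] [InnerProductSpace ℂ H]

lemma trip [CompleteSpace H] {ι : Pol d →ₗ[ℂ] H} (Ψ : C(Fin d → ℂ, ℂ) →⋆ₐ[ℂ] (H →L[ℂ] H))
    (A : Fin d → C(Fin d → ℂ, ℂ)) (a b : Fin d → Pol d)
    (h : ∀ j p, Ψ (A j) (ι (a j * p)) = ι (b j * p)) (n : Fin d → ℕ) :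
    Ψ (∏ j, A j ^ n j) (ι (∏ j, a j ^ n j)) = ι (∏ j, b j ^ n j) := by
  let M : Submonoid (C(Fin d → ℂ, ℂ) × Pol d × Pol d) :=
    { carrier := {x | ∀ p, Ψ x.1 (ι (x.2.1 * p)) = ι (x.2.2 * p)}
      one_mem' := fun p => by simp
      mul_mem' := by
        intro x y hx hy p
        simp only [Prod.fst_mul, Prod.snd_mul, map_mul]
        show Ψ x.1 (Ψ y.1 _) = _
        rw [mul_comm x.2.1, mul_assoc, hy, mul_left_comm, hx, mul_assoc] }
  have hm : (∏ j, (A j, a j, b j) ^ n j) ∈ M :=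
    Submonoid.prod_mem _ fun j _ => Submonoid.pow_mem _ (show (A j, a j, b j) ∈ M from fun p => h j p) _
  have := hm 1
  simpa [Prod.fst_prod, Prod.snd_prod] using this

lemma rel_pt (z : ℂ) (h : z - conj z + 2 * Complex.I * (z * conj z) = 0) :
    conj z * (1 - Complex.I * z) = ((‖z‖ ^ 2 * (1 / z).re : ℝ) : ℂ) := by
  by_cases hz : z = 0
  · simp [hz]
  have hn : (‖z‖ ^ 2 : ℝ) ≠ 0 := by simpa using hz
  have h1 : (‖z‖ ^ 2 * (1 / z).re : ℝ) = z.re := by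
    rw [one_div, Complex.inv_re, Complex.normSq_eq_norm_sq]
    field_simp
  rw [h1]
  have h2 : (z.re : ℂ) = (z + conj z) / 2 := by
    rw [Complex.add_conj]; push_cast; ring
  rw [h2]
  linear_combination (-1/2) * h

lemma existence [CompleteSpace H] {ι : Pol d →ₗ[ℂ] H} (hdense : DenseRange ι)
    (hι : ∀ p q, ⟪ι p, ι q⟫_ℂ = Lf s (conjP p * q))
    (hcarl : ∀ j : Fin d, ¬ Summable fun n : ℕ =>
      s (fun i => if i = j then 2 * (n + 1) else 0) ^ (-(1 / (2 * ((n : ℝ) + 1))))) :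
    ∃ μ : Measure (Fin d → ℝ), IsFiniteMeasure μ ∧ ∀ α : Fin d → ℕ,
        Integrable (fun x : Fin d → ℝ => ∏ i, x i ^ α i) μ ∧
        s α = ∫ x : Fin d → ℝ, ∏ i, x i ^ α i ∂μ := by
  obtain ⟨R, hR, hc, hs, hrel⟩ := ops hdense hι hcarl
  obtain ⟨Ψ, hΨ, hμ⟩ := spectral R hc hs
  choose μ hfin hμ using hμ
  -- a.e. relation
  have hae : ∀ v, ∀ᵐ z ∂(μ v), ∀ j, z j - conj (z j) + 2 * Complex.I * (z j * conj (z j)) = 0 := by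
    intro v
    rw [ae_all_iff]
    intro j
    set f : C(Fin d → ℂ, ℂ) :=
      coordC d j - star (coordC d j) + (2 * Complex.I) • (coordC d j * star (coordC d j)) with hf
    have hf0 : Ψ f = 0 := by
      rw [hf]
      simp only [map_add, map_sub, map_smul, map_mul, map_star, hΨ]
      exact hrel j
    have h1 := hμ v (star f * f)
    have h2 : ∫ z, ‖f z‖ ^ 2 ∂(μ v) = 0 := by
      have h3 := h1.2
      rw [map_mul, hf0, mul_zero] at h3
      have h4 : ∀ z, (star f * f) z = ((‖f z‖ ^ 2 : ℝ) : ℂ) := by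
        intro z
        rw [ContinuousMap.mul_apply, ContinuousMap.star_apply]
        simpa using Complex.conj_mul' (f z)
      simp only [h4] at h3
      rw [integral_complex_ofReal] at h3
      simpa using h3
    have h5 : Integrable (fun z => ‖f z‖ ^ 2) (μ v) := by
      have := h1.1.norm
      refine this.congr (Filter.Eventually.of_forall fun z => ?_)
      simp [ContinuousMap.mul_apply, ContinuousMap.star_apply, sq]
    rw [integral_eq_zero_iff_of_nonneg (fun z => by positivity) h5] at h2
    filter_upwards [h2] with z hz
    have hz' : f z = 0 := by simpa using hz
    rw [hf] at hz'
    simpa [coordC] using hz'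
  set Ω := ι 1 with hΩ
  have hfinΩ := hfin Ω
  have hmeas : Measurable (fun z : Fin d → ℂ => fun j => (1 / z j).re) := by fun_prop
  refine ⟨(μ Ω).map fun z j => (1 / z j).re, Measure.isFiniteMeasure_map _ _, fun α => ?_⟩
  set η := ι (∏ j, (MvPolynomial.X j + MvPolynomial.C Complex.I) ^ α j) with hη
  have hfinη := hfin η
  set w : C(Fin d → ℂ, ℂ) := ∏ j, (coordC d j) ^ α j with hw
  set B : C(Fin d → ℂ, ℂ) := ∏ j, (1 - Complex.I • coordC d j) ^ α j with hB
  have hwη : Ψ w η = Ω := by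
    have := trip (ι := ι) Ψ (coordC d) (fun j => MvPolynomial.X j + MvPolynomial.C Complex.I)
      (fun _ => 1) (fun j p => by rw [hΨ, hR, one_mul]) α
    simpa using this
  have hBη : Ψ B η = ι (∏ j, MvPolynomial.X j ^ α j) := by
    refine trip (ι := ι) Ψ (fun j => 1 - Complex.I • coordC d j)
      (fun j => MvPolynomial.X j + MvPolynomial.C Complex.I)
      (fun j => MvPolynomial.X j) (fun j p => ?_) α
    rw [map_sub, map_smul, hΨ, map_one]
    show ι _ - Complex.I • R j _ = _
    rw [hR, ← map_smul, ← map_sub, MvPolynomial.smul_eq_C_mul]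
    congr 1
    ring
  have hadj : ∀ f g : C(Fin d → ℂ, ℂ), ⟪Ψ f η, Ψ g η⟫_ℂ = ⟪η, Ψ (star f * g) η⟫_ℂ := by
    intro f g
    rw [map_mul, map_star, ContinuousLinearMap.star_eq_adjoint]
    exact (ContinuousLinearMap.adjoint_inner_right _ _ _).symm
  -- measure identity
  let dn : (Fin d → ℂ) → NNReal := fun z => ‖w z‖₊ ^ 2
  have hdn : Measurable dn := by
    have := w.continuous.measurable
    fun_prop
  have hww : ∀ z, (star w * w) z = ((‖w z‖ ^ 2 : ℝ) : ℂ) := by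
    intro z
    rw [ContinuousMap.mul_apply, ContinuousMap.star_apply]
    simpa using Complex.conj_mul' (w z)
  have hint : Integrable (fun z => ‖w z‖ ^ 2) (μ η) := by
    refine (hμ η (star w * w)).1.norm.congr (Filter.Eventually.of_forall fun z => ?_)
    beta_reduce
    rw [hww]; simp
  have hfd : IsFiniteMeasure ((μ η).withDensity fun z => (dn z : ENNReal)) := by
    refine isFiniteMeasure_withDensity ?_
    have h1 := hint.2
    rw [hasFiniteIntegral_iff_enorm] at h1
    refine (lt_of_eq_of_lt (lintegral_congr fun z => ?_) h1).ne
    simp [dn, enorm_eq_nnnorm]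
  have hmeq : μ Ω = (μ η).withDensity fun z => (dn z : ENNReal) := by
    apply ext_of_forall_integral_eq_of_IsFiniteMeasure
    intro f
    rw [integral_withDensity_eq_integral_smul hdn]
    have e1 := (hμ Ω (toCx f.toContinuousMap)).2
    have e2 := (hμ η (star w * (toCx f.toContinuousMap * w))).2
    have e3 : ⟪Ω, Ψ (toCx f.toContinuousMap) Ω⟫_ℂ =
        ⟪η, Ψ (star w * (toCx f.toContinuousMap * w)) η⟫_ℂ := by
      rw [← hadj, hwη, map_mul Ψ _ w]
      show _ = ⟪Ω, Ψ _ (Ψ w η)⟫_ℂ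
      rw [hwη]
    rw [e3, ← e2] at e1
    have e4 : ∀ z, (star w * (toCx f.toContinuousMap * w)) z = ((dn z • f z : ℝ) : ℂ) := by
      intro z
      have : star w * (toCx f.toContinuousMap * w) = toCx f.toContinuousMap * (star w * w) := by ring
      rw [this, ContinuousMap.mul_apply, hww]
      simp [toCx, dn, NNReal.smul_def]
      ring
    have e5 : ∀ z, toCx f.toContinuousMap z = ((f z : ℝ) : ℂ) := fun z => rfl
    simp only [e4, e5] at e1
    rw [integral_complex_ofReal, integral_complex_ofReal] at e1
    exact_mod_cast e1
  -- the pointwise identity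
  have hpt : ∀ᵐ z ∂(μ η), (star w * B) z = dn z • ((∏ i, (1 / z i).re ^ α i : ℝ) : ℂ) := by
    filter_upwards [hae η] with z hz
    have e1 : (star w * B) z = ∏ j, (conj (z j) * (1 - Complex.I * z j)) ^ α j := by
      rw [ContinuousMap.mul_apply, ContinuousMap.star_apply, hw, hB]
      simp only [ContinuousMap.prod_apply, ContinuousMap.pow_apply, coordC, mul_pow,
        Finset.prod_mul_distrib]
      simp
    have e2 : dn z = ∏ j, (‖z j‖₊ ^ 2) ^ α j := by
      simp only [dn, hw, ContinuousMap.prod_apply, ContinuousMap.pow_apply, coordC]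
      simp [nnnorm_prod, ← Finset.prod_pow, pow_right_comm]
    rw [e1, e2, NNReal.smul_def, Complex.real_smul, ← Complex.ofReal_mul]
    push_cast
    rw [← Finset.prod_mul_distrib]
    refine Finset.prod_congr rfl fun j _ => ?_
    rw [← mul_pow, rel_pt _ (hz j)]
    push_cast
    rfl
  have hI : Integrable (fun z : Fin d → ℂ => ((∏ i, (1 / z i).re ^ α i : ℝ) : ℂ)) (μ Ω) := by
    rw [hmeq, integrable_withDensity_iff_integrable_smul hdn]
    exact (hμ η (star w * B)).1.congr hpt
  have hval : ∫ z, ((∏ i, (1 / z i).re ^ α i : ℝ) : ℂ) ∂(μ Ω) = s α := by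
    rw [hmeq, integral_withDensity_eq_integral_smul hdn, ← integral_congr_ae hpt,
      (hμ η (star w * B)).2, ← hadj, hwη, hBη, hι]
    have : (∏ j, MvPolynomial.X j ^ α j : Pol d) =
        MvPolynomial.monomial (Finsupp.equivFunOnFinite.symm α) 1 := by
      rw [MvPolynomial.monomial_eq]
      simp [Finsupp.prod_fintype]
    rw [map_one, one_mul, this, Lf_monomial, one_mul]
    rfl
  have hI' : Integrable (fun z : Fin d → ℂ => ∏ i, (1 / z i).re ^ α i) (μ Ω) := by
    refine hI.re.congr (Filter.Eventually.of_forall fun z => ?_)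
    exact Complex.ofReal_re _
  have hm2 : AEStronglyMeasurable (fun x : Fin d → ℝ => ∏ i, x i ^ α i)
      ((μ Ω).map fun z j => (1 / z j).re) := by
    refine Continuous.aestronglyMeasurable ?_
    fun_prop
  refine ⟨(integrable_map_measure hm2 hmeas.aemeasurable).2 hI', ?_⟩
  rw [integral_map hmeas.aemeasurable hm2]
  rw [integral_complex_ofReal] at hval
  exact_mod_cast hval.symm
end exi

section uni
variable {d : ℕ} {s : (Fin d → ℕ) → ℝ} {H : Type} [NormedAddCommGroup H] [InnerProductSpace ℂ H]

def Rep (s : (Fin d → ℕ) → ℝ) (m : Measure (Fin d → ℝ)) : Prop :=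
  ∀ α : Fin d → ℕ, Integrable (fun x : Fin d → ℝ => ∏ i, x i ^ α i) m ∧
        s α = ∫ x : Fin d → ℝ, ∏ i, x i ^ α i ∂m

noncomputable def ev (p : Pol d) (x : Fin d → ℝ) : ℂ := MvPolynomial.eval (fun i => (x i : ℂ)) p

lemma ev_cont (p : Pol d) : Continuous (ev p) := by
  unfold ev
  exact (MvPolynomial.continuous_eval p).comp (by fun_prop)

lemma ev_add (p q : Pol d) (x) : ev (p + q) x = ev p x + ev q x := by simp [ev]
lemma ev_sub (p q : Pol d) (x) : ev (p - q) x = ev p x - ev q x := by simp [ev]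
lemma ev_mul (p q : Pol d) (x) : ev (p * q) x = ev p x * ev q x := by simp [ev]
lemma ev_C (c : ℂ) (x) : ev (MvPolynomial.C c : Pol d) x = c := by simp [ev]
lemma ev_X (j : Fin d) (x) : ev (MvPolynomial.X j : Pol d) x = x j := by simp [ev]
lemma ev_monomial (n : Fin d →₀ ℕ) (c : ℂ) (x : Fin d → ℝ) :
    ev (MvPolynomial.monomial n c) x = c * ((∏ i, x i ^ n i : ℝ) : ℂ) := by
  simp [ev, MvPolynomial.eval_monomial, Finsupp.prod_fintype]
lemma ev_conj (p : Pol d) (x) : ev (conjP p) x = conj (ev p x) := by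
  induction p using MvPolynomial.induction_on' with
  | monomial m c =>
    rw [conjP, MvPolynomial.map_monomial, ev_monomial, ev_monomial, map_mul, Complex.conj_ofReal]
  | add p q hp hq => rw [map_add, ev_add, hp, hq, ev_add, map_add]

lemma Rep.int {m : Measure (Fin d → ℝ)} (hm : Rep s m) (p : Pol d) :
    Integrable (ev p) m ∧ ∫ x, ev p x ∂m = Lf s p := by
  induction p using MvPolynomial.induction_on' with
  | monomial n c =>
    have h := hm n
    have e : ev (MvPolynomial.monomial n c) =
        fun x : Fin d → ℝ => c * ((∏ i, x i ^ n i : ℝ) : ℂ) := funext fun x => ev_monomial n c x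
    constructor
    · rw [e]
      exact h.1.ofReal.const_mul c
    · rw [e, integral_const_mul, integral_complex_ofReal, Lf_monomial, h.2]
  | add p q hp hq =>
    have e : ev (p + q) = ev p + ev q := funext fun x => ev_add p q x
    refine ⟨e ▸ hp.1.add hq.1, ?_⟩
    simp only [ev_add]
    rw [integral_add hp.1 hq.1, hp.2, hq.2, map_add]

lemma Rep.finite {m : Measure (Fin d → ℝ)} (hm : Rep s m) : IsFiniteMeasure m := by
  have := (hm 0).1
  simp only [Pi.zero_apply, pow_zero, Finset.prod_const_one] at this
  exact (integrable_const_iff_isFiniteMeasure (one_ne_zero)).1 this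

lemma Rep.norm {ι : Pol d →ₗ[ℂ] H} (hι : ∀ p q, ⟪ι p, ι q⟫_ℂ = Lf s (conjP p * q))
    {m : Measure (Fin d → ℝ)} (hm : Rep s m) (p : Pol d) :
    eLpNorm (ev p) 2 m = ENNReal.ofReal ‖ι p‖ := by
  have h := hm.int (conjP p * p)
  have e : ∀ x, ev (conjP p * p) x = ((‖ev p x‖ ^ 2 : ℝ) : ℂ) := by
    intro x
    rw [ev_mul, ev_conj]
    simpa using Complex.conj_mul' (ev p x)
  have h1 : Integrable (fun x => ‖ev p x‖ ^ 2) m := by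
    refine h.1.norm.congr (Filter.Eventually.of_forall fun x => ?_)
    beta_reduce
    rw [e]; simp
  have h2 : ∫ x, ‖ev p x‖ ^ 2 ∂m = ‖ι p‖ ^ 2 := by
    rw [norm_sq_ι hι, ← h.2]
    simp only [e]
    rw [integral_complex_ofReal, Complex.ofReal_re]
  have hmem : MemLp (ev p) 2 m :=
    (memLp_two_iff_integrable_sq_norm (ev_cont p).aestronglyMeasurable).2 h1
  rw [hmem.eLpNorm_eq_integral_rpow_norm (by norm_num) (by norm_num)]
  congr 1
  have : ∀ x, ‖ev p x‖ ^ (ENNReal.toReal 2) = ‖ev p x‖ ^ 2 := by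
    intro x; rw [← Real.rpow_natCast]; norm_num
  simp only [this]
  rw [h2, ← Real.sqrt_sq (norm_nonneg (ι p)), Real.sqrt_eq_rpow]
  rw [← Real.sqrt_eq_rpow, Real.sqrt_sq (norm_nonneg (ι p))]
  norm_num [← Real.sqrt_eq_rpow]

open BoundedContinuousFunction in
def Good (s : (Fin d → ℕ) → ℝ) (f : (Fin d → ℝ) →ᵇ ℂ) : Prop :=
  ∀ p : Pol d, ∀ ε : ℝ, 0 < ε → ∃ q : Pol d, ∀ m, Rep s m →
    eLpNorm (fun x => f x * ev p x - ev q x) 2 m ≤ ENNReal.ofReal ε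

open BoundedContinuousFunction in
lemma good_meas (f : (Fin d → ℝ) →ᵇ ℂ) (p q : Pol d) (m : Measure (Fin d → ℝ)) :
    AEStronglyMeasurable (fun x => f x * ev p x - ev q x) m := by
  refine Continuous.aestronglyMeasurable ?_
  have := ev_cont p
  have := ev_cont q
  fun_prop

open BoundedContinuousFunction in
lemma good_add {f g : (Fin d → ℝ) →ᵇ ℂ} (hf : Good s f) (hg : Good s g) : Good s (f + g) := by
  intro p ε hε
  obtain ⟨q1, h1⟩ := hf p (ε / 2) (by positivity)
  obtain ⟨q2, h2⟩ := hg p (ε / 2) (by positivity)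
  refine ⟨q1 + q2, fun m hm => ?_⟩
  have e : (fun x => (f + g) x * ev p x - ev (q1 + q2) x) =
      (fun x => f x * ev p x - ev q1 x) + (fun x => g x * ev p x - ev q2 x) := by
    funext x
    simp only [Pi.add_apply, ev_add, BoundedContinuousFunction.add_apply]
    ring
  rw [e]
  refine (eLpNorm_add_le (good_meas f p q1 m) (good_meas g p q2 m) (by norm_num)).trans ?_
  refine (add_le_add (h1 m hm) (h2 m hm)).trans ?_
  rw [← ENNReal.ofReal_add (by positivity) (by positivity), add_halves]

open BoundedContinuousFunction in
lemma good_mul {f g : (Fin d → ℝ) →ᵇ ℂ} (hf : Good s f) (hg : Good s g) : Good s (f * g) := by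
  intro p ε hε
  have hn : 0 < ‖f‖ + 1 := by positivity
  obtain ⟨q1, h1⟩ := hg p (ε / 2 / (‖f‖ + 1)) (by positivity)
  obtain ⟨q2, h2⟩ := hf q1 (ε / 2) (by positivity)
  refine ⟨q2, fun m hm => ?_⟩
  have e : (fun x => (f * g) x * ev p x - ev q2 x) =
      (fun x => f x * (g x * ev p x - ev q1 x)) + (fun x => f x * ev q1 x - ev q2 x) := by
    funext x
    simp only [Pi.add_apply, BoundedContinuousFunction.mul_apply]
    ring
  rw [e]
  refine (eLpNorm_add_le (f.continuous.aestronglyMeasurable.mul (good_meas g p q1 m))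
    (good_meas f q1 q2 m) (by norm_num)).trans ?_
  have h3 : eLpNorm (fun x => f x * (g x * ev p x - ev q1 x)) 2 m ≤ ENNReal.ofReal (ε / 2) := by
    refine (eLpNorm_le_mul_eLpNorm_of_ae_le_mul (c := ‖f‖ + 1)
      (g := fun x => g x * ev p x - ev q1 x) (Filter.Eventually.of_forall fun x => ?_) 2).trans ?_
    · rw [norm_mul]
      have := f.norm_coe_le_norm x
      gcongr
      linarith
    · refine (mul_le_mul_right (h1 m hm) _).trans ?_
      rw [← ENNReal.ofReal_mul hn.le]
      apply ENNReal.ofReal_le_ofReal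
      field_simp
      exact le_rfl
  refine (add_le_add h3 (h2 m hm)).trans ?_
  rw [← ENNReal.ofReal_add (by positivity) (by positivity), add_halves]

open BoundedContinuousFunction in
lemma good_const (c : ℂ) : Good s (algebraMap ℂ ((Fin d → ℝ) →ᵇ ℂ) c) := by
  intro p ε hε
  refine ⟨MvPolynomial.C c * p, fun m hm => ?_⟩
  have e : (fun x => (algebraMap ℂ ((Fin d → ℝ) →ᵇ ℂ) c) x * ev p x -
      ev (MvPolynomial.C c * p) x) = 0 := by
    funext x
    rw [ev_mul, ev_C, BoundedContinuousFunction.algebraMap_apply]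
    simp
  rw [e]; simp

open BoundedContinuousFunction in
lemma good_star {f : (Fin d → ℝ) →ᵇ ℂ} (hf : Good s f) : Good s (star f) := by
  intro p ε hε
  obtain ⟨q, h⟩ := hf (conjP p) ε hε
  refine ⟨conjP q, fun m hm => ?_⟩
  refine le_trans (le_of_eq ?_) (h m hm)
  refine eLpNorm_congr_norm_ae (Filter.Eventually.of_forall fun x => ?_)
  rw [← RCLike.norm_conj]
  congr 1
  simp [ev_conj]

open BoundedContinuousFunction in
noncomputable def rf (j : Fin d) : (Fin d → ℝ) →ᵇ ℂ :=
  BoundedContinuousFunction.ofNormedAddCommGroup (fun x => 1 / ((x j : ℂ) + Complex.I))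
    (by
      refine Continuous.div continuous_const (by fun_prop) fun x h => ?_
      have := congrArg Complex.im h
      simp at this) 1 (by
      intro x
      rw [norm_div, norm_one]
      refine div_le_one_of_le₀ ?_ (norm_nonneg _)
      have := Complex.abs_im_le_norm ((x j : ℂ) + Complex.I)
      simpa using this)

lemma rf_apply (j : Fin d) (x : Fin d → ℝ) : rf j x = 1 / ((x j : ℂ) + Complex.I) := rfl

lemma xI_ne (t : ℝ) : (t : ℂ) + Complex.I ≠ 0 := fun h => by
  have := congrArg Complex.im h
  simp at this

lemma good_rf [CompleteSpace H] {ι : Pol d →ₗ[ℂ] H} (hdense : DenseRange ι)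
    (hι : ∀ p q, ⟪ι p, ι q⟫_ℂ = Lf s (conjP p * q)) (j : Fin d)
    (hcarl : ¬ Summable fun n : ℕ =>
      s (fun i => if i = j then 2 * (n + 1) else 0) ^ (-(1 / (2 * ((n : ℝ) + 1))))) :
    Good s (rf j) := by
  intro p ε hε
  have hd := dense_step hι j hcarl 1 (by simpa using hdense) Complex.I (by simp)
  simp only [mul_one] at hd
  obtain ⟨q, hq⟩ := hd.exists_dist_lt (ι p) hε
  refine ⟨q, fun m hm => ?_⟩
  rw [dist_eq_norm, ← map_sub] at hq
  refine le_trans ?_ ((hm.norm hι _).le.trans (ENNReal.ofReal_le_ofReal hq.le))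
  refine eLpNorm_mono fun x => ?_
  have e : rf j x * ev p x - ev q x =
      rf j x * ev (p - (MvPolynomial.X j + MvPolynomial.C Complex.I) * q) x := by
    rw [ev_sub, ev_mul, ev_add, ev_X, ev_C, rf_apply]
    have := xI_ne (x j)
    field_simp
  rw [e, norm_mul]
  refine mul_le_of_le_one_left (norm_nonneg _) ?_
  rw [rf_apply, norm_div, norm_one]
  refine div_le_one_of_le₀ ?_ (norm_nonneg _)
  have := Complex.abs_im_le_norm ((x j : ℂ) + Complex.I)
  simpa using this

open BoundedContinuousFunction in
lemma good_int {f : (Fin d → ℝ) →ᵇ ℂ} (hf : Good s f) {m1 m2 : Measure (Fin d → ℝ)}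
    (h1 : Rep s m1) (h2 : Rep s m2) : ∫ x, f x ∂m1 = ∫ x, f x ∂m2 := by
  have key1 : ∀ m, Rep s m → ∀ ε : ℝ, 0 < ε → ∀ q : Pol d,
      eLpNorm (fun x => f x * ev 1 x - ev q x) 2 m ≤ ENNReal.ofReal ε →
      ‖∫ x, f x ∂m - Lf s q‖ ≤ ε * (m Set.univ ^ (1 / 2 : ℝ)).toReal := by
    intro m hm ε hε q hq
    have := hm.finite
    have hfi : Integrable (fun x => f x) m := f.integrable m
    rw [← (hm.int q).2, ← integral_sub hfi (hm.int q).1]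
    have a1 := enorm_integral_le_lintegral_enorm (μ := m) (fun x => f x - ev q x)
    rw [← eLpNorm_one_eq_lintegral_enorm] at a1
    have a2 := eLpNorm_le_eLpNorm_mul_rpow_measure_univ (μ := m) (p := 1) (q := 2)
      (f := fun x => f x - ev q x) (by norm_num) (hfi.sub (hm.int q).1).aestronglyMeasurable
    have e : (fun x => f x * ev 1 x - ev q x) = fun x => f x - ev q x := by
      funext x; simp [ev]
    rw [e] at hq
    have hexp : (1 / ENNReal.toReal 1 - 1 / ENNReal.toReal 2 : ℝ) = 1 / 2 := by norm_num
    rw [hexp] at a2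
    have a3 := a1.trans (a2.trans (mul_le_mul_left hq _))
    have hfin : m Set.univ ^ (1 / 2 : ℝ) ≠ ⊤ :=
      ENNReal.rpow_ne_top_of_nonneg (by norm_num) (measure_ne_top _ _)
    have a4 := ENNReal.toReal_mono (ENNReal.mul_ne_top ENNReal.ofReal_ne_top hfin) a3
    rwa [toReal_enorm, ENNReal.toReal_mul, ENNReal.toReal_ofReal hε.le] at a4
  set D1 := (m1 Set.univ ^ (1 / 2 : ℝ)).toReal with hD1
  set D2 := (m2 Set.univ ^ (1 / 2 : ℝ)).toReal with hD2
  have hD1' : 0 ≤ D1 := ENNReal.toReal_nonneg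
  have hD2' : 0 ≤ D2 := ENNReal.toReal_nonneg
  rw [← sub_eq_zero, ← norm_le_zero_iff]
  refine le_of_forall_pos_le_add fun δ hδ => ?_
  obtain ⟨q, hq⟩ := hf 1 (δ / (D1 + D2 + 1)) (by positivity)
  have b1 := key1 m1 h1 _ (by positivity) q (hq m1 h1)
  have b2 := key1 m2 h2 _ (by positivity) q (hq m2 h2)
  have e : ∫ x, f x ∂m1 - ∫ x, f x ∂m2 =
      (∫ x, f x ∂m1 - Lf s q) - (∫ x, f x ∂m2 - Lf s q) := by ring
  rw [e, zero_add]
  refine (norm_sub_le _ _).trans ((add_le_add b1 b2).trans ?_)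
  rw [← hD1, ← hD2, ← mul_add, div_mul_eq_mul_div, div_le_iff₀ (by positivity)]
  nlinarith

open BoundedContinuousFunction in
lemma uniqueness [CompleteSpace H] {ι : Pol d →ₗ[ℂ] H} (hdense : DenseRange ι)
    (hι : ∀ p q, ⟪ι p, ι q⟫_ℂ = Lf s (conjP p * q))
    (hcarl : ∀ j : Fin d, ¬ Summable fun n : ℕ =>
      s (fun i => if i = j then 2 * (n + 1) else 0) ^ (-(1 / (2 * ((n : ℝ) + 1)))))
    {m1 m2 : Measure (Fin d → ℝ)} (h1 : Rep s m1) (h2 : Rep s m2) : m1 = m2 := by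
  have := h1.finite
  have := h2.finite
  have hgood : ∀ g ∈ StarAlgebra.adjoin ℂ (Set.range (rf (d := d))), Good s g := by
    intro g hg
    induction hg using StarAlgebra.adjoin_induction with
    | mem x h => obtain ⟨j, rfl⟩ := h; exact good_rf hdense hι j (hcarl j)
    | algebraMap r => exact good_const r
    | add x y _ _ hx hy => exact good_add hx hy
    | mul x y _ _ hx hy => exact good_mul hx hy
    | star x _ hx => exact good_star hx
  refine ext_of_forall_mem_subalgebra_integral_eq_of_polish (𝕜 := ℂ)
    (A := StarAlgebra.adjoin ℂ (Set.range (rf (d := d)))) ?_ fun g hg => good_int (hgood g hg) h1 h2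
  intro x y hxy
  obtain ⟨j, hj⟩ := Function.ne_iff.1 hxy
  refine ⟨rf j, ⟨(rf j).toContinuousMap, ?_, rfl⟩, ?_⟩
  · exact ⟨rf j, StarAlgebra.subset_adjoin ℂ _ ⟨j, rfl⟩, rfl⟩
  · intro h
    rw [rf_apply, rf_apply, one_div, one_div, inv_inj, add_left_inj] at h
    exact hj (by exact_mod_cast h)
end uni

end Nuss

/-- Nussbaum's theorem: a positive semidefinite multisequence satisfying the multivariate
Carleman condition is a determinate moment sequence. -/
theorem nussbaum (d : ℕ) (s : (Fin d → ℕ) → ℝ)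
    (hpsd : ∀ ξ : (Fin d → ℕ) →₀ ℝ,
      0 ≤ ∑ α ∈ ξ.support, ∑ β ∈ ξ.support, s (α + β) * ξ α * ξ β)
    (hcarl : ∀ j : Fin d, ¬ Summable fun n : ℕ =>
      s (fun i => if i = j then 2 * (n + 1) else 0) ^ (-(1 / (2 * ((n : ℝ) + 1))))) :
    ∃! μ : Measure (Fin d → ℝ), IsRadon μ ∧
      ∀ α : Fin d → ℕ,
        Integrable (fun x : Fin d → ℝ => ∏ i, x i ^ α i) μ ∧
        s α = ∫ x : Fin d → ℝ, ∏ i, x i ^ α i ∂μ := by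
  obtain ⟨H, i1, i2, i3, ι, hd, hι⟩ :=
    Nuss.gns (Nuss.Lf s) (Nuss.Lf_conj s) (Nuss.Lf_pos s hpsd)
  obtain ⟨μ, hfin, hμ⟩ := Nuss.existence hd hι hcarl
  refine ⟨μ, ⟨⟨inferInstance, inferInstance⟩, hμ⟩, fun ν hν => ?_⟩
  exact Nuss.uniqueness hd hι hcarl hν.2 hμ
end
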